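/- arXiv:1410.2005 — 6 statements merged into one kernel-verified Lean document; each statement's English description precedes it below -/
import Mathlib

section
/- Let n ≥ 2, let S ⊆ ℝ^n be a Borel measurable set symmetric about the origin with Lebesgue measure V, and let k, α be integers with 1 ≤ k ≤ α ≤ √(n/2). Then |∫_{X_n} Σ_{h=k}^{α} (−1)^{h−k} C(h−1,k−1) ρ_{S',h}(L) dμ_n(L) − Σ_{h=k}^{α} (−1)^{h−k} (V/2)^h / (h·(h−k)!·(k−1)!)| ≤ (12/k!)·√(n/2)·(0.999)^n·(V/2+1)^{√(n/2)}. -/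
open MeasureTheory Matrix
open scoped Nat Classical

noncomputable section

abbrev SLR (n : ℕ) := Matrix.SpecialLinearGroup (Fin n) ℝ

instance (n : ℕ) : MeasurableSpace (SLR n) :=
  MeasurableSpace.comap (fun g : SLR n => (g : Matrix (Fin n) (Fin n) ℝ))
    (inferInstanceAs (MeasurableSpace (Fin n → Fin n → ℝ)))

/-- The image of SL_n(ℤ) in SL_n(ℝ), as a subgroup. -/
def SLZ (n : ℕ) : Subgroup (SLR n) :=
  (Matrix.SpecialLinearGroup.map (Int.castRingHom ℝ)).range

/-- The space of lattices `X_n = SL_n(ℤ) \ SL_n(ℝ)` (space of right cosets). -/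
def LatSpace (n : ℕ) := Quotient (QuotientGroup.rightRel (SLZ n))

instance (n : ℕ) : MeasurableSpace (LatSpace n) :=
  inferInstanceAs (MeasurableSpace (Quotient _))

/-- The coset of `g`. -/
def latMk (n : ℕ) (g : SLR n) : LatSpace n :=
  Quotient.mk (QuotientGroup.rightRel (SLZ n)) g

/-- Right translation action of `SL_n(ℝ)` on `X_n`. -/
def rTranslate (n : ℕ) (a : SLR n) (x : LatSpace n) : LatSpace n :=
  Quotient.lift (fun g => latMk n (g * a))
    (fun g g' hgg' => Quotient.sound (QuotientGroup.rightRel_apply.mpr (by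
      have h : g' * g⁻¹ ∈ SLZ n := QuotientGroup.rightRel_apply.mp hgg'
      simpa [_root_.mul_inv_rev, mul_assoc] using h))) x

/-- The lattice `ℤ^n g` associated to `g ∈ SL_n(ℝ)`. -/
def latticeOf (n : ℕ) (g : SLR n) : Set (Fin n → ℝ) :=
  Set.range (fun m : Fin n → ℤ =>
    Matrix.vecMul (fun i => (m i : ℝ)) (g : Matrix (Fin n) (Fin n) ℝ))

/-- `S'`: the set of points of `S` whose first nonzero coordinate is positive. -/
def posHalf (n : ℕ) (S : Set (Fin n → ℝ)) : Set (Fin n → ℝ) :=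
  {x ∈ S | ∃ i : Fin n, 0 < x i ∧ ∀ j < i, x j = 0}

/-- `A` has at least `k` elements. -/
def hasAtLeast {α : Type*} (A : Set α) (k : ℕ) : Prop :=
  ∃ t : Finset α, ↑t ⊆ A ∧ t.card = k

/-- `ρ_{S',h}(L)`: the number of `h`-element subsets of `L ∩ S'`. -/
def rhoSub (n : ℕ) (S : Set (Fin n → ℝ)) (h : ℕ) (g : SLR n) : ℕ :=
  Nat.card {t : Finset (Fin n → ℝ) // ↑t ⊆ latticeOf n g ∩ posHalf n S ∧ t.card = h}

end

theorem exists_gaussian_quantile : ∃ Q : ℝ → ℝ, StrictMonoOn Q (Set.Ioo 0 1) ∧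
    ∀ u ∈ Set.Ioo (0 : ℝ) 1, HasDerivAt Q (Real.exp (Real.pi * Q u ^ 2)) u := by
  set g : ℝ → ℝ := fun t => Real.exp (-Real.pi * t ^ 2) with hg
  have hgc : Continuous g := by fun_prop
  have hgi : Integrable g := integrable_exp_neg_mul_sq Real.pi_pos
  have hg1 : ∫ t, g t = 1 := by
    rw [hg, integral_gaussian, div_self Real.pi_pos.ne', Real.sqrt_one]
  set Φ : ℝ → ℝ := fun x => (∫ t in Set.Iic 0, g t) + ∫ t in (0 : ℝ)..x, g t with hΦ
  have hder : ∀ x, HasStrictDerivAt Φ (g x) x := fun x =>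
    (intervalIntegral.integral_hasStrictDerivAt_right (hgc.intervalIntegrable _ _)
      hgc.stronglyMeasurable.stronglyMeasurableAtFilter hgc.continuousAt).const_add _
  have hmono : StrictMono Φ := strictMono_of_hasDerivAt_pos (fun x => (hder x).hasDerivAt)
    (fun x => Real.exp_pos _)
  have hcont : Continuous Φ := continuous_iff_continuousAt.2 fun x => (hder x).hasDerivAt.continuousAt
  have htop : Filter.Tendsto Φ Filter.atTop (nhds 1) := by
    have := (intervalIntegral_tendsto_integral_Ioi (0 : ℝ) hgi.integrableOn
      Filter.tendsto_id).const_add (∫ t in Set.Iic 0, g t)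
    rwa [intervalIntegral.integral_Iic_add_Ioi hgi.integrableOn hgi.integrableOn, hg1] at this
  have hbot : Filter.Tendsto Φ Filter.atBot (nhds 0) := by
    have := (intervalIntegral_tendsto_integral_Iic (0 : ℝ) hgi.integrableOn
      Filter.tendsto_id).const_sub (∫ t in Set.Iic 0, g t)
    rw [sub_self] at this
    refine this.congr fun x => ?_
    simp only [id, hΦ]
    rw [intervalIntegral.integral_symm, sub_neg_eq_add]
  have hrange : ∀ u ∈ Set.Ioo (0 : ℝ) 1, ∃ x, Φ x = u := by
    intro u hu
    obtain ⟨a, ha⟩ := (hbot.eventually_lt_const hu.1).exists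
    obtain ⟨b, hb⟩ := (htop.eventually_const_lt hu.2).exists
    exact mem_range_of_exists_le_of_exists_ge hcont ⟨a, ha.le⟩ ⟨b, hb.le⟩
  have hinv : ∀ u ∈ Set.Ioo (0 : ℝ) 1, Φ (Function.invFun Φ u) = u := fun u hu =>
    Function.invFun_eq (hrange u hu)
  refine ⟨Function.invFun Φ, fun u hu v hv huv => ?_, fun u hu => ?_⟩
  · rw [← hmono.lt_iff_lt, hinv u hu, hinv v hv]; exact huv
  · set a := Function.invFun Φ u with ha
    have hua : Φ a = u := hinv u hu
    have hne : g a ≠ 0 := (Real.exp_pos _).ne'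
    have h1 := (hder a).to_localInverse hne
    have h2 := HasStrictFDerivAt.eventually_right_inverse ((hder a).hasStrictFDerivAt_equiv hne)
    have h3 := h1.hasDerivAt
    rw [hua] at h3 h2
    have h4 : (g a)⁻¹ = Real.exp (Real.pi * a ^ 2) := by
      rw [hg, ← Real.exp_neg]; congr 1; ring
    rw [h4] at h3
    refine h3.congr_of_eventuallyEq ?_
    filter_upwards [h2] with y hy
    apply hmono.injective
    have : Φ (Function.invFun Φ y) = y := Function.invFun_eq ⟨_, hy⟩
    rw [this]; exact hy.symm

theorem exists_gaussian_transport (f : ℝ → ENNReal) (hf : Measurable f) (h1 : ∫⁻ x, f x = 1) :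
    ∃ (T T' : ℝ → ℝ) (s : Set ℝ), MeasurableSet s ∧ (∀ᵐ x, f x = 0 ∨ x ∈ s) ∧ StrictMonoOn T s ∧
      ∀ x ∈ s, HasDerivAt T (T' x) x ∧ 0 < T' x ∧
        f x = ENNReal.ofReal (T' x * Real.exp (-Real.pi * T x ^ 2)) := by
  obtain ⟨Q, hQm, hQ⟩ := exists_gaussian_quantile
  set ν : Measure ℝ := volume.withDensity f with hν
  have : IsProbabilityMeasure ν := ⟨by rw [hν, withDensity_apply _ MeasurableSet.univ]; simpa using h1⟩
  set F : ℝ → ℝ := fun x => ProbabilityTheory.cdf ν x with hF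
  have hder : ∀ᵐ x, HasDerivAt F (f x).toReal x := by
    have h := (ProbabilityTheory.cdf ν).ae_hasDerivAt
    rw [ProbabilityTheory.measure_cdf] at h
    filter_upwards [h, Measure.rnDeriv_withDensity volume hf] with x hx hx'
    rwa [hν, hx'] at hx
  have hfin : ∀ᵐ x, f x < ⊤ := ae_lt_top hf (by rw [h1]; simp)
  have hall : ∀ᵐ x, HasDerivAt F (f x).toReal x ∧ f x < ⊤ := hder.and hfin
  obtain ⟨s0, hs0c, hs0m, hs0⟩ := hall.exists_measurable_mem
  set s := s0 ∩ {x | f x ≠ 0} with hs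
  have hpos : ∀ x ∈ s, 0 < (f x).toReal := fun x hx => ENNReal.toReal_pos hx.2 (hs0 x hx.1).2.ne
  have hd : ∀ x ∈ s, HasDerivAt F (f x).toReal x := fun x hx => (hs0 x hx.1).1
  have hF0 : ∀ x, 0 ≤ F x := ProbabilityTheory.cdf_nonneg ν
  have hF1 : ∀ x, F x ≤ 1 := ProbabilityTheory.cdf_le_one ν
  have hFm : Monotone F := ProbabilityTheory.monotone_cdf ν
  have hIoo : ∀ x ∈ s, F x ∈ Set.Ioo (0 : ℝ) 1 := by
    intro x hx
    constructor
    · refine lt_of_le_of_ne (hF0 x) fun h => (hpos x hx).ne' ?_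
      have : IsLocalMin F x := Filter.Eventually.of_forall fun y => by rw [← h]; exact hF0 y
      exact this.hasDerivAt_eq_zero (hd x hx)
    · refine lt_of_le_of_ne (hF1 x) fun h => (hpos x hx).ne' ?_
      have : IsLocalMax F x := Filter.Eventually.of_forall fun y => by rw [h]; exact hF1 y
      exact this.hasDerivAt_eq_zero (hd x hx)
  have hFs : StrictMonoOn F s := by
    intro x hx y hy hxy
    refine lt_of_le_of_ne (hFm hxy.le) fun h => (hpos x hx).ne' ?_
    have hc : HasDerivWithinAt F 0 (Set.Icc x y) x := by
      refine (hasDerivWithinAt_const x _ (F x)).congr (fun z hz => ?_) rfl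
      exact le_antisymm (h ▸ hFm hz.2) (hFm hz.1)
    exact (uniqueDiffOn_Icc hxy x ⟨le_rfl, hxy.le⟩).eq_deriv _ (hd x hx).hasDerivWithinAt hc
  refine ⟨fun x => Q (F x), fun x => Real.exp (Real.pi * Q (F x) ^ 2) * (f x).toReal, s,
    hs0m.inter (hf (measurableSet_singleton 0).compl), ?_, ?_, ?_⟩
  · have : ∀ᵐ x, x ∈ s0 := hs0c
    filter_upwards [this] with x hx
    by_cases h : f x = 0
    · exact Or.inl h
    · exact Or.inr ⟨hx, h⟩
  · exact fun x hx y hy hxy => hQm (hIoo x hx) (hIoo y hy) (hFs hx hy hxy)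
  · intro x hx
    refine ⟨(hQ _ (hIoo x hx)).comp x (hd x hx), mul_pos (Real.exp_pos _) (hpos x hx), ?_⟩
    rw [mul_right_comm, ← Real.exp_add]
    simp [ENNReal.ofReal_toReal (hs0 x hx.1).2.ne]

theorem lintegral_gaussian_quadratic :
    ∫⁻ p : ℝ × ℝ, ENNReal.ofReal
      (Real.exp (-(4 * Real.pi / 9) * (p.1 ^ 2 - p.1 * p.2 + p.2 ^ 2))) =
      ENNReal.ofReal (3 * Real.sqrt 3 / 2) := by
  have hpi := Real.pi_pos
  have key : ∀ b : ℝ, 0 < b → ∫⁻ x : ℝ, ENNReal.ofReal (Real.exp (-b * x ^ 2)) =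
      ENNReal.ofReal (Real.sqrt (Real.pi / b)) := by
    intro b hb
    rw [← ofReal_integral_eq_lintegral_ofReal (integrable_exp_neg_mul_sq hb)
      (Filter.Eventually.of_forall fun x => (Real.exp_pos _).le), integral_gaussian]
  rw [Measure.volume_eq_prod, lintegral_prod_symm' _ (by fun_prop)]
  have inner : ∀ y : ℝ, ∫⁻ x : ℝ, ENNReal.ofReal
      (Real.exp (-(4 * Real.pi / 9) * (x ^ 2 - x * y + y ^ 2))) =
      ENNReal.ofReal (3 / 2) * ENNReal.ofReal (Real.exp (-(Real.pi / 3) * y ^ 2)) := by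
    intro y
    have h1 : ∀ x : ℝ, ENNReal.ofReal
      (Real.exp (-(4 * Real.pi / 9) * (x ^ 2 - x * y + y ^ 2))) =
       ENNReal.ofReal (Real.exp (-(4 * Real.pi / 9) * (x - y / 2) ^ 2)) *
        ENNReal.ofReal (Real.exp (-(Real.pi / 3) * y ^ 2)) := by
      intro x
      rw [← ENNReal.ofReal_mul (Real.exp_pos _).le, ← Real.exp_add]
      congr 2; ring
    simp_rw [h1]
    rw [lintegral_mul_const _ (by fun_prop),
      lintegral_sub_right_eq_self (fun x => ENNReal.ofReal (Real.exp (-(4 * Real.pi / 9) * x ^ 2))) (y / 2),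
      key _ (by positivity)]
    congr 2
    rw [show Real.pi / (4 * Real.pi / 9) = (3 / 2) ^ 2 by field_simp; norm_num]
    exact Real.sqrt_sq (by norm_num)
  simp_rw [inner]
  rw [lintegral_const_mul _ (by fun_prop), key _ (by positivity), ← ENNReal.ofReal_mul (by norm_num)]
  congr 1
  rw [show Real.pi / (Real.pi / 3) = 3 by field_simp]
  ring

theorem det_prod_clm (a b c d : ℝ) :
    ((a • ContinuousLinearMap.fst ℝ ℝ ℝ + b • ContinuousLinearMap.snd ℝ ℝ ℝ).prod
      (c • ContinuousLinearMap.fst ℝ ℝ ℝ + d • ContinuousLinearMap.snd ℝ ℝ ℝ)).det =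
      a * d - b * c := by
  rw [ContinuousLinearMap.det, ← LinearMap.det_toMatrix (Module.Basis.finTwoProd ℝ),
    Matrix.det_fin_two]
  simp [LinearMap.toMatrix_apply]

theorem young_real_normalized (f g h : ℝ → ENNReal) (hf : Measurable f) (hg : Measurable g)
    (hh : Measurable h) (hf1 : ∫⁻ x, f x = 1) (hg1 : ∫⁻ x, g x = 1) (hh1 : ∫⁻ x, h x = 1) :
    ∫⁻ p : ℝ × ℝ, (f p.1 * g p.2 * h (p.1 + p.2)) ^ (2 / 3 : ℝ) ≤
      ENNReal.ofReal (Real.sqrt 3 / 2) := by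
  obtain ⟨T1, t1, s1, hs1, hc1, hm1, hd1⟩ := exists_gaussian_transport f hf hf1
  obtain ⟨T2, t2, s2, hs2, hc2, hm2, hd2⟩ := exists_gaussian_transport g hg hg1
  obtain ⟨T3, t3, s3, hs3, hc3, hm3, hd3⟩ := exists_gaussian_transport h hh hh1
  set E : Set (ℝ × ℝ) := {p | p.1 ∈ s1 ∧ p.2 ∈ s2 ∧ p.1 + p.2 ∈ s3} with hE
  have hEm : MeasurableSet E := (measurable_fst hs1).inter ((measurable_snd hs2).inter
    ((measurable_fst.add measurable_snd) hs3))
  set D : ℝ × ℝ → ℝ × ℝ →L[ℝ] ℝ × ℝ := fun p =>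
    ((t1 p.1 + t3 (p.1 + p.2)) • ContinuousLinearMap.fst ℝ ℝ ℝ +
      t3 (p.1 + p.2) • ContinuousLinearMap.snd ℝ ℝ ℝ).prod
    (t3 (p.1 + p.2) • ContinuousLinearMap.fst ℝ ℝ ℝ +
      (t2 p.2 + t3 (p.1 + p.2)) • ContinuousLinearMap.snd ℝ ℝ ℝ) with hD
  set Ψ : ℝ × ℝ → ℝ × ℝ := fun p => (T1 p.1 + T3 (p.1 + p.2), T2 p.2 + T3 (p.1 + p.2)) with hΨ
  have hΨd : ∀ p ∈ E, HasFDerivWithinAt Ψ (D p) E p := by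
    intro p hp
    have e1 : HasFDerivAt (fun p : ℝ × ℝ => T1 p.1) (t1 p.1 • ContinuousLinearMap.fst ℝ ℝ ℝ) p :=
      (hd1 _ hp.1).1.comp_hasFDerivAt p hasFDerivAt_fst
    have e2 : HasFDerivAt (fun p : ℝ × ℝ => T2 p.2) (t2 p.2 • ContinuousLinearMap.snd ℝ ℝ ℝ) p :=
      (hd2 _ hp.2.1).1.comp_hasFDerivAt p hasFDerivAt_snd
    have e3 : HasFDerivAt (fun p : ℝ × ℝ => T3 (p.1 + p.2)) (t3 (p.1 + p.2) •
        (ContinuousLinearMap.fst ℝ ℝ ℝ + ContinuousLinearMap.snd ℝ ℝ ℝ)) p :=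
      HasDerivAt.comp_hasFDerivAt (f := fun p : ℝ × ℝ => p.1 + p.2) p (hd3 _ hp.2.2).1
        (hasFDerivAt_fst.add hasFDerivAt_snd)
    refine HasFDerivAt.hasFDerivWithinAt (((e1.add e3).prodMk (e2.add e3)).congr_fderiv ?_)
    rw [hD]
    congr 1 <;> module
  have hinj : Set.InjOn Ψ E := by
    intro p hp q hq hpq
    have h1 : T1 p.1 + T3 (p.1 + p.2) = T1 q.1 + T3 (q.1 + q.2) := congrArg Prod.fst hpq
    have h2 : T2 p.2 + T3 (p.1 + p.2) = T2 q.2 + T3 (q.1 + q.2) := congrArg Prod.snd hpq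
    have a1 := hm1.lt_iff_lt hp.1 hq.1
    have a1' := hm1.lt_iff_lt hq.1 hp.1
    have a2 := hm2.lt_iff_lt hp.2.1 hq.2.1
    have a2' := hm2.lt_iff_lt hq.2.1 hp.2.1
    have a3 := hm3.lt_iff_lt hp.2.2 hq.2.2
    have a3' := hm3.lt_iff_lt hq.2.2 hp.2.2
    rcases lt_trichotomy (T3 (p.1 + p.2)) (T3 (q.1 + q.2)) with hlt | heq | hgt
    · have := a3.1 hlt
      have := a1'.1 (by linarith)
      have := a2'.1 (by linarith)
      linarith
    · have b1 : p.1 = q.1 := hm1.injOn hp.1 hq.1 (by linarith)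
      have b2 : p.2 = q.2 := hm2.injOn hp.2.1 hq.2.1 (by linarith)
      exact Prod.ext b1 b2
    · have := a3'.1 hgt
      have := a1.1 (by linarith)
      have := a2.1 (by linarith)
      linarith
  set G : ℝ × ℝ → ENNReal := fun p => ENNReal.ofReal
      (Real.exp (-(4 * Real.pi / 9) * (p.1 ^ 2 - p.1 * p.2 + p.2 ^ 2))) with hG
  have hpt : ∀ p ∈ E, (f p.1 * g p.2 * h (p.1 + p.2)) ^ (2 / 3 : ℝ) ≤
      ENNReal.ofReal (1 / 3) * (ENNReal.ofReal |(D p).det| * G (Ψ p)) := by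
    intro p hp
    obtain ⟨-, p1, q1⟩ := hd1 _ hp.1
    obtain ⟨-, p2, q2⟩ := hd2 _ hp.2.1
    obtain ⟨-, p3, q3⟩ := hd3 _ hp.2.2
    rw [q1, q2, q3, ← ENNReal.ofReal_mul (by positivity), ← ENNReal.ofReal_mul (by positivity),
      ENNReal.ofReal_rpow_of_nonneg (by positivity) (by norm_num), hG,
      ← ENNReal.ofReal_mul (abs_nonneg _), ← ENNReal.ofReal_mul (by norm_num)]
    apply ENNReal.ofReal_le_ofReal
    rw [hD, det_prod_clm, hΨ]
    simp only
    generalize t1 p.1 = a at *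
    generalize t2 p.2 = b at *
    generalize t3 (p.1 + p.2) = c at *
    generalize T1 p.1 = x at *
    generalize T2 p.2 = y at *
    generalize T3 (p.1 + p.2) = z at *
    rw [show (a + c) * (b + c) - c * c = a * b + a * c + b * c by ring, abs_of_pos (by positivity),
      show a * Real.exp (-Real.pi * x ^ 2) * (b * Real.exp (-Real.pi * y ^ 2)) *
        (c * Real.exp (-Real.pi * z ^ 2)) = (a * b * c) *
          (Real.exp (-Real.pi * x ^ 2) * Real.exp (-Real.pi * y ^ 2) * Real.exp (-Real.pi * z ^ 2))
        by ring, Real.mul_rpow (by positivity) (by positivity), ← Real.exp_add, ← Real.exp_add,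
      ← Real.exp_mul, ← mul_assoc]
    refine mul_le_mul ?_ (Real.exp_le_exp.2 ?_) (Real.exp_pos _).le (by positivity)
    · have := Real.geom_mean_le_arith_mean3_weighted (w₁ := 1 / 3) (w₂ := 1 / 3) (w₃ := 1 / 3)
        (p₁ := a * b) (p₂ := a * c) (p₃ := b * c) (by norm_num) (by norm_num) (by norm_num)
        (by positivity) (by positivity) (by positivity) (by norm_num)
      rw [← Real.mul_rpow (by positivity) (by positivity),
        ← Real.mul_rpow (by positivity) (by positivity),
        show a * b * (a * c) * (b * c) = (a * b * c) ^ (2 : ℝ) by rw [Real.rpow_two]; ring,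
        ← Real.rpow_mul (by positivity)] at this
      norm_num at this ⊢
      linarith
    · have h0 := Real.pi_pos
      nlinarith [mul_nonneg h0.le (sq_nonneg (x + y - z))]
  calc ∫⁻ p : ℝ × ℝ, (f p.1 * g p.2 * h (p.1 + p.2)) ^ (2 / 3 : ℝ)
      ≤ ∫⁻ p : ℝ × ℝ, E.indicator (fun p => (f p.1 * g p.2 * h (p.1 + p.2)) ^ (2 / 3 : ℝ)) p := by
        apply lintegral_mono_ae
        have b1 : ∀ᵐ p : ℝ × ℝ, f p.1 = 0 ∨ p.1 ∈ s1 := Measure.quasiMeasurePreserving_fst.ae hc1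
        have b2 : ∀ᵐ p : ℝ × ℝ, g p.2 = 0 ∨ p.2 ∈ s2 := Measure.quasiMeasurePreserving_snd.ae hc2
        have b3 : ∀ᵐ p : ℝ × ℝ, h (p.1 + p.2) = 0 ∨ p.1 + p.2 ∈ s3 :=
          (Measure.quasiMeasurePreserving_snd.comp (measurePreserving_prod_add
            (volume : Measure ℝ) (volume : Measure ℝ)).quasiMeasurePreserving).ae hc3
        filter_upwards [b1, b2, b3] with p c1 c2 c3
        by_cases hp : p ∈ E
        · rw [Set.indicator_of_mem hp]
        · have : f p.1 * g p.2 * h (p.1 + p.2) = 0 := by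
            by_contra hne
            simp only [mul_eq_zero, not_or] at hne
            exact hp ⟨c1.resolve_left hne.1.1, c2.resolve_left hne.1.2, c3.resolve_left hne.2⟩
          rw [this, ENNReal.zero_rpow_of_pos (by norm_num)]
          exact zero_le
    _ = ∫⁻ p in E, (f p.1 * g p.2 * h (p.1 + p.2)) ^ (2 / 3 : ℝ) := lintegral_indicator hEm _
    _ ≤ ∫⁻ p in E, ENNReal.ofReal (1 / 3) * (ENNReal.ofReal |(D p).det| * G (Ψ p)) :=
        setLIntegral_mono' hEm hpt
    _ = ENNReal.ofReal (1 / 3) * ∫⁻ p in E, (ENNReal.ofReal |(D p).det| * G (Ψ p)) :=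
        lintegral_const_mul' _ _ ENNReal.ofReal_ne_top
    _ = ENNReal.ofReal (1 / 3) * ∫⁻ p in Ψ '' E, G p := by
        rw [lintegral_image_eq_lintegral_abs_det_fderiv_mul volume hEm hΨd hinj]
    _ ≤ ENNReal.ofReal (1 / 3) * ∫⁻ p, G p := by
        gcongr
        exact Measure.restrict_le_self
    _ = ENNReal.ofReal (Real.sqrt 3 / 2) := by
        rw [lintegral_gaussian_quadratic, ← ENNReal.ofReal_mul (by norm_num)]
        congr 1; ring

theorem young_real (f g h : ℝ → ENNReal) (hf : Measurable f) (hg : Measurable g)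
    (hh : Measurable h) :
    ∫⁻ x, ∫⁻ y, (f x * g y * h (x + y)) ^ (2 / 3 : ℝ) ≤
      ENNReal.ofReal (Real.sqrt 3 / 2) *
        ((∫⁻ x, f x) * (∫⁻ x, g x) * ∫⁻ x, h x) ^ (2 / 3 : ℝ) := by
  have hm : Measurable fun p : ℝ × ℝ => (f p.1 * g p.2 * h (p.1 + p.2)) ^ (2 / 3 : ℝ) := by
    fun_prop
  have hC : ENNReal.ofReal (Real.sqrt 3 / 2) ≠ 0 := by
    rw [ENNReal.ofReal_ne_zero_iff]; positivity
  have hz : ∀ p : ℝ × ℝ, f p.1 = 0 ∨ g p.2 = 0 ∨ h (p.1 + p.2) = 0 →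
      (f p.1 * g p.2 * h (p.1 + p.2)) ^ (2 / 3 : ℝ) = 0 := by
    intro p hp
    rw [ENNReal.rpow_eq_zero_iff_of_pos (by norm_num)]
    rcases hp with hp | hp | hp <;> simp [hp]
  have hprod : ∫⁻ x, ∫⁻ y, (f x * g y * h (x + y)) ^ (2 / 3 : ℝ) =
      ∫⁻ p : ℝ × ℝ, (f p.1 * g p.2 * h (p.1 + p.2)) ^ (2 / 3 : ℝ) := by
    rw [Measure.volume_eq_prod, lintegral_prod _ hm.aemeasurable]
  rw [hprod]
  by_cases f0 : ∫⁻ x, f x = 0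
  · rw [lintegral_eq_zero_iff hf] at f0
    have : ∀ᵐ p : ℝ × ℝ, f p.1 = 0 := Measure.quasiMeasurePreserving_fst.ae f0
    rw [lintegral_congr_ae (g := fun _ => 0) (this.mono fun p hp => hz p (Or.inl hp))]
    simp
  by_cases g0 : ∫⁻ x, g x = 0
  · rw [lintegral_eq_zero_iff hg] at g0
    have : ∀ᵐ p : ℝ × ℝ, g p.2 = 0 := Measure.quasiMeasurePreserving_snd.ae g0
    rw [lintegral_congr_ae (g := fun _ => 0) (this.mono fun p hp => hz p (Or.inr (Or.inl hp)))]
    simp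
  by_cases h0 : ∫⁻ x, h x = 0
  · rw [lintegral_eq_zero_iff hh] at h0
    have : ∀ᵐ p : ℝ × ℝ, h (p.1 + p.2) = 0 :=
      (Measure.quasiMeasurePreserving_snd.comp (measurePreserving_prod_add
        (volume : Measure ℝ) (volume : Measure ℝ)).quasiMeasurePreserving).ae h0
    rw [lintegral_congr_ae (g := fun _ => 0) (this.mono fun p hp => hz p (Or.inr (Or.inr hp)))]
    simp
  by_cases htop : (∫⁻ x, f x) * (∫⁻ x, g x) * ∫⁻ x, h x = ⊤
  · rw [htop, ENNReal.top_rpow_of_pos (by norm_num), ENNReal.mul_top hC]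
    exact le_top
  have fT : ∫⁻ x, f x ≠ ⊤ := fun h => htop (by rw [h, ENNReal.top_mul g0, ENNReal.top_mul h0])
  have gT : ∫⁻ x, g x ≠ ⊤ := fun h => htop (by rw [h, ENNReal.mul_top f0, ENNReal.top_mul h0])
  have hT : ∫⁻ x, h x ≠ ⊤ := fun h => htop (by rw [h, ENNReal.mul_top (mul_ne_zero f0 g0)])
  set a := ∫⁻ x, f x
  set b := ∫⁻ x, g x
  set c := ∫⁻ x, h x
  have key := young_real_normalized (fun x => a⁻¹ * f x) (fun x => b⁻¹ * g x) (fun x => c⁻¹ * h x)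
    (by fun_prop) (by fun_prop) (by fun_prop)
    (by rw [lintegral_const_mul _ hf, ENNReal.inv_mul_cancel f0 fT])
    (by rw [lintegral_const_mul _ hg, ENNReal.inv_mul_cancel g0 gT])
    (by rw [lintegral_const_mul _ hh, ENNReal.inv_mul_cancel h0 hT])
  have e : ∀ p : ℝ × ℝ, (f p.1 * g p.2 * h (p.1 + p.2)) ^ (2 / 3 : ℝ) =
      (a * b * c) ^ (2 / 3 : ℝ) *
        (a⁻¹ * f p.1 * (b⁻¹ * g p.2) * (c⁻¹ * h (p.1 + p.2))) ^ (2 / 3 : ℝ) := by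
    intro p
    rw [← ENNReal.mul_rpow_of_nonneg _ _ (by norm_num)]
    congr 1
    calc _ = (a * a⁻¹) * (b * b⁻¹) * (c * c⁻¹) * (f p.1 * g p.2 * h (p.1 + p.2)) := by
          rw [ENNReal.mul_inv_cancel f0 fT, ENNReal.mul_inv_cancel g0 gT,
            ENNReal.mul_inv_cancel h0 hT]; simp
      _ = _ := by ring
  simp_rw [e]
  rw [lintegral_const_mul _ (by fun_prop), mul_comm]
  gcongr

theorem piFinSuccAbove_zero_symm_apply (n : ℕ) (p : ℝ × (Fin n → ℝ)) :
    (MeasurableEquiv.piFinSuccAbove (fun _ : Fin (n + 1) => ℝ) 0).symm p = Fin.cons p.1 p.2 := by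
  simp [MeasurableEquiv.piFinSuccAbove, Fin.insertNthEquiv]

theorem lintegral_fin_cons (n : ℕ) (f : (Fin (n + 1) → ℝ) → ENNReal) (hf : Measurable f) :
    ∫⁻ x, f x = ∫⁻ t : ℝ, ∫⁻ x : Fin n → ℝ, f (Fin.cons t x) := by
  have h := (volume_preserving_piFinSuccAbove (fun _ : Fin (n + 1) => ℝ) 0).symm
  rw [← h.lintegral_comp_emb (MeasurableEquiv.measurableEmbedding _), Measure.volume_eq_prod,
    lintegral_prod _ (by exact (hf.comp (MeasurableEquiv.measurable _)).aemeasurable)]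
  simp_rw [piFinSuccAbove_zero_symm_apply]

theorem young_pi (n : ℕ) : ∀ f g h : (Fin n → ℝ) → ENNReal, Measurable f → Measurable g →
    Measurable h → ∫⁻ x, ∫⁻ y, (f x * g y * h (x + y)) ^ (2 / 3 : ℝ) ≤
      ENNReal.ofReal (Real.sqrt 3 / 2) ^ n *
        ((∫⁻ x, f x) * (∫⁻ x, g x) * ∫⁻ x, h x) ^ (2 / 3 : ℝ) := by
  induction n with
  | zero =>
    intro f g h hf hg hh
    have : (volume : Measure (Fin 0 → ℝ)) = Measure.dirac 0 := by
      rw [volume_pi, Measure.pi_of_empty (x := 0)]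
    simp [this]
  | succ n ih =>
    intro f g h hf hg hh
    have hcons : Measurable fun p : ℝ × (Fin n → ℝ) => (Fin.cons p.1 p.2 : Fin (n + 1) → ℝ) := by
      simpa only [← piFinSuccAbove_zero_symm_apply] using
        (MeasurableEquiv.piFinSuccAbove (fun _ : Fin (n + 1) => ℝ) 0).symm.measurable
    have hconsm : ∀ {β : Type} [MeasurableSpace β] (u : β → ℝ) (v : β → Fin n → ℝ), Measurable u →
        Measurable v → Measurable fun b => (Fin.cons (u b) (v b) : Fin (n + 1) → ℝ) :=
      fun u v hu hv => hcons.comp (hu.prodMk hv)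
    have m1 : ∀ u : (Fin (n + 1) → ℝ) → ENNReal, Measurable u →
        Measurable fun t : ℝ => ∫⁻ x : Fin n → ℝ, u (Fin.cons t x) := fun u hu =>
      Measurable.lintegral_prod_right' (f := fun p : ℝ × (Fin n → ℝ) => u (Fin.cons p.1 p.2))
        (hu.comp hcons)
    have mall : Measurable fun p : (Fin (n + 1) → ℝ) × (Fin (n + 1) → ℝ) =>
      (f p.1 * g p.2 * h (p.1 + p.2)) ^ (2 / 3 : ℝ) := by fun_prop
    calc ∫⁻ x, ∫⁻ y, (f x * g y * h (x + y)) ^ (2 / 3 : ℝ)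
        = ∫⁻ t : ℝ, ∫⁻ x : Fin n → ℝ, ∫⁻ s : ℝ, ∫⁻ y : Fin n → ℝ,
          (f (Fin.cons t x) * g (Fin.cons s y) * h (Fin.cons (t + s) (x + y))) ^ (2 / 3 : ℝ) := by
          rw [lintegral_fin_cons n _ (Measurable.lintegral_prod_right' mall)]
          refine lintegral_congr fun t => lintegral_congr fun x => ?_
          rw [lintegral_fin_cons n _ (by fun_prop)]
          refine lintegral_congr fun s => lintegral_congr fun y => ?_
          congr 3
          ext i
          refine Fin.cases ?_ (fun i => ?_) i <;> simp
      _ = ∫⁻ t : ℝ, ∫⁻ s : ℝ, ∫⁻ x : Fin n → ℝ, ∫⁻ y : Fin n → ℝ,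
          (f (Fin.cons t x) * g (Fin.cons s y) * h (Fin.cons (t + s) (x + y))) ^ (2 / 3 : ℝ) := by
          refine lintegral_congr fun t => ?_
          rw [lintegral_lintegral_swap]
          refine Measurable.aemeasurable ?_
          have : Measurable fun p : ((Fin n → ℝ) × ℝ) × (Fin n → ℝ) =>
            (f (Fin.cons t p.1.1) * g (Fin.cons p.1.2 p.2) *
              h (Fin.cons (t + p.1.2) (p.1.1 + p.2))) ^ (2 / 3 : ℝ) := by
            refine Measurable.pow_const ((Measurable.mul ?_ ?_).mul ?_) _
            · exact hf.comp (hconsm _ _ (by fun_prop) (by fun_prop))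
            · exact hg.comp (hconsm _ _ (by fun_prop) (by fun_prop))
            · exact hh.comp (hconsm _ _ (by fun_prop) (by fun_prop))
          exact Measurable.lintegral_prod_right' this
      _ ≤ ∫⁻ t : ℝ, ∫⁻ s : ℝ, ENNReal.ofReal (Real.sqrt 3 / 2) ^ n *
          ((∫⁻ x : Fin n → ℝ, f (Fin.cons t x)) * (∫⁻ x : Fin n → ℝ, g (Fin.cons s x)) *
            ∫⁻ x : Fin n → ℝ, h (Fin.cons (t + s) x)) ^ (2 / 3 : ℝ) := by
          gcongr with t s
          exact ih (fun x => f (Fin.cons t x)) (fun x => g (Fin.cons s x))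
            (fun x => h (Fin.cons (t + s) x))
            (hf.comp (hconsm _ _ (by fun_prop) (by fun_prop)))
            (hg.comp (hconsm _ _ (by fun_prop) (by fun_prop)))
            (hh.comp (hconsm _ _ (by fun_prop) (by fun_prop)))
      _ = ENNReal.ofReal (Real.sqrt 3 / 2) ^ n * ∫⁻ t : ℝ, ∫⁻ s : ℝ,
          ((∫⁻ x : Fin n → ℝ, f (Fin.cons t x)) * (∫⁻ x : Fin n → ℝ, g (Fin.cons s x)) *
            ∫⁻ x : Fin n → ℝ, h (Fin.cons (t + s) x)) ^ (2 / 3 : ℝ) := by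
          rw [← lintegral_const_mul' _ _ (ENNReal.pow_ne_top ENNReal.ofReal_ne_top)]
          refine lintegral_congr fun t => ?_
          rw [← lintegral_const_mul' _ _ (ENNReal.pow_ne_top ENNReal.ofReal_ne_top)]
      _ ≤ ENNReal.ofReal (Real.sqrt 3 / 2) ^ n * (ENNReal.ofReal (Real.sqrt 3 / 2) *
        ((∫⁻ t : ℝ, ∫⁻ x : Fin n → ℝ, f (Fin.cons t x)) *
          (∫⁻ t : ℝ, ∫⁻ x : Fin n → ℝ, g (Fin.cons t x)) *
          ∫⁻ t : ℝ, ∫⁻ x : Fin n → ℝ, h (Fin.cons t x)) ^ (2 / 3 : ℝ)) := by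
          gcongr
          exact young_real _ _ _ (m1 f hf) (m1 g hg) (m1 h hh)
      _ = _ := by
          rw [← lintegral_fin_cons n f hf, ← lintegral_fin_cons n g hg,
            ← lintegral_fin_cons n h hh, pow_succ, mul_assoc (_ ^ n)]

theorem lintegral_sign_smul {n : ℕ} (a : ℝ) (ha : a = 1 ∨ a = -1) (F : (Fin n → ℝ) → ENNReal) :
    ∫⁻ x, F (a • x) = ∫⁻ x, F x := by
  rcases ha with rfl | rfl
  · simp
  · simpa using lintegral_neg_eq_self F

theorem young_indicator {n : ℕ} (P : Set (Fin n → ℝ)) (hP : MeasurableSet P) (a b : ℝ)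
    (ha : a = 1 ∨ a = -1) (hb : b = 1 ∨ b = -1) (z : Fin n → ℝ) :
    ∫⁻ s, ∫⁻ t, P.indicator 1 s * P.indicator 1 t * P.indicator 1 (a • s + b • t + z) ≤
      ENNReal.ofReal (Real.sqrt 3 / 2) ^ n * (volume P * volume P) := by
  have aa : a * a = 1 := by rcases ha with rfl | rfl <;> norm_num
  have bb : b * b = 1 := by rcases hb with rfl | rfl <;> norm_num
  have mI : Measurable (P.indicator (1 : (Fin n → ℝ) → ENNReal)) := measurable_one.indicator hP
  have key := young_pi n (fun s => P.indicator 1 (a • s)) (fun t => P.indicator 1 (b • t))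
    (fun u => P.indicator 1 (u + z)) (by fun_prop) (by fun_prop) (by fun_prop)
  rw [lintegral_sign_smul a ha, lintegral_sign_smul b hb,
    lintegral_add_right_eq_self (P.indicator (1 : (Fin n → ℝ) → ENNReal)), lintegral_indicator_one hP] at key
  have e : (volume P * volume P * volume P) ^ (2 / 3 : ℝ) = volume P * volume P := by
    rw [show volume P * volume P * volume P = volume P ^ (3 : ℝ) by
      rw [show (3 : ℝ) = (3 : ℕ) by norm_num, ENNReal.rpow_natCast]; ring, ← ENNReal.rpow_mul]
    norm_num
    ring
  rw [e] at key
  refine le_trans (le_of_eq ?_) key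
  rw [← lintegral_sign_smul a ha]
  refine lintegral_congr fun s => ?_
  rw [← lintegral_sign_smul b hb]
  refine lintegral_congr fun t => ?_
  rw [smul_smul, smul_smul, aa, bb, one_smul, one_smul]
  by_cases h1 : a • s ∈ P <;> by_cases h2 : b • t ∈ P <;> by_cases h3 : s + t + z ∈ P <;>
    simp [h1, h2, h3]

theorem volume_pi_row_le {n : ℕ} {I : Type} [Fintype I] (P : Set (Fin n → ℝ))
    (hP : MeasurableSet P) (d : I → ℝ) (i₁ i₂ : I) (hi : i₁ ≠ i₂)
    (h₁ : d i₁ = 1 ∨ d i₁ = -1) (h₂ : d i₂ = 1 ∨ d i₂ = -1) :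
    volume {x : I → Fin n → ℝ | (∀ i, x i ∈ P) ∧ ∑ i, d i • x i ∈ P} ≤
      ENNReal.ofReal (Real.sqrt 3 / 2) ^ n * volume P ^ Fintype.card I := by
  have mI : Measurable (P.indicator (1 : (Fin n → ℝ) → ENNReal)) := measurable_one.indicator hP
  set c := ENNReal.ofReal (Real.sqrt 3 / 2) ^ n
  set Ψ : (I → Fin n → ℝ) → ENNReal := fun x => ∏ i, P.indicator 1 (x i) with hΨ
  set Φ : (I → Fin n → ℝ) → ENNReal := fun x => Ψ x * P.indicator 1 (∑ i, d i • x i) with hΦ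
  have mΨ : Measurable Ψ := Finset.measurable_prod _ fun i _ => by fun_prop
  have mΦ : Measurable Φ := by fun_prop
  have hall : MeasurableSet {x : I → Fin n → ℝ | ∀ i, x i ∈ P} := by
    simp only [Set.ofPred_forall]
    exact MeasurableSet.iInter fun i => measurable_pi_apply i hP
  have hset : MeasurableSet {x : I → Fin n → ℝ | (∀ i, x i ∈ P) ∧ ∑ i, d i • x i ∈ P} :=
    hall.inter
      ((show Measurable fun x : I → Fin n → ℝ => ∑ i, d i • x i by fun_prop) hP)
  have hvol : volume {x : I → Fin n → ℝ | (∀ i, x i ∈ P) ∧ ∑ i, d i • x i ∈ P} = ∫⁻ x, Φ x := by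
    rw [← lintegral_indicator_one hset]
    refine lintegral_congr fun x => ?_
    rw [hΦ, hΨ]
    by_cases hx : ∀ i, x i ∈ P
    · by_cases hx' : ∑ i, d i • x i ∈ P <;> simp [hx, hx', Set.indicator]
    · obtain ⟨i, hi⟩ := not_forall.1 hx
      rw [Set.indicator_of_notMem (fun h => hx h.1)]
      simp only
      rw [Finset.prod_eq_zero (Finset.mem_univ i) (Set.indicator_of_notMem hi _), zero_mul]
  have hΨi : ∫⁻ x, Ψ x = volume P ^ Fintype.card I := by
    calc _ = ∫⁻ x : I → Fin n → ℝ, {x : I → Fin n → ℝ | ∀ i, x i ∈ P}.indicator 1 x := by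
          refine lintegral_congr fun x => ?_
          rw [hΨ]
          by_cases hx : ∀ i, x i ∈ P
          · simp [hx, Set.indicator]
          · obtain ⟨i, hi⟩ := not_forall.1 hx
            have hx' : x ∉ {x : I → Fin n → ℝ | ∀ i, x i ∈ P} := hx
            rw [Set.indicator_of_notMem hx']
            exact Finset.prod_eq_zero (Finset.mem_univ i) (Set.indicator_of_notMem hi _)
      _ = volume (Set.univ.pi fun _ : I => P) := by
          rw [lintegral_indicator_one hall]
          congr 1
          ext; simp
      _ = _ := by
          rw [volume_pi_pi, Finset.prod_const, Finset.card_univ]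
  rw [hvol, ← hΨi, ← lintegral_const_mul _ mΨ, volume_pi,
    lintegral_eq_lmarginal_univ (0 : I → Fin n → ℝ), lintegral_eq_lmarginal_univ (0 : I → Fin n → ℝ)]
  have hun : (Finset.univ : Finset I) = {i₁, i₂}ᶜ ∪ {i₁, i₂} := by
    rw [Finset.union_comm, Finset.union_compl]
  have hdis : Disjoint ({i₁, i₂}ᶜ : Finset I) {i₁, i₂} := disjoint_compl_left
  rw [hun, lmarginal_union _ _ mΦ hdis, lmarginal_union _ _ (by fun_prop) hdis]
  refine lmarginal_mono ?_ 0
  intro x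
  have hni : i₁ ∉ ({i₂} : Finset I) := by simpa using hi
  have hupd : ∀ s t, Ψ (Function.update (Function.update x i₁ s) i₂ t) =
      P.indicator 1 s * P.indicator 1 t * ∏ i ∈ ({i₁, i₂}ᶜ : Finset I), P.indicator 1 (x i) := by
    intro s t
    rw [hΨ]
    simp only
    rw [← Finset.prod_mul_prod_compl ({i₁, i₂} : Finset I), Finset.prod_pair hi]
    congr 1
    · simp [Function.update_of_ne hi]
    · refine Finset.prod_congr rfl fun i hi' => ?_
      simp only [Finset.mem_compl, Finset.mem_insert, Finset.mem_singleton, not_or] at hi'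
      rw [Function.update_of_ne hi'.2, Function.update_of_ne hi'.1]
  have hsum : ∀ s t, ∑ i, d i • (Function.update (Function.update x i₁ s) i₂ t) i =
      d i₁ • s + d i₂ • t + ∑ i ∈ ({i₁, i₂}ᶜ : Finset I), d i • x i := by
    intro s t
    rw [← Finset.sum_add_sum_compl ({i₁, i₂} : Finset I), Finset.sum_pair hi]
    congr 1
    · simp [Function.update_of_ne hi]
    · refine Finset.sum_congr rfl fun i hi' => ?_
      simp only [Finset.mem_compl, Finset.mem_insert, Finset.mem_singleton, not_or] at hi'
      rw [Function.update_of_ne hi'.2, Function.update_of_ne hi'.1]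
  set R := ∏ i ∈ ({i₁, i₂}ᶜ : Finset I), P.indicator (1 : (Fin n → ℝ) → ENNReal) (x i)
  have hR : R ≠ ⊤ := ENNReal.prod_ne_top fun i _ => by
    by_cases h : x i ∈ P <;> simp [h]
  rw [lmarginal_insert _ mΦ hni, lmarginal_insert _ (by fun_prop) hni]
  simp only [lmarginal_singleton]
  rw [hΦ]
  simp only [hupd, hsum]
  calc _ = ∫⁻ s, ∫⁻ t, R * (P.indicator 1 s * P.indicator 1 t *
        P.indicator 1 (d i₁ • s + d i₂ • t + ∑ i ∈ ({i₁, i₂}ᶜ : Finset I), d i • x i)) := by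
        refine lintegral_congr fun s => lintegral_congr fun t => ?_
        ring
    _ = R * ∫⁻ s, ∫⁻ t, (P.indicator 1 s * P.indicator 1 t *
        P.indicator 1 (d i₁ • s + d i₂ • t + ∑ i ∈ ({i₁, i₂}ᶜ : Finset I), d i • x i)) := by
        rw [← lintegral_const_mul' _ _ hR]
        exact lintegral_congr fun s => lintegral_const_mul' _ _ hR
    _ ≤ R * (c * (volume P * volume P)) := by
        gcongr
        exact young_indicator P hP _ _ h₁ h₂ _
    _ = _ := by
        have : ∀ s t : Fin n → ℝ, c * (P.indicator 1 s * P.indicator 1 t * R) =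
          (c * R * P.indicator 1 s) * P.indicator 1 t := fun s t => by ring
        simp_rw [this]
        simp_rw [lintegral_const_mul _ mI, lintegral_mul_const _ (mI.const_mul _),
          lintegral_const_mul _ mI, lintegral_indicator_one hP]
        ring

/-- Rowwise right multiplication by `g`. -/
def rowMul {n : ℕ} {κ : Type} (v : κ → Fin n → ℝ) (g : SLR n) : κ → Fin n → ℝ :=
  fun i => Matrix.vecMul (v i) (g : Matrix (Fin n) (Fin n) ℝ)

/-- The tuple of real vectors underlying a tuple of integer vectors. -/
def realTuple {n : ℕ} {κ : Type} (w : κ → Fin n → ℤ) : κ → Fin n → ℝ := fun i j => (w i j : ℝ)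

theorem rowMul_mul {n : ℕ} {κ : Type} (v : κ → Fin n → ℝ) (g a : SLR n) :
    rowMul v (g * a) = rowMul (rowMul v g) a := by
  funext i
  simp [rowMul, Matrix.vecMul_vecMul]

theorem rowMul_one {n : ℕ} {κ : Type} (v : κ → Fin n → ℝ) : rowMul v (1 : SLR n) = v := by
  funext i
  simp [rowMul]

/-- The action of `SL_n(ℤ)` on integer tuples. -/
def intRowEquiv {n : ℕ} (κ : Type) (γ : Matrix.SpecialLinearGroup (Fin n) ℤ) :
    (κ → Fin n → ℤ) ≃ (κ → Fin n → ℤ) where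
  toFun w i := Matrix.vecMul (w i) (γ : Matrix (Fin n) (Fin n) ℤ)
  invFun w i := Matrix.vecMul (w i) ((γ⁻¹ : Matrix.SpecialLinearGroup (Fin n) ℤ) : Matrix (Fin n) (Fin n) ℤ)
  left_inv w := by
    funext i
    exact (Matrix.vecMul_vecMul _ _ _).trans (by
      rw [← Matrix.SpecialLinearGroup.coe_mul, mul_inv_cancel]
      simp)
  right_inv w := by
    funext i
    exact (Matrix.vecMul_vecMul _ _ _).trans (by
      rw [← Matrix.SpecialLinearGroup.coe_mul, inv_mul_cancel]
      simp)

theorem realTuple_intRowEquiv {n : ℕ} {κ : Type} (γ : Matrix.SpecialLinearGroup (Fin n) ℤ)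
    (w : κ → Fin n → ℤ) : realTuple (intRowEquiv κ γ w) =
      rowMul (realTuple w) (Matrix.SpecialLinearGroup.map (Int.castRingHom ℝ) γ) := by
  funext i j
  simp [realTuple, intRowEquiv, rowMul, Matrix.vecMul, dotProduct]

/-- The sum of `F₀` over all `κ`-tuples of lattice vectors. -/
noncomputable def siegelSum {n : ℕ} {κ : Type} (F₀ : (κ → Fin n → ℝ) → ENNReal) (x : LatSpace n) : ENNReal :=
  Quotient.lift (fun g : SLR n => ∑' w : κ → Fin n → ℤ, F₀ (rowMul (realTuple w) g))
    (fun g g' h => by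
      obtain ⟨γ, hγ⟩ := QuotientGroup.rightRel_apply.mp h
      have hg : g' = Matrix.SpecialLinearGroup.map (Int.castRingHom ℝ) γ * g := by
        rw [hγ]; group
      rw [hg, ← (intRowEquiv κ γ).tsum_eq]
      simp_rw [realTuple_intRowEquiv, ← rowMul_mul]) x

theorem siegelSum_mk {n : ℕ} {κ : Type} (F₀ : (κ → Fin n → ℝ) → ENNReal) (g : SLR n) :
    siegelSum F₀ (latMk n g) = ∑' w : κ → Fin n → ℤ, F₀ (rowMul (realTuple w) g) := rfl

theorem measurable_SLR_entry {n : ℕ} (i j : Fin n) :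
    Measurable fun g : SLR n => (g : Matrix (Fin n) (Fin n) ℝ) i j :=
  (show Measurable fun M : Fin n → Fin n → ℝ => M i j by fun_prop).comp
    (comap_measurable (m := (MeasurableSpace.pi : MeasurableSpace (Fin n → Fin n → ℝ)))
      fun g : SLR n => (g : Matrix (Fin n) (Fin n) ℝ))

theorem measurable_rowMul {n : ℕ} {κ : Type} (v : κ → Fin n → ℝ) :
    Measurable fun g : SLR n => rowMul v g := by
  refine measurable_pi_lambda _ fun i => measurable_pi_lambda _ fun j => ?_
  simp only [rowMul, Matrix.vecMul, dotProduct]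
  exact Finset.measurable_sum _ fun l _ => Measurable.const_mul (measurable_SLR_entry l j) _

theorem measurable_latMk (n : ℕ) : Measurable (latMk n) := fun _ h => h

theorem measurable_of_comp_latMk {n : ℕ} {β : Type} [MeasurableSpace β] {F : LatSpace n → β}
    (h : Measurable (F ∘ latMk n)) : Measurable F := fun _ hs => h hs

theorem measurable_siegelSum {n : ℕ} {κ : Type} [Finite κ] {F₀ : (κ → Fin n → ℝ) → ENNReal}
    (hF₀ : Measurable F₀) : Measurable (siegelSum F₀) :=
  measurable_of_comp_latMk
    (Measurable.tsum fun w => hF₀.comp (measurable_rowMul (realTuple w)))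

theorem measurable_mul_const_SLR {n : ℕ} (a : SLR n) : Measurable fun g : SLR n => g * a := by
  refine measurable_comap_iff.2 (measurable_pi_lambda _ fun i => measurable_pi_lambda _ fun j => ?_)
  simp only [Function.comp_def, Matrix.SpecialLinearGroup.coe_mul, Matrix.mul_apply]
  exact Finset.measurable_sum _ fun l _ => Measurable.mul_const (measurable_SLR_entry i l) _

theorem measurable_rTranslate {n : ℕ} (a : SLR n) : Measurable (rTranslate n a) :=
  measurable_of_comp_latMk ((measurable_latMk n).comp (measurable_mul_const_SLR a))

theorem exists_latMk_eq {n : ℕ} (x : LatSpace n) : ∃ g, latMk n g = x := Quotient.exists_rep x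

theorem siegelSum_rTranslate {n : ℕ} {κ : Type} (F₀ : (κ → Fin n → ℝ) → ENNReal) (a : SLR n)
    (x : LatSpace n) :
    siegelSum F₀ (rTranslate n a x) = siegelSum (fun v => F₀ (rowMul v a)) x := by
  obtain ⟨g, rfl⟩ := exists_latMk_eq x
  change siegelSum F₀ (latMk n (g * a)) = _
  simp_rw [siegelSum_mk, rowMul_mul]

/-- The intensity measure of the `κ`-tuples of lattice vectors. -/
noncomputable def tupleMeasure {n : ℕ} (κ : Type) [Finite κ] (μ : Measure (LatSpace n)) :
    Measure (κ → Fin n → ℝ) :=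
  Measure.ofMeasurable (fun A _ => ∫⁻ x, siegelSum (A.indicator 1) x ∂μ)
    (by
      rw [← lintegral_zero (μ := μ)]
      refine lintegral_congr fun x => ?_
      obtain ⟨g, rfl⟩ := exists_latMk_eq x
      simp [siegelSum_mk])
    (fun A hA hd => by
      rw [← lintegral_tsum fun i =>
        (measurable_siegelSum (measurable_one.indicator (hA i))).aemeasurable]
      refine lintegral_congr fun x => ?_
      obtain ⟨g, rfl⟩ := exists_latMk_eq x
      simp_rw [siegelSum_mk]
      rw [ENNReal.tsum_comm]
      refine tsum_congr fun w => ?_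
      simp_rw [← Measure.dirac_apply' _ (hA _)]
      rw [← Measure.dirac_apply' _ (MeasurableSet.iUnion hA), measure_iUnion hd hA])

theorem tupleMeasure_apply {n : ℕ} {κ : Type} [Finite κ] (μ : Measure (LatSpace n))
    {A : Set (κ → Fin n → ℝ)} (hA : MeasurableSet A) :
    tupleMeasure κ μ A = ∫⁻ x, siegelSum (A.indicator 1) x ∂μ :=
  Measure.ofMeasurable_apply A hA

theorem lintegral_eq_of_average_tendsto {X : Type} [MeasurableSpace X] (μ : Measure X)
    [IsProbabilityMeasure μ] (ι : ℕ → Type) [∀ J, Fintype (ι J)] [∀ J, Nonempty (ι J)]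
    (τ : ∀ J, ι J → X → X) (hτ : ∀ J k, MeasurePreserving (τ J k) μ μ) (N : X → ENNReal)
    (hN : Measurable N) (c : ENNReal)
    (h : ∀ x, Filter.Tendsto (fun J => (Fintype.card (ι J) : ENNReal)⁻¹ * ∑ k, N (τ J k x))
      Filter.atTop (nhds c)) : ∫⁻ x, N x ∂μ = c := by
  have card0 : ∀ J, (Fintype.card (ι J) : ENNReal) ≠ 0 := fun J => by
    simp [Fintype.card_ne_zero]
  have cardT : ∀ J, (Fintype.card (ι J) : ENNReal) ≠ ⊤ := fun J => ENNReal.natCast_ne_top _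
  have mΦ : ∀ J, Measurable fun x => (Fintype.card (ι J) : ENNReal)⁻¹ * ∑ k, N (τ J k x) :=
    fun J => Measurable.const_mul (Finset.measurable_sum _ fun k _ => hN.comp (hτ J k).measurable) _
  have hav : ∀ (F : X → ENNReal), Measurable F → ∀ J,
      ∫⁻ x, (Fintype.card (ι J) : ENNReal)⁻¹ * ∑ k, F (τ J k x) ∂μ = ∫⁻ x, F x ∂μ := by
    intro F hF J
    have mk : ∀ k, Measurable fun x => F (τ J k x) := fun k => hF.comp (hτ J k).measurable
    rw [lintegral_const_mul _ (Finset.measurable_sum _ fun k _ => mk k),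
      lintegral_finsetSum _ fun k _ => mk k]
    simp_rw [(hτ J _).lintegral_comp hF]
    rw [Finset.sum_const, Finset.card_univ, nsmul_eq_mul, ← mul_assoc,
      ENNReal.inv_mul_cancel (card0 J) (cardT J), one_mul]
  apply le_antisymm
  · have hT : ∀ T : ℕ, ∫⁻ x, min (N x) T ∂μ ≤ c := by
      intro T
      have hlim : Filter.Tendsto (fun J => ∫⁻ x, min ((Fintype.card (ι J) : ENNReal)⁻¹ *
          ∑ k, N (τ J k x)) T ∂μ) Filter.atTop (nhds (∫⁻ _, min c T ∂μ)) := by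
        refine tendsto_lintegral_of_dominated_convergence (fun _ => (T : ENNReal))
          (fun J => (mΦ J).min measurable_const) (fun J => Filter.Eventually.of_forall fun x =>
            min_le_right _ _) (by simp) (Filter.Eventually.of_forall fun x => ?_)
        exact (h x).min tendsto_const_nhds
      rw [lintegral_const, measure_univ, mul_one] at hlim
      refine le_trans (ge_of_tendsto hlim (Filter.Eventually.of_forall fun J => ?_)) (min_le_left _ _)
      rw [← hav (fun x => min (N x) T) (hN.min measurable_const) J]
      refine lintegral_mono fun x => le_min ?_ ?_
      · gcongr
        exact min_le_left _ _
      · rw [ENNReal.inv_mul_le_iff (card0 J) (cardT J)]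
        calc ∑ k, min (N (τ J k x)) T ≤ ∑ k : ι J, (T : ENNReal) :=
              Finset.sum_le_sum fun k _ => min_le_right _ _
          _ = _ := by rw [Finset.sum_const, Finset.card_univ, nsmul_eq_mul]
    have hlim : Filter.Tendsto (fun T : ℕ => ∫⁻ x, min (N x) T ∂μ) Filter.atTop
        (nhds (∫⁻ x, N x ∂μ)) := by
      refine lintegral_tendsto_of_tendsto_of_monotone
        (fun T => (hN.min measurable_const).aemeasurable) (Filter.Eventually.of_forall fun x => ?_)
        (Filter.Eventually.of_forall fun x => ?_)
      · intro a b hab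
        exact min_le_min le_rfl (by exact_mod_cast hab)
      · have := (tendsto_const_nhds (x := N x)).min ENNReal.tendsto_nat_nhds_top
        simpa using this
    exact le_of_tendsto hlim (Filter.Eventually.of_forall hT)
  · calc c = ∫⁻ _, c ∂μ := by rw [lintegral_const, measure_univ, mul_one]
      _ = ∫⁻ x, Filter.liminf (fun J => (Fintype.card (ι J) : ENNReal)⁻¹ * ∑ k, N (τ J k x))
          Filter.atTop ∂μ := lintegral_congr fun x => (h x).liminf_eq.symm
      _ ≤ Filter.liminf (fun J => ∫⁻ x, (Fintype.card (ι J) : ENNReal)⁻¹ * ∑ k, N (τ J k x) ∂μ)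
          Filter.atTop := lintegral_liminf_le mΦ
      _ = ∫⁻ x, N x ∂μ := by simp_rw [hav N hN]; simp

theorem measurePreserving_curry (κ ρ : Type) [Fintype κ] [Fintype ρ] :
    MeasurePreserving (MeasurableEquiv.curry κ ρ ℝ) volume volume := by
  refine MeasurePreserving.symm (MeasurableEquiv.curry κ ρ ℝ).symm ⟨MeasurableEquiv.measurable _, ?_⟩
  rw [volume_pi (ι := κ × ρ)]
  refine (Measure.pi_eq fun s hs => ?_).symm
  rw [MeasurableEquiv.map_apply]
  have : (MeasurableEquiv.curry κ ρ ℝ).symm ⁻¹' (Set.univ.pi s) =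
      Set.univ.pi fun i => Set.univ.pi fun j => s (i, j) := by
    ext x
    simp [MeasurableEquiv.curry, Function.uncurry]
  rw [this, volume_pi_pi]
  simp_rw [volume_pi_pi]
  rw [Fintype.prod_prod_type]

theorem measurePreserving_rowMul {n : ℕ} (κ : Type) [Fintype κ] (g : SLR n) :
    MeasurePreserving (fun v : κ → Fin n → ℝ => rowMul v g) volume volume := by
  refine volume_preserving_pi (f := fun (_ : κ) (v : Fin n → ℝ) =>
    Matrix.vecMul v (g : Matrix (Fin n) (Fin n) ℝ)) fun _ => ?_
  have h := Real.map_matrix_volume_pi_eq_smul_volume_pi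
    (M := (g : Matrix (Fin n) (Fin n) ℝ)ᵀ) (by simp)
  have e : (Matrix.toLin' (g : Matrix (Fin n) (Fin n) ℝ)ᵀ : (Fin n → ℝ) → Fin n → ℝ) =
      fun v => Matrix.vecMul v (g : Matrix (Fin n) (Fin n) ℝ) := by
    funext v
    simp [Matrix.mulVec_transpose]
  rw [e] at h
  refine ⟨?_, by simpa using h⟩
  rw [← e]
  exact (LinearMap.continuous_of_finiteDimensional _).measurable

theorem continuous_rowMul {n : ℕ} (κ : Type) (g : SLR n) :
    Continuous fun v : κ → Fin n → ℝ => rowMul v g := by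
  unfold rowMul
  fun_prop

/-- Rowwise right multiplication as a homeomorphism. -/
def rowMulHomeomorph {n : ℕ} (κ : Type) (g : SLR n) : (κ → Fin n → ℝ) ≃ₜ (κ → Fin n → ℝ) where
  toFun v := rowMul v g
  invFun v := rowMul v g⁻¹
  left_inv v := by simp [← rowMul_mul, rowMul_one]
  right_inv v := by simp [← rowMul_mul, rowMul_one]
  continuous_toFun := continuous_rowMul κ g
  continuous_invFun := continuous_rowMul κ g⁻¹

theorem tsum_indicator_eq_natCard {W : Type} (s : Set W) (hs : s.Finite) :
    ∑' w, s.indicator (1 : W → ENNReal) w = (Nat.card s : ENNReal) := by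
  have := hs.fintype
  rw [← tsum_subtype s (1 : W → ENNReal)]
  simp

theorem finite_int_mem_of_isBounded {ι : Type} [Fintype ι] (s : Set (ι → ℝ))
    (hs : Bornology.IsBounded s) : {w : ι → ℤ | (fun i => (w i : ℝ)) ∈ s}.Finite := by
  obtain ⟨R, hR⟩ := hs.exists_norm_le
  refine (Set.finite_Icc (fun _ : ι => -⌈R⌉) (fun _ => ⌈R⌉)).subset fun w hw => ?_
  have h : ∀ i, |(w i : ℝ)| ≤ ⌈R⌉ := fun i =>
    ((norm_le_pi_norm (fun i => (w i : ℝ)) i).trans (hR _ hw)).trans (Int.le_ceil R)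
  refine ⟨fun i => ?_, fun i => ?_⟩
  · exact_mod_cast (abs_le.1 (h i)).1
  · exact_mod_cast (abs_le.1 (h i)).2

section

open scoped Pointwise

theorem natCard_inter_smul_span {ι : Type} [Fintype ι] (s : Set (ι → ℝ)) (N : ℕ) (hN : N ≠ 0) :
    Nat.card ↑(s ∩ (N : ℝ)⁻¹ • (Submodule.span ℤ (Set.range (Pi.basisFun ℝ ι)) : Set (ι → ℝ))) =
      Nat.card {w : ι → ℤ | (fun i => (N : ℝ)⁻¹ * w i) ∈ s} := by
  have hN' : (N : ℝ)⁻¹ ≠ 0 := inv_ne_zero (Nat.cast_ne_zero.2 hN)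
  symm
  refine Nat.card_congr (Equiv.ofBijective (fun w => ⟨fun i => (N : ℝ)⁻¹ * w.1 i, w.2, ?_⟩) ⟨?_, ?_⟩)
  · refine ⟨fun i => (w.1 i : ℝ), ?_, ?_⟩
    · rw [SetLike.mem_coe, Module.Basis.mem_span_iff_repr_mem]
      simp
    · funext i; rfl
  · intro w w' h
    ext i
    have := congrFun (congrArg Subtype.val h) i
    simpa [hN] using this
  · rintro ⟨x, hx, y, hy, rfl⟩
    rw [SetLike.mem_coe, Module.Basis.mem_span_iff_repr_mem] at hy
    simp only [Pi.basisFun_repr] at hy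
    choose w hw using hy
    refine ⟨⟨w, ?_⟩, ?_⟩
    · have e : (fun i => (N : ℝ)⁻¹ * (w i : ℝ)) = (N : ℝ)⁻¹ • y := by
        funext i
        simp [← hw]
      change (fun i => (N : ℝ)⁻¹ * (w i : ℝ)) ∈ s
      rw [e]
      exact hx
    · ext i
      simp [← hw]

theorem tendsto_tsum_indicator_rowMul {n : ℕ} {κ : Type} [Fintype κ] (A : Set (κ → Fin n → ℝ))
    (hb : Bornology.IsBounded A) (hA : MeasurableSet A) (hf : volume (frontier A) = 0) (g : SLR n) :
    Filter.Tendsto (fun N : ℕ => ((N : ENNReal) ^ (Fintype.card κ * n))⁻¹ *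
      ∑' w : κ → Fin n → ℤ, A.indicator 1 ((N : ℝ)⁻¹ • rowMul (realTuple w) g))
      Filter.atTop (nhds (volume A)) := by
  set s : Set (κ × Fin n → ℝ) := {x | rowMul (Function.curry x) g ∈ A} with hs
  have mp : MeasurePreserving (fun x : κ × Fin n → ℝ => rowMul (Function.curry x) g) volume volume :=
    (measurePreserving_rowMul κ g).comp (measurePreserving_curry κ (Fin n))
  set H : (κ × Fin n → ℝ) ≃ₜ (κ → Fin n → ℝ) :=
    { toEquiv := Equiv.curry κ (Fin n) ℝ
      continuous_toFun := by
        refine continuous_pi fun i => continuous_pi fun j => ?_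
        exact continuous_apply (i, j)
      continuous_invFun := by
        refine continuous_pi fun p => ?_
        exact (continuous_apply p.2).comp (continuous_apply p.1) } with hH
  set H' := H.trans (rowMulHomeomorph κ g) with hH'
  have hsH : s = H' ⁻¹' A := rfl
  have vs : volume s = volume A := mp.measure_preimage hA.nullMeasurableSet
  have ms : MeasurableSet s := mp.measurable hA
  have hfr : volume (frontier s) = 0 := by
    rw [hsH, ← H'.preimage_frontier]
    have := mp.measure_preimage (s := frontier A) isClosed_frontier.measurableSet.nullMeasurableSet
    rw [← hf, ← this]
    rfl
  have hsb : Bornology.IsBounded s := by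
    have hc : IsCompact (H'.symm '' closure A) := hb.isCompact_closure.image H'.symm.continuous
    refine hc.isBounded.subset fun x hx => ⟨H' x, subset_closure hx, by simp⟩
  have hAT : volume A ≠ ⊤ := hb.measure_lt_top.ne
  have key := tendsto_card_div_pow_atTop_volume s hsb ms hfr
  rw [measureReal_def, vs] at key
  have key2 := (ENNReal.continuous_ofReal.tendsto _).comp key
  rw [ENNReal.ofReal_toReal hAT] at key2
  refine key2.congr' ?_
  filter_upwards [Filter.eventually_gt_atTop 0] with N hN
  have hN' : (N : ℝ) ≠ 0 := Nat.cast_ne_zero.2 hN.ne'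
  rw [Function.comp_apply, natCard_inter_smul_span s N hN.ne',
    ENNReal.ofReal_div_of_pos (by positivity), mul_comm, ← div_eq_mul_inv,
    ENNReal.ofReal_natCast, ENNReal.ofReal_pow (by positivity), ENNReal.ofReal_natCast,
    Fintype.card_prod, Fintype.card_fin]
  congr 1
  rw [← tsum_indicator_eq_natCard, ← (Equiv.curry κ (Fin n) ℤ).tsum_eq]
  · refine tsum_congr fun w => ?_
    have : (w ∈ {w : κ × Fin n → ℤ | (fun i => (N : ℝ)⁻¹ * w i) ∈ s}) ↔
        (N : ℝ)⁻¹ • rowMul (realTuple (Equiv.curry κ (Fin n) ℤ w)) g ∈ A := by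
      rw [hs]
      simp only [Set.mem_ofPred_eq]
      have : rowMul (Function.curry fun i => (N : ℝ)⁻¹ * (w i : ℝ)) g =
        (N : ℝ)⁻¹ • rowMul (realTuple (Equiv.curry κ (Fin n) ℤ w)) g := by
        funext i
        simp only [rowMul, Pi.smul_apply]
        rw [← Matrix.smul_vecMul]
        rfl
      rw [this]
    by_cases h : w ∈ {w : κ × Fin n → ℤ | (fun i => (N : ℝ)⁻¹ * w i) ∈ s}
    · rw [Set.indicator_of_mem h, Set.indicator_of_mem (this.1 h)]; simp
    · rw [Set.indicator_of_notMem h, Set.indicator_of_notMem (mt this.2 h)]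
  · have hb2 : Bornology.IsBounded ((N : ℝ) • s) := hsb.smul₀ _
    refine (finite_int_mem_of_isBounded _ hb2).subset fun w hw => ?_
    refine ⟨_, hw, ?_⟩
    funext i
    simp [hN']

end

/-- The corner of the `k`-th cell of the subdivision of `[l, u)` into `K` intervals, recentred so
that dilation by `K` about it maps the cell onto `[l, u)`. -/
noncomputable def gridShift (K : ℕ) (l u : ℝ) (k : ℕ) : ℝ := ((K - 1) * l + (u - l) * k) / K

theorem gridShift_mem_iff {K : ℕ} (hK : 0 < K) {l u : ℝ} (hlu : l < u) (y : ℝ) (k : Fin K) :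
    K * (y - gridShift K l u k) ∈ Set.Ico l u ↔
      y ∈ Set.Ico l u ∧ (k : ℕ) = ⌊K * (y - l) / (u - l)⌋₊ := by
  have hK' : (0 : ℝ) < K := Nat.cast_pos.2 hK
  have hd : 0 < u - l := sub_pos.2 hlu
  have hk' : ((k : ℕ) : ℝ) + 1 ≤ K := by exact_mod_cast k.2
  have hk0 : (0 : ℝ) ≤ (k : ℕ) := Nat.cast_nonneg _
  have e : K * (y - gridShift K l u k) = K * y - ((K - 1) * l + (u - l) * (k : ℕ)) := by
    unfold gridShift
    field_simp
  have e2 : K * (y - gridShift K l u k) ∈ Set.Ico l u ↔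
      ((k : ℕ) : ℝ) ≤ K * (y - l) / (u - l) ∧ K * (y - l) / (u - l) < (k : ℕ) + 1 := by
    rw [e, le_div_iff₀ hd, div_lt_iff₀ hd]
    constructor <;> rintro ⟨h1, h2⟩ <;> constructor <;> nlinarith
  rw [e2]
  constructor
  · rintro ⟨h1, h2⟩
    rw [le_div_iff₀ hd] at h1
    rw [div_lt_iff₀ hd] at h2
    have hy : l ≤ y ∧ y < u := by
      constructor
      · have : 0 ≤ K * (y - l) := le_trans (by positivity) h1
        linarith [(mul_nonneg_iff_of_pos_left hK').1 this]
      · have : K * (y - l) < K * (u - l) := by nlinarith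
        linarith [lt_of_mul_lt_mul_left this hK'.le]
    refine ⟨hy, ((Nat.floor_eq_iff ?_).2 ⟨(le_div_iff₀ hd).2 h1, (div_lt_iff₀ hd).2 h2⟩).symm⟩
    exact div_nonneg (mul_nonneg hK'.le (by linarith)) hd.le
  · rintro ⟨hy, h⟩
    exact (Nat.floor_eq_iff (div_nonneg (mul_nonneg hK'.le (by linarith [hy.1])) hd.le)).1 h.symm

theorem floor_grid_lt {K : ℕ} (hK : 0 < K) {l u : ℝ} (hlu : l < u) {y : ℝ}
    (hy : y ∈ Set.Ico l u) : ⌊K * (y - l) / (u - l)⌋₊ < K := by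
  have hK' : (0 : ℝ) < K := Nat.cast_pos.2 hK
  have hd : 0 < u - l := sub_pos.2 hlu
  rw [Nat.floor_lt (div_nonneg (mul_nonneg hK'.le (by linarith [hy.1])) hd.le), div_lt_iff₀ hd]
  nlinarith [hy.2]

section

set_option linter.unusedSectionVars false

variable {n : ℕ} {κ ρ : Type} [Fintype κ] [Fintype ρ]

/-- The square block of the columns in `κ`. -/
def blockL (e : κ ⊕ ρ ≃ Fin n) (v : κ → Fin n → ℝ) : Matrix κ κ ℝ :=
  Matrix.of fun i j => v i (e (Sum.inl j))

/-- The block of the columns in `ρ`. -/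
def blockR (e : κ ⊕ ρ ≃ Fin n) (v : κ → Fin n → ℝ) : Matrix κ ρ ℝ :=
  Matrix.of fun i j => v i (e (Sum.inr j))

/-- The tuple with the given blocks. -/
def blockJoin (e : κ ⊕ ρ ≃ Fin n) (X : Matrix κ κ ℝ) (Y : Matrix κ ρ ℝ) : κ → Fin n → ℝ :=
  fun i l => Sum.elim (X i) (Y i) (e.symm l)

@[simp] theorem blockL_blockJoin (e : κ ⊕ ρ ≃ Fin n) (X : Matrix κ κ ℝ) (Y : Matrix κ ρ ℝ) :
    blockL e (blockJoin e X Y) = X := by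
  ext; simp [blockL, blockJoin]

@[simp] theorem blockR_blockJoin (e : κ ⊕ ρ ≃ Fin n) (X : Matrix κ κ ℝ) (Y : Matrix κ ρ ℝ) :
    blockR e (blockJoin e X Y) = Y := by
  ext; simp [blockR, blockJoin]

theorem blockJoin_blocks (e : κ ⊕ ρ ≃ Fin n) (v : κ → Fin n → ℝ) :
    blockJoin e (blockL e v) (blockR e v) = v := by
  funext i l
  obtain ⟨s, rfl⟩ := e.surjective l
  cases s <;> simp [blockJoin, blockL, blockR]

theorem blockL_smul (e : κ ⊕ ρ ≃ Fin n) (c : ℝ) (v : κ → Fin n → ℝ) :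
    blockL e (c • v) = c • blockL e v := rfl

theorem blockR_smul (e : κ ⊕ ρ ≃ Fin n) (c : ℝ) (v : κ → Fin n → ℝ) :
    blockR e (c • v) = c • blockR e v := rfl

/-- Normalising the right block by the inverse of the left block. -/
noncomputable def blockNormalize (e : κ ⊕ ρ ≃ Fin n) (v : κ → Fin n → ℝ) : κ → Fin n → ℝ :=
  blockJoin e (blockL e v) ((blockL e v)⁻¹ * blockR e v)

/-- The inverse of `blockNormalize`. -/
noncomputable def blockUnnormalize (e : κ ⊕ ρ ≃ Fin n) (v : κ → Fin n → ℝ) : κ → Fin n → ℝ :=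
  blockJoin e (blockL e v) (blockL e v * blockR e v)

theorem blockUnnormalize_normalize (e : κ ⊕ ρ ≃ Fin n) {v : κ → Fin n → ℝ}
    (hv : (blockL e v).det ≠ 0) : blockUnnormalize e (blockNormalize e v) = v := by
  have := Matrix.mul_nonsing_inv (blockL e v) (isUnit_iff_ne_zero.2 hv)
  simp only [blockUnnormalize, blockNormalize, blockL_blockJoin, blockR_blockJoin]
  rw [← Matrix.mul_assoc, this, Matrix.one_mul, blockJoin_blocks]

/-- The tuples with invertible left block whose normalisation lies in a half-open box. -/
def chartBox (e : κ ⊕ ρ ≃ Fin n) (l u : κ → Fin n → ℝ) : Set (κ → Fin n → ℝ) :=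
  {v | (blockL e v).det ≠ 0 ∧ ∀ i j, blockNormalize e v i j ∈ Set.Ico (l i j) (u i j)}

theorem mem_chartBox_iff (e : κ ⊕ ρ ≃ Fin n) (l u v : κ → Fin n → ℝ) :
    v ∈ chartBox e l u ↔ ((blockL e v).det ≠ 0 ∧
      ∀ i j, blockL e v i j ∈ Set.Ico (l i (e (Sum.inl j))) (u i (e (Sum.inl j)))) ∧
      ∀ p : κ × ρ, ((blockL e v)⁻¹ * blockR e v) p.1 p.2 ∈
        Set.Ico (l p.1 (e (Sum.inr p.2))) (u p.1 (e (Sum.inr p.2))) := by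
  have : ∀ i, (∀ j, blockNormalize e v i j ∈ Set.Ico (l i j) (u i j)) ↔
      (∀ j, blockL e v i j ∈ Set.Ico (l i (e (Sum.inl j))) (u i (e (Sum.inl j)))) ∧
      ∀ j, ((blockL e v)⁻¹ * blockR e v) i j ∈
        Set.Ico (l i (e (Sum.inr j))) (u i (e (Sum.inr j))) := by
    intro i
    rw [← e.forall_congr_right, Sum.forall]
    simp [blockNormalize, blockJoin]
  change _ ∧ (∀ i, ∀ j, _) ↔ _
  simp_rw [this]
  rw [forall_and, Prod.forall]
  tauto

/-- The block-triangular matrix moving the cells of the grid. -/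
noncomputable def shearMatrix (e : κ ⊕ ρ ≃ Fin n) (ε c : ℝ) (U : Matrix κ ρ ℝ) : Matrix (Fin n) (Fin n) ℝ :=
  Matrix.reindex e e (Matrix.fromBlocks (ε • 1) (-(c • U)) 0 (c • 1))

theorem det_shearMatrix (e : κ ⊕ ρ ≃ Fin n) (ε c : ℝ) (U : Matrix κ ρ ℝ) :
    (shearMatrix e ε c U).det = ε ^ Fintype.card κ * c ^ Fintype.card ρ := by
  rw [shearMatrix, Matrix.det_reindex_self, Matrix.det_fromBlocks_zero₂₁, Matrix.det_smul,
    Matrix.det_smul, Matrix.det_one, Matrix.det_one, mul_one, mul_one]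

theorem vecMul_shearMatrix (e : κ ⊕ ρ ≃ Fin n) (ε c : ℝ) (U : Matrix κ ρ ℝ)
    (v : κ → Fin n → ℝ) :
    (fun i => Matrix.vecMul (v i) (shearMatrix e ε c U)) =
      blockJoin e (ε • blockL e v) (c • (blockR e v - blockL e v * U)) := by
  funext i l
  obtain ⟨s, rfl⟩ := e.surjective l
  simp only [Matrix.vecMul, dotProduct]
  rw [← e.sum_comp, Fintype.sum_sum_type]
  cases s with
  | inl j => simp [shearMatrix, blockJoin, blockL, Matrix.one_apply, mul_comm]
  | inr j =>
    simp only [shearMatrix, blockJoin, blockL, blockR, Matrix.reindex_apply, Matrix.submatrix_apply,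
      Equiv.symm_apply_apply, Matrix.fromBlocks_apply₁₂, Matrix.fromBlocks_apply₂₂,
      Matrix.neg_apply, Matrix.smul_apply, smul_eq_mul, Matrix.one_apply, Sum.elim_inr,
      Matrix.sub_apply, Matrix.of_apply, Matrix.mul_apply]
    simp only [mul_ite, mul_one, mul_zero, Finset.sum_ite_eq', Finset.mem_univ, if_true, mul_sub,
      Finset.mul_sum]
    rw [sub_eq_neg_add, ← Finset.sum_neg_distrib]
    congr 1
    · exact Finset.sum_congr rfl fun _ _ => by ring
    · ring

theorem sum_indicator_chartBox (e : κ ⊕ ρ ≃ Fin n) (l u : κ → Fin n → ℝ)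
    (hlu : ∀ i j, l i j < u i j) (K : ℕ) (hK : 0 < K) (ε c : ℝ) (hε : ε ≠ 0) (hc : c = ε * K)
    (v : κ → Fin n → ℝ) :
    ∑ k : κ × ρ → Fin K, (chartBox e l u).indicator (1 : (κ → Fin n → ℝ) → ENNReal)
      (fun i => Matrix.vecMul (v i) (shearMatrix e ε c (Matrix.of fun i j =>
        gridShift K (l i (e (Sum.inr j))) (u i (e (Sum.inr j))) (k (i, j))))) =
      (chartBox e l u).indicator 1 (ε • v) := by
  have hmem : ∀ k : κ × ρ → Fin K, (fun i => Matrix.vecMul (v i) (shearMatrix e ε c (Matrix.of fun i j =>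
        gridShift K (l i (e (Sum.inr j))) (u i (e (Sum.inr j))) (k (i, j))))) ∈ chartBox e l u ↔
      ε • v ∈ chartBox e l u ∧ ∀ p : κ × ρ, (k p : ℕ) =
        ⌊K * (((blockL e v)⁻¹ * blockR e v) p.1 p.2 - l p.1 (e (Sum.inr p.2))) /
          (u p.1 (e (Sum.inr p.2)) - l p.1 (e (Sum.inr p.2)))⌋₊ := by
    intro k
    rw [vecMul_shearMatrix, mem_chartBox_iff, mem_chartBox_iff, blockL_blockJoin, blockR_blockJoin,
      blockL_smul, blockR_smul]
    refine Iff.trans (and_congr_right fun h => ?_) and_assoc.symm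
    have hdet : (blockL e v).det ≠ 0 := by
      intro h0
      exact h.1 (by rw [Matrix.det_smul, h0, mul_zero])
    have hu : IsUnit (blockL e v).det := isUnit_iff_ne_zero.2 hdet
    have hinv : (ε • blockL e v)⁻¹ = ε⁻¹ • (blockL e v)⁻¹ := by
      refine Matrix.inv_eq_left_inv ?_
      rw [Matrix.smul_mul, Matrix.mul_smul, smul_smul, inv_mul_cancel₀ hε,
        Matrix.nonsing_inv_mul _ hu, one_smul]
    rw [← forall_and]
    refine forall_congr' fun p => ?_
    rw [hinv, Matrix.smul_mul, Matrix.mul_smul, Matrix.mul_sub, ← Matrix.mul_assoc,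
      Matrix.nonsing_inv_mul _ hu, Matrix.one_mul, smul_smul, hc, inv_mul_cancel_left₀ hε,
      Matrix.smul_mul, Matrix.mul_smul, smul_smul, inv_mul_cancel₀ hε, one_smul]
    exact gridShift_mem_iff hK (hlu _ _) _ _
  by_cases hv : ε • v ∈ chartBox e l u
  · have hd := ((mem_chartBox_iff e l u _).1 hv)
    have hlt : ∀ p : κ × ρ, ⌊K * (((blockL e v)⁻¹ * blockR e v) p.1 p.2 - l p.1 (e (Sum.inr p.2))) /
          (u p.1 (e (Sum.inr p.2)) - l p.1 (e (Sum.inr p.2)))⌋₊ < K := by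
      intro p
      refine floor_grid_lt hK (hlu _ _) ?_
      have h2 := hd.2 p
      have hdet : (blockL e v).det ≠ 0 := by
        intro h0
        exact hd.1.1 (by rw [blockL_smul, Matrix.det_smul, h0, mul_zero])
      have hinv : (ε • blockL e v)⁻¹ = ε⁻¹ • (blockL e v)⁻¹ := by
        refine Matrix.inv_eq_left_inv ?_
        rw [Matrix.smul_mul, Matrix.mul_smul, smul_smul, inv_mul_cancel₀ hε,
          Matrix.nonsing_inv_mul _ (isUnit_iff_ne_zero.2 hdet), one_smul]
      rwa [blockL_smul, blockR_smul, hinv, Matrix.smul_mul, Matrix.mul_smul, smul_smul,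
        inv_mul_cancel₀ hε, one_smul] at h2
    rw [Finset.sum_eq_single fun p => (⟨_, hlt p⟩ : Fin K)]
    · exact (Set.indicator_of_mem ((hmem fun p => ⟨_, hlt p⟩).2 ⟨hv, fun p => rfl⟩) _).trans
        (Set.indicator_of_mem hv (1 : (κ → Fin n → ℝ) → ENNReal)).symm
    · intro k _ hk
      refine Set.indicator_of_notMem (fun h => hk ?_) _
      funext p
      exact Fin.ext (((hmem k).1 h).2 p)
    · simp
  · rw [Set.indicator_of_notMem hv]
    exact Finset.sum_eq_zero fun k _ =>
      Set.indicator_of_notMem (fun h => hv ((hmem k).1 h).1) _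

end

section

set_option linter.unusedSectionVars false

variable {n : ℕ} {κ ρ : Type} [Fintype κ] [Fintype ρ]

theorem continuous_det_blockL (e : κ ⊕ ρ ≃ Fin n) :
    Continuous fun v : κ → Fin n → ℝ => (blockL e v).det := by
  refine Continuous.matrix_det (continuous_matrix fun i j => ?_)
  simp only [blockL, Matrix.of_apply]
  fun_prop

theorem continuous_adjugate_blockL (e : κ ⊕ ρ ≃ Fin n) (i j : κ) :
    Continuous fun v : κ → Fin n → ℝ => (blockL e v).adjugate i j := by
  refine Continuous.matrix_elem (Continuous.matrix_adjugate (continuous_matrix fun i j => ?_)) i j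
  simp only [blockL, Matrix.of_apply]
  fun_prop

theorem volume_det_blockL_eq_zero (e : κ ⊕ ρ ≃ Fin n) :
    volume {v : κ → Fin n → ℝ | (blockL e v).det = 0} = 0 := by
  let L : ℝ →ₗ[ℝ] (κ → Fin n → ℝ) := LinearMap.toSpanSingleton ℝ _ (blockJoin e 1 0)
  have hs : MeasurableSet {v : κ → Fin n → ℝ | (blockL e v).det ≠ 0} :=
    ((isClosed_singleton (x := (0 : ℝ))).preimage (continuous_det_blockL e)).isOpen_compl.measurableSet
  have key := ae_mem_of_ae_add_linearMap_mem (μ := (volume : Measure ℝ))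
    (ν := (volume : Measure (κ → Fin n → ℝ))) L hs (fun y => ?_)
  · simpa [ae_iff] using key
  · have hL : ∀ t : ℝ, (blockL e (y + L t)).det = (-(blockL e y)).charpoly.eval t := by
      intro t
      rw [Matrix.eval_charpoly]
      congr 1
      ext i j
      simp [blockL, L, blockJoin, Matrix.one_apply, Matrix.diagonal_apply, add_comm]
    have hfin : {t : ℝ | (-(blockL e y)).charpoly.eval t = 0}.Finite := by
      refine ((-(blockL e y)).charpoly.roots.toFinset.finite_toSet).subset fun t ht => ?_
      simp only [Finset.mem_coe, Multiset.mem_toFinset]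
      exact (Polynomial.mem_roots (Matrix.charpoly_monic _).ne_zero).2 ht
    filter_upwards [hfin.measure_zero volume |> compl_mem_ae_iff.2] with t ht
    intro h
    rw [hL] at h
    exact ht h

theorem measurable_blockNormalize (e : κ ⊕ ρ ≃ Fin n) :
    Measurable (blockNormalize e : (κ → Fin n → ℝ) → _) := by
  refine measurable_pi_lambda _ fun i => measurable_pi_lambda _ fun l => ?_
  obtain ⟨s, rfl⟩ := e.surjective l
  cases s with
  | inl j =>
    simp only [blockNormalize, blockJoin, blockL, Equiv.symm_apply_apply, Sum.elim_inl,
      Matrix.of_apply]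
    fun_prop
  | inr j =>
    simp only [blockNormalize, blockJoin, Equiv.symm_apply_apply, Sum.elim_inr, Matrix.mul_apply,
      Matrix.inv_def, Matrix.smul_apply, smul_eq_mul, Ring.inverse_eq_inv', blockR, Matrix.of_apply]
    refine Finset.measurable_sum _ fun m _ => Measurable.mul (Measurable.mul ?_ ?_) ?_
    · exact (continuous_det_blockL e).measurable.inv
    · exact (continuous_adjugate_blockL e _ _).measurable
    · fun_prop

theorem continuousAt_blockNormalize (e : κ ⊕ ρ ≃ Fin n) {v : κ → Fin n → ℝ}
    (hv : (blockL e v).det ≠ 0) : ContinuousAt (blockNormalize e) v := by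
  refine tendsto_pi_nhds.2 fun i => tendsto_pi_nhds.2 fun l => ?_
  obtain ⟨s, rfl⟩ := e.surjective l
  cases s with
  | inl j =>
    simp only [blockNormalize, blockJoin, blockL, Equiv.symm_apply_apply, Sum.elim_inl,
      Matrix.of_apply]
    exact Continuous.tendsto (by fun_prop) v
  | inr j =>
    simp only [blockNormalize, blockJoin, Equiv.symm_apply_apply, Sum.elim_inr, Matrix.mul_apply,
      Matrix.inv_def, Matrix.smul_apply, smul_eq_mul, Ring.inverse_eq_inv', blockR, Matrix.of_apply]
    refine tendsto_finsetSum _ fun m _ => Filter.Tendsto.mul (Filter.Tendsto.mul ?_ ?_) ?_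
    · exact ((continuous_det_blockL e).tendsto v).inv₀ hv
    · exact (continuous_adjugate_blockL e _ _).tendsto v
    · exact Continuous.tendsto (by fun_prop) v

theorem differentiable_blockUnnormalize (e : κ ⊕ ρ ≃ Fin n) :
    Differentiable ℝ (blockUnnormalize e : (κ → Fin n → ℝ) → _) := by
  refine differentiable_pi.2 fun i => differentiable_pi.2 fun l => ?_
  obtain ⟨s, rfl⟩ := e.surjective l
  cases s with
  | inl j =>
    simp only [blockUnnormalize, blockJoin, blockL, Equiv.symm_apply_apply, Sum.elim_inl,
      Matrix.of_apply]
    fun_prop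
  | inr j =>
    simp only [blockUnnormalize, blockJoin, Equiv.symm_apply_apply, Sum.elim_inr, Matrix.mul_apply,
      blockL, blockR, Matrix.of_apply]
    fun_prop

/-- The half-open box with corners `l` and `u`. -/
def tupleBox (l u : κ → Fin n → ℝ) : Set (κ → Fin n → ℝ) :=
  {v | ∀ i j, v i j ∈ Set.Ico (l i j) (u i j)}

theorem tupleBox_eq_pi (l u : κ → Fin n → ℝ) : tupleBox l u =
    Set.pi Set.univ fun i => Set.pi Set.univ fun j => Set.Ico (l i j) (u i j) := by
  ext v
  simp only [tupleBox, Set.mem_univ_pi]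
  rfl

theorem measurableSet_tupleBox (l u : κ → Fin n → ℝ) : MeasurableSet (tupleBox l u) := by
  rw [tupleBox_eq_pi]
  exact MeasurableSet.univ_pi fun i => MeasurableSet.univ_pi fun j => measurableSet_Ico

theorem volume_frontier_tupleBox (l u : κ → Fin n → ℝ) :
    volume (frontier (tupleBox l u)) = 0 := by
  refine Convex.addHaar_frontier (μ := volume) ?_
  rw [tupleBox_eq_pi]
  exact convex_pi fun i _ => convex_pi fun j _ => convex_Ico _ _

theorem isBounded_tupleBox (l u : κ → Fin n → ℝ) : Bornology.IsBounded (tupleBox l u) := by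
  rw [tupleBox_eq_pi]
  exact Bornology.IsBounded.pi fun i => Bornology.IsBounded.pi fun j => Metric.isBounded_Ico _ _

theorem chartBox_subset_image (e : κ ⊕ ρ ≃ Fin n) (l u : κ → Fin n → ℝ) :
    chartBox e l u ⊆ blockUnnormalize e '' tupleBox l u := fun v hv =>
  ⟨blockNormalize e v, hv.2, blockUnnormalize_normalize e hv.1⟩

theorem isBounded_chartBox (e : κ ⊕ ρ ≃ Fin n) (l u : κ → Fin n → ℝ) :
    Bornology.IsBounded (chartBox e l u) := by
  refine Bornology.IsBounded.subset (IsCompact.isBounded ?_)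
    ((chartBox_subset_image e l u).trans (Set.image_mono subset_closure))
  exact (isBounded_tupleBox l u).isCompact_closure.image
    (differentiable_blockUnnormalize e).continuous

theorem isOpen_det_blockL_ne_zero (e : κ ⊕ ρ ≃ Fin n) :
    IsOpen {v : κ → Fin n → ℝ | (blockL e v).det ≠ 0} :=
  ((isClosed_singleton (x := (0 : ℝ))).preimage (continuous_det_blockL e)).isOpen_compl

theorem measurableSet_chartBox (e : κ ⊕ ρ ≃ Fin n) (l u : κ → Fin n → ℝ) :
    MeasurableSet (chartBox e l u) :=
  (isOpen_det_blockL_ne_zero e).measurableSet.inter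
    (measurable_blockNormalize e (measurableSet_tupleBox l u))

theorem volume_frontier_chartBox (e : κ ⊕ ρ ≃ Fin n) (l u : κ → Fin n → ℝ) :
    volume (frontier (chartBox e l u)) = 0 := by
  have hsub : frontier (chartBox e l u) ⊆ {v | (blockL e v).det = 0} ∪
      blockUnnormalize e '' frontier (tupleBox l u) := by
    intro v hv
    by_cases hdet : (blockL e v).det = 0
    · exact Or.inl hdet
    refine Or.inr ⟨blockNormalize e v, ⟨?_, ?_⟩, blockUnnormalize_normalize e hdet⟩
    · refine mem_closure_iff_nhds.2 fun t ht => ?_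
      obtain ⟨w, hw1, hw2⟩ := mem_closure_iff_nhds.1 hv.1 _ (continuousAt_blockNormalize e hdet ht)
      exact ⟨_, hw1, hw2.2⟩
    · intro hintegral
      refine hv.2 (mem_interior_iff_mem_nhds.2 ?_)
      filter_upwards [continuousAt_blockNormalize e hdet (mem_interior_iff_mem_nhds.1 hintegral),
        (isOpen_det_blockL_ne_zero e).mem_nhds hdet] with w h1 h2
      exact ⟨h2, h1⟩
  refine measure_mono_null hsub (measure_union_null (volume_det_blockL_eq_zero e) ?_)
  exact addHaar_image_eq_zero_of_differentiableOn_of_addHaar_eq_zero volume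
    (differentiable_blockUnnormalize e).differentiableOn (volume_frontier_tupleBox l u)

end

section

variable {n : ℕ} {κ ρ : Type} [Fintype κ] [Fintype ρ]

theorem tupleMeasure_chartBox [Nonempty ρ] (μ : Measure (LatSpace n)) [IsProbabilityMeasure μ]
    (hinv : ∀ a : SLR n, μ.map (rTranslate n a) = μ) (e : κ ⊕ ρ ≃ Fin n) (l u : κ → Fin n → ℝ)
    (hlu : ∀ i j, l i j < u i j) :
    tupleMeasure κ μ (chartBox e l u) = volume (chartBox e l u) := by
  have hmA := measurableSet_chartBox e l u
  have hcard : Fintype.card κ + Fintype.card ρ = n := by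
    have := Fintype.card_congr e
    simpa using this
  have hr : Fintype.card ρ ≠ 0 := Fintype.card_ne_zero
  rw [tupleMeasure_apply μ hmA]
  have hM : ∀ J : ℕ, ((J : ℝ) + 1) ≠ 0 := fun J => by positivity
  let ε : ℕ → ℝ := fun J => (((J : ℝ) + 1) ^ Fintype.card ρ)⁻¹
  let c : ℕ → ℝ := fun J => ((J : ℝ) + 1) ^ Fintype.card κ
  have hε : ∀ J, ε J ≠ 0 := fun J => inv_ne_zero (pow_ne_zero _ (hM J))
  have hdet : ∀ J (U : Matrix κ ρ ℝ), (shearMatrix e (ε J) (c J) U).det = 1 := by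
    intro J U
    rw [det_shearMatrix]
    simp only [ε, c]
    rw [inv_pow, ← pow_mul, ← pow_mul, mul_comm (Fintype.card κ)]
    exact inv_mul_cancel₀ (pow_ne_zero _ (hM J))
  have hc : ∀ J, c J = ε J * ((J + 1) ^ n : ℕ) := by
    intro J
    simp only [ε, c]
    rw [← hcard]
    push_cast
    rw [pow_add]
    field_simp
  let a : ∀ J : ℕ, (κ × ρ → Fin ((J + 1) ^ n)) → SLR n := fun J k =>
    ⟨shearMatrix e (ε J) (c J) (Matrix.of fun i j =>
        gridShift ((J + 1) ^ n) (l i (e (Sum.inr j))) (u i (e (Sum.inr j))) (k (i, j))), hdet J _⟩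
  have : ∀ J : ℕ, Nonempty (Fin ((J + 1) ^ n)) := fun J => ⟨⟨0, by positivity⟩⟩
  refine lintegral_eq_of_average_tendsto μ (fun J => κ × ρ → Fin ((J + 1) ^ n))
    (fun J k => rTranslate n (a J k)) (fun J k => ⟨measurable_rTranslate _, hinv _⟩) _
    (measurable_siegelSum (measurable_one.indicator hmA)) _ fun x => ?_
  obtain ⟨g, rfl⟩ := exists_latMk_eq x
  have hlim := (tendsto_tsum_indicator_rowMul (chartBox e l u) (isBounded_chartBox e l u) hmA
    (volume_frontier_chartBox e l u) g).comp
    ((Filter.tendsto_pow_atTop hr).comp (Filter.tendsto_add_atTop_nat 1))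
  refine hlim.congr fun J => ?_
  simp only [Function.comp_apply]
  congr 1
  · congr 1
    rw [Fintype.card_fun, Fintype.card_prod, Fintype.card_fin]
    push_cast
    rw [← pow_mul, ← pow_mul]
    congr 1
    ring
  · simp_rw [siegelSum_rTranslate, siegelSum_mk]
    rw [← Summable.tsum_finsetSum fun _ _ => ENNReal.summable]
    refine tsum_congr fun w => ?_
    have := sum_indicator_chartBox e l u hlu ((J + 1) ^ n) (by positivity) (ε J) (c J) (hε J) (hc J)
      (rowMul (realTuple w) g)
    refine Eq.trans ?_ this.symm
    congr 2
    simp [ε]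

/-- The tuples with invertible left block. -/
def chartDomain (e : κ ⊕ ρ ≃ Fin n) : Set (κ → Fin n → ℝ) := {v | (blockL e v).det ≠ 0}

theorem measurableSet_chartDomain (e : κ ⊕ ρ ≃ Fin n) : MeasurableSet (chartDomain e) :=
  (isOpen_det_blockL_ne_zero e).measurableSet

theorem measure_ext_tupleBox (ν₁ ν₂ : Measure (κ → Fin n → ℝ))
    (h : ∀ l u : κ → Fin n → ℝ, (∀ i j, l i j < u i j) → ν₁ (tupleBox l u) = ν₂ (tupleBox l u))
    (hfin : ∀ l u : κ → Fin n → ℝ, (∀ i j, l i j < u i j) → ν₁ (tupleBox l u) ≠ ⊤) : ν₁ = ν₂ := by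
  let C : Set (Set ℝ) := {S | ∃ l u, l < u ∧ Set.Ico l u = S}
  have hC : borel ℝ = MeasurableSpace.generateFrom C := borel_eq_generateFrom_Ico ℝ
  have hCspan : IsCountablySpanning C := by
    refine ⟨fun m : ℕ => Set.Ico (-(m : ℝ) - 1) (m + 1), fun m => ⟨_, _, by
      have : (0 : ℝ) ≤ m := Nat.cast_nonneg m
      linarith, rfl⟩, ?_⟩
    refine Set.eq_univ_of_forall fun x => Set.mem_iUnion.2 ?_
    obtain ⟨m, hm⟩ := exists_nat_gt |x|
    exact ⟨m, by linarith [neg_abs_le x], by linarith [le_abs_self x]⟩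
  let D : Set (Set (Fin n → ℝ)) := Set.pi Set.univ '' Set.pi Set.univ fun _ : Fin n => C
  have hDgen : MeasurableSpace.generateFrom D = MeasurableSpace.pi :=
    generateFrom_eq_pi (fun _ => by rw [← hC]; exact (BorelSpace.measurable_eq).symm) fun _ => hCspan
  have hDspan : IsCountablySpanning D := IsCountablySpanning.pi fun _ => hCspan
  let E : Set (Set (κ → Fin n → ℝ)) := Set.pi Set.univ '' Set.pi Set.univ fun _ : κ => D
  have hEgen : MeasurableSpace.generateFrom E = MeasurableSpace.pi :=
    generateFrom_eq_pi (fun _ => hDgen) fun _ => hDspan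
  have hE : ∀ s ∈ E, ∃ l u : κ → Fin n → ℝ, (∀ i j, l i j < u i j) ∧ s = tupleBox l u := by
    rintro _ ⟨t, ht, rfl⟩
    have ht' : ∀ i, t i ∈ D := fun i => ht i (Set.mem_univ i)
    choose r hr hrt using ht'
    have hr' : ∀ i j, r i j ∈ C := fun i j => hr i j (Set.mem_univ j)
    choose l u hlu hlur using hr'
    refine ⟨l, u, hlu, ?_⟩
    rw [tupleBox_eq_pi]
    congr 1
    funext i
    rw [← hrt i]
    congr 1
    funext j
    exact (hlur i j).symm
  have hCpi : IsPiSystem C := isPiSystem_Ico id id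
  have hEpi : IsPiSystem E := IsPiSystem.pi fun _ => IsPiSystem.pi fun _ => hCpi
  obtain ⟨B, hBE, hBu⟩ := IsCountablySpanning.pi (C := fun _ : κ => D) fun _ => hDspan
  refine Measure.ext_of_generateFrom_of_iUnion E B hEgen.symm hEpi hBu hBE (fun m => ?_) fun s hs => ?_
  · obtain ⟨l, u, hlu, he⟩ := hE _ (hBE m)
    rw [he]
    exact hfin l u hlu
  · obtain ⟨l, u, hlu, rfl⟩ := hE s hs
    exact h l u hlu

theorem tupleMeasure_eq_volume_of_subset_chartDomain [Nonempty ρ] (μ : Measure (LatSpace n))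
    [IsProbabilityMeasure μ] (hinv : ∀ a : SLR n, μ.map (rTranslate n a) = μ)
    (e : κ ⊕ ρ ≃ Fin n) {A : Set (κ → Fin n → ℝ)} (hA : MeasurableSet A)
    (hAe : A ⊆ chartDomain e) : tupleMeasure κ μ A = volume A := by
  have hT := measurableSet_chartDomain e
  have hπ := measurable_blockNormalize e
  have key : (((tupleMeasure κ μ).restrict (chartDomain e)).map (blockNormalize e)) =
      ((volume.restrict (chartDomain e)).map (blockNormalize e)) := by
    have hbox : ∀ (ν : Measure (κ → Fin n → ℝ)) l u,
        ((ν.restrict (chartDomain e)).map (blockNormalize e)) (tupleBox l u) = ν (chartBox e l u) := by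
      intro ν l u
      rw [Measure.map_apply hπ (measurableSet_tupleBox l u),
        Measure.restrict_apply (hπ (measurableSet_tupleBox l u)), Set.inter_comm]
      rfl
    refine measure_ext_tupleBox _ _ (fun l u hlu => ?_) fun l u hlu => ?_
    · rw [hbox, hbox, tupleMeasure_chartBox μ hinv e l u hlu]
    · rw [hbox, tupleMeasure_chartBox μ hinv e l u hlu]
      exact (isBounded_chartBox e l u).measure_lt_top.ne
  have hpre : ∀ ν : Measure (κ → Fin n → ℝ), ((ν.restrict (chartDomain e)).map (blockNormalize e))
      (blockUnnormalize e ⁻¹' A) = ν A := by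
    intro ν
    have hσ := (differentiable_blockUnnormalize e).continuous.measurable hA
    rw [Measure.map_apply hπ hσ, Measure.restrict_apply (hπ hσ)]
    congr 1
    ext v
    constructor
    · rintro ⟨h1, h2⟩
      have h1' : blockUnnormalize e (blockNormalize e v) ∈ A := h1
      rwa [blockUnnormalize_normalize e h2] at h1'
    · intro h
      refine ⟨?_, hAe h⟩
      change blockUnnormalize e (blockNormalize e v) ∈ A
      rwa [blockUnnormalize_normalize e (hAe h)]
  rw [← hpre, key, hpre]

end

section

variable {n : ℕ} {κ : Type} [Fintype κ]

theorem exists_mem_chartDomain {v : κ → Fin n → ℝ} (hv : LinearIndependent ℝ v) :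
    ∃ e : κ ⊕ Fin (n - Fintype.card κ) ≃ Fin n, v ∈ chartDomain e := by
  let M : Matrix κ (Fin n) ℝ := Matrix.of v
  have hrank : M.rank = Fintype.card κ := LinearIndependent.rank_matrix (M := M) hv
  obtain ⟨ι, a, ha, hspan, hli⟩ := exists_linearIndependent' ℝ M.col
  have : Fintype ι := Fintype.ofInjective a ha
  have hι : Fintype.card ι = Fintype.card κ := by
    rw [← hrank, Matrix.rank_eq_finrank_span_cols, ← hspan, finrank_span_eq_card hli]
  obtain ⟨b⟩ := Fintype.card_eq.1 hι.symm
  have hab : Function.Injective (a ∘ b) := ha.comp b.injective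
  have hcompl : Fintype.card (Fin (n - Fintype.card κ)) =
      Fintype.card ((Set.range (a ∘ b))ᶜ : Set (Fin n)) := by
    rw [Fintype.card_compl_set, Fintype.card_fin, Fintype.card_fin,
      ← Fintype.card_congr (Equiv.ofInjective _ hab)]
  obtain ⟨b'⟩ := Fintype.card_eq.1 hcompl
  let e : κ ⊕ Fin (n - Fintype.card κ) ≃ Fin n :=
    (Equiv.sumCongr (Equiv.ofInjective _ hab) b').trans (Equiv.Set.sumCompl (Set.range (a ∘ b)))
  refine ⟨e, ?_⟩
  change (blockL e v).det ≠ 0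
  have hcol : (blockL e v).col = (M.col ∘ a) ∘ b := by
    funext j i
    have he : e (Sum.inl j) = a (b j) := by simp [e]
    simp only [blockL, Matrix.col_apply, Matrix.of_apply, Function.comp_apply, he, M]
  have : LinearIndependent ℝ (blockL e v).col := by
    rw [hcol]
    exact hli.comp b b.injective
  exact ((Matrix.isUnit_iff_isUnit_det _).1
    (Matrix.linearIndependent_cols_iff_isUnit.1 this)).ne_zero

theorem linearIndependent_of_mem_chartDomain {ρ : Type} {e : κ ⊕ ρ ≃ Fin n}
    {v : κ → Fin n → ℝ} (hv : v ∈ chartDomain e) : LinearIndependent ℝ v := by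
  have h1 : LinearIndependent ℝ (blockL e v).row :=
    Matrix.linearIndependent_rows_iff_isUnit.2
      ((Matrix.isUnit_iff_isUnit_det _).2 (isUnit_iff_ne_zero.2 hv))
  exact LinearIndependent.of_comp (LinearMap.funLeft ℝ ℝ fun j => e (Sum.inl j)) h1

theorem measurableSet_linearIndependent :
    MeasurableSet {v : κ → Fin n → ℝ | LinearIndependent ℝ v} :=
  (isOpen_setOfPred_linearIndependent (𝕜 := ℝ) (E := Fin n → ℝ) (ι := κ)).measurableSet

theorem volume_not_linearIndependent (h : Fintype.card κ ≤ n) :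
    volume {v : κ → Fin n → ℝ | ¬ LinearIndependent ℝ v} = 0 := by
  have hc : Fintype.card (κ ⊕ Fin (n - Fintype.card κ)) = Fintype.card (Fin n) := by
    simp only [Fintype.card_sum, Fintype.card_fin]
    omega
  obtain ⟨e⟩ := Fintype.card_eq.1 hc
  refine measure_mono_null (fun v hv => ?_) (volume_det_blockL_eq_zero e)
  by_contra h0
  exact hv (linearIndependent_of_mem_chartDomain (e := e) h0)

theorem tupleMeasure_eq_volume (μ : Measure (LatSpace n))
    [IsProbabilityMeasure μ] (hinv : ∀ a : SLR n, μ.map (rTranslate n a) = μ)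
    (h : Fintype.card κ < n) {A : Set (κ → Fin n → ℝ)} (hA : MeasurableSet A)
    (hAi : ∀ v ∈ A, LinearIndependent ℝ v) : tupleMeasure κ μ A = volume A := by
  have : Nonempty (Fin (n - Fintype.card κ)) := ⟨⟨0, by omega⟩⟩
  have hcov : A ⊆ ⋃ e : κ ⊕ Fin (n - Fintype.card κ) ≃ Fin n, chartDomain e := fun v hv =>
    Set.mem_iUnion.2 (exists_mem_chartDomain (hAi v hv))
  have hres := (Measure.restrict_iUnion_congr (μ := tupleMeasure κ μ) (ν := volume)
    (s := fun e : κ ⊕ Fin (n - Fintype.card κ) ≃ Fin n => chartDomain (κ := κ) e)).2 fun e => by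
      ext B hB
      rw [Measure.restrict_apply hB, Measure.restrict_apply hB]
      exact tupleMeasure_eq_volume_of_subset_chartDomain μ hinv e
        (hB.inter (measurableSet_chartDomain e)) Set.inter_subset_right
  have := congrArg (fun ν => ν A) hres
  simpa only [Measure.restrict_apply hA, Set.inter_eq_left.2 hcov] using this

/-- Siegel's mean value formula for linearly independent tuples, as an upper bound for arbitrary
sets of such tuples. -/
theorem lintegral_siegelSum_linearIndependent (μ : Measure (LatSpace n))
    [IsProbabilityMeasure μ] (hinv : ∀ a : SLR n, μ.map (rTranslate n a) = μ)
    (h : Fintype.card κ < n) {A : Set (κ → Fin n → ℝ)} (hA : MeasurableSet A) :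
    ∫⁻ x, siegelSum ((A ∩ {v | LinearIndependent ℝ v}).indicator 1) x ∂μ = volume A := by
  have hm := hA.inter (measurableSet_linearIndependent (n := n) (κ := κ))
  rw [← tupleMeasure_apply μ hm, tupleMeasure_eq_volume μ hinv h hm fun v hv => hv.2]
  refine measure_inter_conull' (measure_mono_null (fun v hv => hv.2) (volume_not_linearIndependent h.le))

end

theorem exists_congruence_basis {I J : Type} [Fintype I] (a : Matrix J I ℤ) {q : ℤ}
    (hq : q ≠ 0) : ∃ B : Matrix I I ℤ, B.det ≠ 0 ∧ (∀ j k, q ∣ (a * B) j k) ∧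
      ∀ y : I → ℤ, (∀ j, q ∣ (a *ᵥ y) j) → ∃ z, y = B *ᵥ z := by
  let N : Submodule ℤ (I → ℤ) :=
    { carrier := {y | ∀ j, q ∣ (a *ᵥ y) j}
      add_mem' := fun {x y} hx hy j => by
        rw [Matrix.mulVec_add]
        exact dvd_add (hx j) (hy j)
      zero_mem' := fun j => by simp
      smul_mem' := fun c x hx j => by
        rw [Matrix.mulVec_smul]
        exact Dvd.dvd.mul_left (hx j) c }
  have hsingle : ∀ i : I, q • (Pi.single i (1 : ℤ)) ∈ N := fun i j => by
    rw [Matrix.mulVec_smul]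
    exact dvd_mul_right _ _
  have hrank : Module.finrank ℤ N = Module.finrank ℤ (I → ℤ) := by
    refine le_antisymm (Submodule.finrank_le N) ?_
    have hli : LinearIndependent ℤ fun i : I => (⟨q • (Pi.single i (1 : ℤ)), hsingle i⟩ : N) := by
      refine LinearIndependent.of_comp N.subtype (Fintype.linearIndependent_iff.2 fun c hc i => ?_)
      have := congrFun hc i
      simpa [Finset.sum_apply, Pi.single_apply, hq] using this
    rw [Module.finrank_fintype_fun_eq_card]
    exact hli.fintype_card_le_finrank
  obtain ⟨-, -, b, -⟩ := Submodule.exists_smith_normal_form_of_rank_eq (Pi.basisFun ℤ I) hrank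
  let B : Matrix I I ℤ := Matrix.of fun i k => (b k : I → ℤ) i
  have hB : ∀ y ∈ N, ∃ z, y = B *ᵥ z := by
    intro y hy
    refine ⟨b.repr ⟨y, hy⟩, ?_⟩
    have := congrArg N.subtype (b.sum_repr ⟨y, hy⟩)
    rw [map_sum] at this
    funext i
    have := congrFun this.symm i
    simpa [Matrix.mulVec, dotProduct, B, mul_comm, Finset.sum_apply] using this
  refine ⟨B, ?_, fun j k => ?_, hB⟩
  · choose z hz using fun i => hB _ (hsingle i)
    have hBC : B * (Matrix.of fun k i => z i k) = q • (1 : Matrix I I ℤ) := by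
      ext k i
      have := congrFun (hz i) k
      rw [Matrix.mul_apply]
      simp only [Matrix.mulVec, dotProduct] at this
      simp only [Matrix.of_apply, ← this, Pi.smul_apply, Matrix.smul_apply, Matrix.one_apply,
        Pi.single_apply]
    have hdet := congrArg Matrix.det hBC
    rw [Matrix.det_mul, Matrix.det_smul, Matrix.det_one, mul_one] at hdet
    intro h0
    rw [h0, zero_mul] at hdet
    exact pow_ne_zero _ hq hdet.symm
  · exact (b k).2 j

theorem dvd_det_of_congruence {I J : Type} [Fintype I] {a : Matrix J I ℤ} {q : ℤ}
    {B : Matrix I I ℤ} (hB : ∀ j k, q ∣ (a * B) j k)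
    (hmin : ∀ m : ℤ, (∀ j i, q ∣ m * a j i) → q ∣ m) : q ∣ B.det := by
  refine hmin _ fun j i => ?_
  have : B.det • a = (a * B) * B.adjugate := by
    rw [Matrix.mul_assoc, Matrix.mul_adjugate, Matrix.mul_smul, Matrix.mul_one]
  have := congrFun (congrFun this j) i
  rw [Matrix.smul_apply, smul_eq_mul, Matrix.mul_apply] at this
  rw [this]
  exact Finset.dvd_sum fun k _ => Dvd.dvd.mul_right (hB j k) _

theorem volume_preimage_mul_left {n : ℕ} {I : Type} [Fintype I] (B : Matrix I I ℝ)
    (hB : B.det ≠ 0) {A : Set (I → Fin n → ℝ)} (hA : MeasurableSet A) :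
    volume {v : I → Fin n → ℝ | (fun i => ∑ k, B i k • v k) ∈ A} =
      ENNReal.ofReal |B.det|⁻¹ ^ n * volume A := by
  let M : Matrix (I × Fin n) (I × Fin n) ℝ := Matrix.kroneckerMap (· * ·) B (1 : Matrix (Fin n) (Fin n) ℝ)
  have hM : M.det = B.det ^ n := by
    have := Matrix.det_kronecker B (1 : Matrix (Fin n) (Fin n) ℝ)
    simp only [Matrix.det_one, one_pow, mul_one, Fintype.card_fin] at this
    exact this
  have hcont : Measurable fun v : I → Fin n → ℝ => fun i => ∑ k, B i k • v k := by
    fun_prop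
  have mp : MeasurePreserving (fun x : I × Fin n → ℝ => Function.curry x) volume volume :=
    measurePreserving_curry I (Fin n)
  have hmap := Real.map_matrix_volume_pi_eq_smul_volume_pi (M := M) (by rw [hM]; exact pow_ne_zero _ hB)
  have hcurry : ∀ x : I × Fin n → ℝ, Function.curry (Matrix.toLin' M x) =
      fun i => ∑ k, B i k • Function.curry x k := by
    intro x
    funext i j
    simp only [Function.curry, Matrix.toLin'_apply, Matrix.mulVec, dotProduct, M,
      Matrix.kroneckerMap_apply, Fintype.sum_prod_type, Matrix.one_apply, Finset.sum_apply,
      Pi.smul_apply, smul_eq_mul]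
    refine Finset.sum_congr rfl fun k _ => ?_
    rw [Finset.sum_eq_single j]
    · simp
    · intro l _ hl
      simp [Ne.symm hl]
    · simp
  have hA' := mp.measurable hA
  have h1 : volume {v : I → Fin n → ℝ | (fun i => ∑ k, B i k • v k) ∈ A} =
      Measure.map (Matrix.toLin' M) volume ((fun x : I × Fin n → ℝ => Function.curry x) ⁻¹' A) := by
    refine ((mp.measure_preimage (hcont hA).nullMeasurableSet).symm.trans ?_).trans
      (Measure.map_apply (LinearMap.continuous_of_finiteDimensional _).measurable hA').symm
    congr 1
    ext x
    change _ ↔ Function.curry (Matrix.toLin' M x) ∈ A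
    rw [hcurry]
    rfl
  rw [h1, hmap, Measure.smul_apply, mp.measure_preimage hA.nullMeasurableSet, hM, smul_eq_mul,
    abs_inv, abs_pow, ← inv_pow, ENNReal.ofReal_pow (by positivity)]

theorem rowMul_realTuple_sum {n : ℕ} {I K : Type} [Fintype K] (B : Matrix I K ℤ)
    (z : K → Fin n → ℤ) (g : SLR n) :
    rowMul (realTuple fun i => ∑ k, B i k • z k) g =
      fun i => ∑ k, (B i k : ℝ) • rowMul (realTuple z) g k := by
  funext i
  simp only [rowMul]
  rw [show realTuple (fun i => ∑ k, B i k • z k) i = ∑ k, (B i k : ℝ) • realTuple z k by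
    funext c
    simp [realTuple, Finset.sum_apply]]
  rw [Matrix.sum_vecMul]
  simp only [Matrix.smul_vecMul]

theorem LinearIndependent.of_sum_smul {I E : Type} [Fintype I] [AddCommGroup E] [Module ℝ E]
    (B : Matrix I I ℝ) {z : I → E} (h : LinearIndependent ℝ fun i => ∑ k, B i k • z k) :
    LinearIndependent ℝ z := by
  rw [linearIndependent_iff_card_le_finrank_span]
  have hle : Submodule.span ℝ (Set.range fun i => ∑ k, B i k • z k) ≤
      Submodule.span ℝ (Set.range z) := by
    refine Submodule.span_le.2 ?_
    rintro _ ⟨i, rfl⟩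
    exact Submodule.sum_mem _ fun k _ => Submodule.smul_mem _ _ (Submodule.subset_span ⟨k, rfl⟩)
  rw [← finrank_span_eq_card h]
  have : FiniteDimensional ℝ (Submodule.span ℝ (Set.range z)) :=
    FiniteDimensional.span_of_finite ℝ (Set.finite_range z)
  exact Submodule.finrank_mono hle

theorem exists_parametrization {n : ℕ} {I J : Type} [Fintype I] [Fintype J]
    {P : Set (Fin n → ℝ)} (hP : MeasurableSet P) {q : ℤ} (hq : 0 < q) (a : Matrix J I ℤ)
    (hmin : ∀ m : ℤ, (∀ j i, q ∣ m * a j i) → q ∣ m)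
    (hone : q = 1 → ∃ j i₁ i₂, i₁ ≠ i₂ ∧ (a j i₁ = 1 ∨ a j i₁ = -1) ∧ (a j i₂ = 1 ∨ a j i₂ = -1)) :
    ∃ (B : Matrix I I ℤ) (T : Set (I → Fin n → ℝ)), MeasurableSet T ∧
      volume T ≤ (if q = 1 then ENNReal.ofReal (Real.sqrt 3 / 2) ^ n
        else ENNReal.ofReal (q : ℝ)⁻¹ ^ n) * volume P ^ Fintype.card I ∧
      ∀ (g : SLR n) (w : I → Fin n → ℤ) (w' : J → Fin n → ℤ),
        (∀ j, q • w' j = ∑ i, a j i • w i) → LinearIndependent ℝ (rowMul (realTuple w) g) →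
        (∀ i, rowMul (realTuple w) g i ∈ P) → (∀ j, rowMul (realTuple w') g j ∈ P) →
        ∃ z : I → Fin n → ℤ, rowMul (realTuple z) g ∈ T ∩ {v | LinearIndependent ℝ v} ∧
          w = fun i => ∑ k, B i k • z k := by
  obtain ⟨B, hB0, hBq, hBz⟩ := exists_congruence_basis a hq.ne'
  have hq' : (0 : ℝ) < q := Int.cast_pos.2 hq
  let A : Set (I → Fin n → ℝ) :=
    {x | (∀ i, x i ∈ P) ∧ ∀ j, (q : ℝ)⁻¹ • ∑ i, (a j i : ℝ) • x i ∈ P}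
  have hA : MeasurableSet A := by
    have hA' : A = (⋂ i : I, {x : I → Fin n → ℝ | x i ∈ P}) ∩
        ⋂ j : J, {x : I → Fin n → ℝ | (q : ℝ)⁻¹ • ∑ i, (a j i : ℝ) • x i ∈ P} := by
      ext x
      simp [A]
    rw [hA']
    refine MeasurableSet.inter (MeasurableSet.iInter fun i => measurable_pi_apply i hP)
      (MeasurableSet.iInter fun j => ?_)
    have hm : Measurable fun x : I → Fin n → ℝ => (q : ℝ)⁻¹ • ∑ i, (a j i : ℝ) • x i := by
      fun_prop
    exact hm hP
  let B' : Matrix I I ℝ := B.map (Int.castRingHom ℝ)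
  have hdet : B'.det = (B.det : ℝ) := by
    have := (RingHom.map_det (Int.castRingHom ℝ) B).symm
    exact this
  have hB'0 : B'.det ≠ 0 := by
    rw [hdet]
    exact_mod_cast hB0
  have hB'm : Measurable fun v : I → Fin n → ℝ => fun i => ∑ k, B' i k • v k := by
    fun_prop
  refine ⟨B, {v | (fun i => ∑ k, B' i k • v k) ∈ A}, hB'm hA, ?_, ?_⟩
  · rw [volume_preimage_mul_left B' hB'0 hA]
    have hqd : (q : ℝ) ≤ |B'.det| := by
      rw [hdet, ← Int.cast_abs]
      exact_mod_cast Int.le_of_dvd (abs_pos.2 hB0) ((dvd_abs _ _).2 (dvd_det_of_congruence hBq hmin))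
    have hle : ENNReal.ofReal |B'.det|⁻¹ ≤ ENNReal.ofReal (q : ℝ)⁻¹ :=
      ENNReal.ofReal_le_ofReal (inv_anti₀ hq' hqd)
    split_ifs with h1
    · obtain ⟨j, i₁, i₂, hi, h₁, h₂⟩ := hone h1
      have hle1 : ENNReal.ofReal |B'.det|⁻¹ ≤ 1 := by
        refine hle.trans ?_
        rw [h1]
        simp
      refine (mul_le_of_le_one_left zero_le (pow_le_one₀ zero_le hle1)).trans ?_
      refine (measure_mono ?_).trans (volume_pi_row_le P hP (fun i => (a j i : ℝ)) i₁ i₂ hi ?_ ?_)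
      · rintro x ⟨hx1, hx2⟩
        refine ⟨hx1, ?_⟩
        have := hx2 j
        rwa [h1, Int.cast_one, inv_one, one_smul] at this
      · rcases h₁ with h | h <;> simp [h]
      · rcases h₂ with h | h <;> simp [h]
    · refine mul_le_mul' (pow_le_pow_left₀ zero_le hle n) ?_
      refine (measure_mono (t := Set.pi Set.univ fun _ => P) fun x hx i _ => hx.1 i).trans ?_
      rw [volume_pi_pi, Finset.prod_const, Finset.card_univ]
  · intro g w w' hw hind hwP hw'P
    choose z hz using fun c : Fin n => hBz (fun i => w i c) fun j => ⟨w' j c, by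
      have := congrFun (hw j) c
      simp only [Pi.smul_apply, smul_eq_mul, Finset.sum_apply] at this
      rw [this]
      rfl⟩
    have hwz : w = fun i => ∑ k, B i k • (fun c => z c k) := by
      funext i c
      have := congrFun (hz c) i
      simpa [Matrix.mulVec, dotProduct, Finset.sum_apply] using this
    have hrow := rowMul_realTuple_sum B (fun k c => z c k) g
    rw [← hwz] at hrow
    refine ⟨fun k c => z c k, ⟨?_, ?_⟩, hwz⟩
    · have hmem : rowMul (realTuple w) g ∈ A := by
        refine ⟨hwP, fun j => ?_⟩
        have h1 : (q : ℝ) • rowMul (realTuple w') g j =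
            ∑ i, (a j i : ℝ) • rowMul (realTuple w) g i := by
          rw [← congrFun (rowMul_realTuple_sum a w g) j]
          have h2 : realTuple (fun i => ∑ k, a i k • w k) j = (q : ℝ) • realTuple w' j := by
            funext c
            have := congrFun (hw j) c
            simp only [realTuple, Pi.smul_apply, smul_eq_mul]
            rw [← this]
            simp
          simp only [rowMul, h2, Matrix.smul_vecMul]
        rw [← h1, smul_smul, inv_mul_cancel₀ hq'.ne', one_smul]
        exact hw'P j
      rw [hrow] at hmem
      exact hmem
    · rw [hrow] at hind
      exact LinearIndependent.of_sum_smul B' hind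

theorem exists_basis_bounded_coords {ι M : Type} [Fintype ι] [AddCommGroup M] [Module ℚ M]
    (u : ι → M) : ∃ I : Finset ι, LinearIndependent ℚ (fun i : {i // i ∈ I} => u i) ∧
      ∀ j, ∃ d : {i // i ∈ I} → ℚ, (∀ i, |d i| ≤ 1) ∧ u j = ∑ i, d i • u i := by
  let W := Submodule.span ℚ (Set.range u)
  let u' : ι → W := fun j => ⟨u j, Submodule.subset_span ⟨j, rfl⟩⟩
  have hu' : Submodule.span ℚ (Set.range u') = ⊤ := by
    refine (Submodule.map_injective_of_injective W.subtype_injective) ?_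
    rw [Submodule.map_span, ← Set.range_comp, Submodule.map_top, Submodule.range_subtype]
    rfl
  obtain ⟨κ, s, hs, hspan, hli⟩ := exists_linearIndependent' ℚ u'
  have : Fintype κ := Fintype.ofInjective s hs
  let b : Module.Basis κ ℚ W := Module.Basis.mk hli (by rw [hspan, hu'])
  have : Nonempty (κ → ι) := ⟨s⟩
  obtain ⟨σ, hσ⟩ := Finite.exists_max fun σ : κ → ι => |b.det (u' ∘ σ)|
  have hb1 : b.det (u' ∘ s) = 1 := by
    have : (u' ∘ s) = b := by simp [b]
    rw [this, b.det_self]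
  have hpos : 0 < |b.det (u' ∘ σ)| := by
    have := hσ s
    simp only [hb1, abs_one] at this
    linarith
  obtain ⟨hσli, hσsp⟩ := b.is_basis_iff_det.2 (isUnit_iff_ne_zero.2 (abs_pos.1 hpos))
  let c : Module.Basis κ ℚ W := Module.Basis.mk hσli hσsp.ge
  have hc : ∀ j k, |c.repr (u' j) k| ≤ 1 := by
    intro j k
    have h1 := LinearMap.congr_fun (b.det_smul_mk_coord_eq_det_update hσli hσsp.ge k) (u' j)
    have h2 : b.det (u' ∘ σ) * c.repr (u' j) k = b.det (u' ∘ Function.update σ k j) := by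
      rw [Function.comp_update]
      exact h1
    have h3 := hσ (Function.update σ k j)
    simp only [← h2, abs_mul] at h3
    exact le_of_mul_le_mul_left (by linarith) hpos
  have hσinj : Function.Injective σ := fun x y hxy =>
    hσli.injective (by simp [hxy])
  let e : κ ≃ {i // i ∈ Finset.univ.image σ} := Equiv.ofBijective
    (fun k => ⟨σ k, Finset.mem_image_of_mem _ (Finset.mem_univ k)⟩)
    ⟨fun x y hxy => hσinj (congrArg Subtype.val hxy), fun ⟨i, hi⟩ => by
      obtain ⟨k, -, rfl⟩ := Finset.mem_image.1 hi
      exact ⟨k, rfl⟩⟩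
  refine ⟨Finset.univ.image σ, ?_, fun j => ⟨fun i => c.repr (u' j) (e.symm i), fun i => hc _ _, ?_⟩⟩
  · rw [← linearIndependent_equiv e]
    exact hσli.map' W.subtype (LinearMap.ker_eq_bot.2 W.subtype_injective)
  · rw [← e.sum_comp]
    simp only [Equiv.symm_apply_apply]
    have := congrArg W.subtype (c.sum_repr (u' j))
    rw [map_sum] at this
    simp only [map_smul, c, Module.Basis.mk_apply] at this
    exact this.symm

theorem exists_common_denominator {I J : Type} [Fintype I] [Fintype J] (D : J → I → ℚ) :
    ∃ q : ℕ, 0 < q ∧ ∃ a : Matrix J I ℤ, (∀ j i, (a j i : ℚ) = q * D j i) ∧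
      ∀ m : ℤ, (∀ j i, (q : ℤ) ∣ m * a j i) → (q : ℤ) ∣ m := by
  let q : ℕ := (Finset.univ : Finset (J × I)).lcm fun p => (D p.1 p.2).den
  have hq : q ≠ 0 := by
    rw [Ne, Finset.lcm_eq_zero_iff]
    simp
  have hdvd : ∀ j i, (D j i).den ∣ q := fun j i =>
    Finset.dvd_lcm (f := fun p : J × I => (D p.1 p.2).den) (Finset.mem_univ (j, i))
  refine ⟨q, Nat.pos_of_ne_zero hq, fun j i => (D j i).num * ((q / (D j i).den : ℕ) : ℤ),
    fun j i => ?_, fun m hm => ?_⟩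
  · obtain ⟨t, ht⟩ := hdvd j i
    have hden : ((D j i).den : ℚ) ≠ 0 := by simp
    simp only
    rw [ht, Nat.mul_div_cancel_left _ (D j i).den_pos]
    conv_rhs => rw [← Rat.num_div_den (D j i)]
    push_cast
    rw [Rat.num_div_den]
    nth_rewrite 1 [← Rat.mul_den_eq_num (D j i)]
    ring
  · rw [← Int.natAbs_dvd_natAbs, Int.natAbs_natCast]
    refine Finset.lcm_dvd fun p _ => ?_
    have h1 := hm p.1 p.2
    obtain ⟨t, ht⟩ := hdvd p.1 p.2
    simp only at h1
    rw [ht, Nat.mul_div_cancel_left _ (D p.1 p.2).den_pos] at h1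
    have ht0 : (t : ℤ) ≠ 0 := by
      intro h0
      apply hq
      rw [ht, Int.natCast_eq_zero.1 h0, mul_zero]
    have h2 : ((D p.1 p.2).den : ℤ) ∣ m * (D p.1 p.2).num := by
      refine (mul_dvd_mul_iff_right ht0).1 ?_
      push_cast at h1
      rwa [mul_assoc]
    have h3 : ((D p.1 p.2).den : ℤ) ∣ m := by
      refine Int.dvd_of_dvd_mul_left_of_gcd_one h2 ?_
      have := (D p.1 p.2).reduced
      rw [Int.gcd_comm]
      exact this
    exact Int.natCast_dvd.1 h3

theorem linearIndependent_rowMul {n : ℕ} {I : Type} {v : I → Fin n → ℝ} (g : SLR n) :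
    LinearIndependent ℝ (rowMul v g) ↔ LinearIndependent ℝ v := by
  constructor
  · intro h
    exact LinearIndependent.of_comp (Matrix.vecMulLinear (g : Matrix (Fin n) (Fin n) ℝ)) h
  · intro h
    have h' : LinearIndependent ℝ (rowMul (rowMul v g) g⁻¹) := by
      rwa [← rowMul_mul, mul_inv_cancel, rowMul_one]
    exact LinearIndependent.of_comp
      (Matrix.vecMulLinear ((g⁻¹ : SLR n) : Matrix (Fin n) (Fin n) ℝ)) h'

theorem linearIndependent_realTuple {n : ℕ} {I : Type} {w : I → Fin n → ℤ} :
    LinearIndependent ℝ (realTuple w) ↔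
      LinearIndependent ℚ (fun i => fun j => ((w i j : ℤ) : ℚ)) := by
  rw [← linearIndependent_algebraMap_comp_iff (R := ℚ) (S := ℝ)]
  have : realTuple w = fun i => algebraMap ℚ ℝ ∘ fun j => ((w i j : ℤ) : ℚ) := by
    funext i j
    simp [realTuple]
  rw [this]

/-- The integer matrix with entries in `[-q, q]` encoded by `a`. -/
def coeffMatrix {I J : Type} (q : ℕ) (a : J → I → Fin (2 * q + 1)) : Matrix J I ℤ :=
  Matrix.of fun j i => ((a j i : ℕ) : ℤ) - q

theorem exists_coeffMatrix_eq {I J : Type} {q : ℕ} (a : Matrix J I ℤ) (ha : ∀ j i, |a j i| ≤ q) :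
    ∃ a' : J → I → Fin (2 * q + 1), coeffMatrix q a' = a := by
  refine ⟨fun j i => ⟨(a j i + q).toNat, ?_⟩, ?_⟩
  · have := abs_le.1 (ha j i)
    omega
  · ext j i
    have := abs_le.1 (ha j i)
    simp only [coeffMatrix, Matrix.of_apply]
    omega

/-- The side conditions satisfied by the reduced coefficients of a dependent tuple. -/
def CoeffAdmissible {I J : Type} (q : ℕ) (a : Matrix J I ℤ) : Prop :=
  0 < q ∧ (∀ m : ℤ, (∀ j i, (q : ℤ) ∣ m * a j i) → (q : ℤ) ∣ m) ∧
    (q = 1 → ∃ j i₁ i₂, i₁ ≠ i₂ ∧ (a j i₁ = 1 ∨ a j i₁ = -1) ∧ (a j i₂ = 1 ∨ a j i₂ = -1))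

theorem exists_coefficients {n : ℕ} {ι : Type} [Fintype ι] {P : Set (Fin n → ℝ)} (hP0 : (0 : Fin n → ℝ) ∉ P)
    (hPneg : ∀ x ∈ P, -x ∉ P) (g : SLR n) (w : ι → Fin n → ℤ) (hinj : Function.Injective w)
    (hwP : ∀ i, rowMul (realTuple w) g i ∈ P)
    (hdep : ¬ LinearIndependent ℝ (rowMul (realTuple w) g)) :
    ∃ (I : Finset ι) (q : ℕ) (a : {j // j ∉ I} → {i // i ∈ I} → Fin (2 * q + 1)),
      I ≠ ∅ ∧ I ≠ Finset.univ ∧ CoeffAdmissible q (coeffMatrix q a) ∧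
      (∀ j : {j // j ∉ I}, (q : ℤ) • w j = ∑ i, coeffMatrix q a j i • w i) ∧
      LinearIndependent ℝ (rowMul (realTuple fun i : {i // i ∈ I} => w i) g) := by
  have hw0 : ∀ i, w i ≠ 0 := by
    intro i h0
    apply hP0
    convert hwP i using 1
    have : realTuple w i = 0 := by
      funext c
      simp [realTuple, h0]
    simp only [rowMul]
    rw [this, Matrix.zero_vecMul]
  have hwneg : ∀ i j, w i ≠ -w j := by
    intro i j h0
    apply hPneg _ (hwP j)
    convert hwP i using 1
    simp only [rowMul]
    rw [← Matrix.neg_vecMul]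
    congr 1
    funext c
    simp [realTuple, h0]
  obtain ⟨I, hI, hd⟩ := exists_basis_bounded_coords fun i => (fun j => ((w i j : ℤ) : ℚ))
  choose d hd1 hd2 using hd
  obtain ⟨q, hq, a, ha, hmin⟩ := exists_common_denominator fun (j : {j // j ∉ I}) => d j
  have hq' : (0 : ℚ) < q := Nat.cast_pos.2 hq
  have habs : ∀ j i, |a j i| ≤ q := by
    intro j i
    have h1 : |(a j i : ℚ)| ≤ q := by
      rw [ha, abs_mul, abs_of_pos hq']
      exact mul_le_of_le_one_right hq'.le (hd1 _ _)
    exact_mod_cast h1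
  have hrel : ∀ j : {j // j ∉ I}, (q : ℤ) • w j = ∑ i, a j i • w i := by
    intro j
    funext c
    have h1 := congrFun (hd2 j) c
    simp only [Finset.sum_apply, Pi.smul_apply, smul_eq_mul] at h1 ⊢
    have : ((q * w j c : ℤ) : ℚ) = ((∑ i, a j i * w i c : ℤ) : ℚ) := by
      push_cast
      rw [h1, Finset.mul_sum]
      exact Finset.sum_congr rfl fun i _ => by rw [ha, mul_assoc]
    exact_mod_cast this
  obtain ⟨a', ha'⟩ := exists_coeffMatrix_eq a habs
  have hind : LinearIndependent ℝ (rowMul (realTuple fun i : {i // i ∈ I} => w i) g) := by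
    rw [linearIndependent_rowMul, linearIndependent_realTuple]
    exact hI
  have huniv : I ≠ Finset.univ := by
    rintro rfl
    apply hdep
    rw [linearIndependent_rowMul] at hind ⊢
    exact hind.comp (fun i => ⟨i, Finset.mem_univ i⟩) fun x y hxy => congrArg Subtype.val hxy
  obtain ⟨j₀, hj₀⟩ : ∃ j, j ∉ I := by
    by_contra! h
    exact huniv (Finset.eq_univ_iff_forall.2 h)
  refine ⟨I, q, a', ?_, huniv, ?_, ?_, hind⟩
  · rintro rfl
    have h1 := hrel ⟨j₀, hj₀⟩
    have : (q : ℤ) • w j₀ = 0 := h1.trans (Finset.sum_of_isEmpty _)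
    rcases smul_eq_zero.1 this with h | h
    · omega
    · exact hw0 _ h
  · rw [ha']
    refine ⟨hq, hmin, fun h1 => ?_⟩
    have hrow := hrel ⟨j₀, hj₀⟩
    have hab := habs ⟨j₀, hj₀⟩
    rw [h1, Nat.cast_one, one_smul] at hrow
    have hval : ∀ i, a ⟨j₀, hj₀⟩ i ≠ 0 → a ⟨j₀, hj₀⟩ i = 1 ∨ a ⟨j₀, hj₀⟩ i = -1 := by
      intro i hi
      have := abs_le.1 (hab i)
      rw [h1] at this
      push_cast at this
      omega
    by_contra! hcon
    have hcon' : ∀ i₁ i₂, a ⟨j₀, hj₀⟩ i₁ ≠ 0 → a ⟨j₀, hj₀⟩ i₂ ≠ 0 → i₁ = i₂ := by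
      intro i₁ i₂ h₁ h₂
      by_contra hne
      have := hcon ⟨j₀, hj₀⟩ i₁ i₂ hne (hval i₁ h₁)
      rcases hval i₂ h₂ with h | h
      · exact this.1 h
      · exact this.2 h
    by_cases hall : ∀ i, a ⟨j₀, hj₀⟩ i = 0
    · apply hw0 j₀
      rw [hrow]
      exact Finset.sum_eq_zero fun i _ => by rw [hall i, zero_smul]
    · push Not at hall
      obtain ⟨i, hi⟩ := hall
      rw [Finset.sum_eq_single i (fun i' _ hi' => by
        by_cases h0 : a ⟨j₀, hj₀⟩ i' = 0
        · rw [h0, zero_smul]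
        · exact absurd (hcon' _ _ h0 hi) hi') (by simp)] at hrow
      rcases hval i hi with h | h
      · rw [h, one_smul] at hrow
        have hji : j₀ = (i : ι) := hinj hrow
        exact hj₀ (hji ▸ i.2)
      · rw [h, neg_smul, one_smul] at hrow
        exact hwneg _ _ hrow
  · intro j
    rw [ha']
    exact hrel j

theorem tsum_le_tsum_of_recover {α γ : Type} {F : α → ENNReal} {G : γ → ENNReal} (r : γ → α)
    (h : ∀ a, F a ≠ 0 → ∃ c, r c = a ∧ F a ≤ G c) : ∑' a, F a ≤ ∑' c, G c := by
  have h' : ∀ a : Function.support F, ∃ c, r c = a ∧ F a ≤ G c := fun a => h a a.2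
  choose s hs hFG using h'
  rw [← tsum_subtype_eq_of_support_subset (s := Function.support F) subset_rfl]
  refine (ENNReal.tsum_le_tsum hFG).trans (ENNReal.tsum_comp_le_tsum_of_injective ?_ G)
  intro a b hab
  exact Subtype.ext (by rw [← hs a, ← hs b, hab])

/-- The factor by which the volume of the parametrizing set shrinks for denominator `q`. -/
noncomputable def denominatorFactor (n q : ℕ) : ENNReal :=
  if q = 1 then ENNReal.ofReal (Real.sqrt 3 / 2) ^ n else ENNReal.ofReal (q : ℝ)⁻¹ ^ n

theorem lintegral_siegelSum_dependent_le {n : ℕ} {ι : Type} [Fintype ι] (μ : Measure (LatSpace n))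
    [IsProbabilityMeasure μ] (hinv : ∀ a : SLR n, μ.map (rTranslate n a) = μ)
    (hcard : Fintype.card ι < n) {P : Set (Fin n → ℝ)} (hP : MeasurableSet P)
    (hP0 : (0 : Fin n → ℝ) ∉ P) (hPneg : ∀ x ∈ P, -x ∉ P) :
    ∫⁻ x, siegelSum (Set.indicator {v : ι → Fin n → ℝ | Function.Injective v ∧ (∀ i, v i ∈ P) ∧
        ¬ LinearIndependent ℝ v} 1) x ∂μ ≤
      ∑ I : Finset ι, ∑' q : ℕ, if I ≠ ∅ ∧ I ≠ Finset.univ ∧ 0 < q then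
        (2 * q + 1 : ENNReal) ^ (I.card * (Fintype.card ι - I.card)) *
          (denominatorFactor n q * volume P ^ I.card) else 0 := by
  let β := (I : Finset ι) × (q : ℕ) × ({j // j ∉ I} → {i // i ∈ I} → Fin (2 * q + 1))
  let good : β → Prop := fun b => b.1 ≠ ∅ ∧ b.1 ≠ Finset.univ ∧
    CoeffAdmissible b.2.1 (coeffMatrix b.2.1 b.2.2)
  have hex : ∀ b : β, ∃ (B : Matrix {i // i ∈ b.1} {i // i ∈ b.1} ℤ)
      (T : Set ({i // i ∈ b.1} → Fin n → ℝ)), MeasurableSet T ∧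
      volume T ≤ (if good b then denominatorFactor n b.2.1 * volume P ^ b.1.card else 0) ∧
      (good b → ∀ (g : SLR n) (w : {i // i ∈ b.1} → Fin n → ℤ) (w' : {j // j ∉ b.1} → Fin n → ℤ),
        (∀ j, (b.2.1 : ℤ) • w' j = ∑ i, coeffMatrix b.2.1 b.2.2 j i • w i) →
        LinearIndependent ℝ (rowMul (realTuple w) g) →
        (∀ i, rowMul (realTuple w) g i ∈ P) → (∀ j, rowMul (realTuple w') g j ∈ P) →
        ∃ z : {i // i ∈ b.1} → Fin n → ℤ,
          rowMul (realTuple z) g ∈ T ∩ {v | LinearIndependent ℝ v} ∧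
          w = fun i => ∑ k, B i k • z k) := by
    intro b
    by_cases hb : good b
    · obtain ⟨hq, hmin, hone⟩ := hb.2.2
      obtain ⟨B, T, hT, hvol, hz⟩ := exists_parametrization hP (Int.natCast_pos.2 hq)
        (coeffMatrix b.2.1 b.2.2) hmin (fun h => hone (by exact_mod_cast h))
      refine ⟨B, T, hT, ?_, fun _ => hz⟩
      rw [if_pos hb]
      refine hvol.trans_eq ?_
      simp [denominatorFactor]
    · exact ⟨0, ∅, MeasurableSet.empty, by simp, fun h => absurd h hb⟩
  choose B T hT hvol hz using hex
  let r : ((b : β) × ({i // i ∈ b.1} → Fin n → ℤ)) → ι → Fin n → ℤ := fun c j =>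
    if hj : j ∈ c.1.1 then ∑ k, B c.1 ⟨j, hj⟩ k • c.2 k
    else fun l => (∑ i, coeffMatrix c.1.2.1 c.1.2.2 ⟨j, hj⟩ i • ∑ k, B c.1 i k • c.2 k) l / c.1.2.1
  have hpt : ∀ x : LatSpace n, siegelSum (Set.indicator {v : ι → Fin n → ℝ |
      Function.Injective v ∧ (∀ i, v i ∈ P) ∧ ¬ LinearIndependent ℝ v} 1) x ≤
      ∑' b : β, siegelSum ((T b ∩ {v | LinearIndependent ℝ v}).indicator 1) x := by
    intro x
    obtain ⟨g, rfl⟩ := exists_latMk_eq x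
    simp only [siegelSum_mk]
    rw [← ENNReal.tsum_sigma' (fun c : (b : β) × ({i // i ∈ b.1} → Fin n → ℤ) =>
      (T c.1 ∩ {v | LinearIndependent ℝ v}).indicator (1 : ({i // i ∈ c.1.1} → Fin n → ℝ) → ENNReal)
        (rowMul (realTuple c.2) g))]
    refine tsum_le_tsum_of_recover r fun w hw => ?_
    have hw' := Set.mem_of_indicator_ne_zero hw
    obtain ⟨hinj, hwP, hdep⟩ := hw'
    have hinj' : Function.Injective w := by
      intro i j hij
      apply hinj
      have : realTuple w i = realTuple w j := by
        funext c
        simp [realTuple, hij]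
      simp only [rowMul, this]
    obtain ⟨I, q, a, hI0, hI1, hadm, hrel, hind⟩ :=
      exists_coefficients hP0 hPneg g w hinj' hwP hdep
    obtain ⟨z, hzT, hwz⟩ := hz ⟨I, q, a⟩ ⟨hI0, hI1, hadm⟩ g (fun i => w i) (fun j => w j) hrel hind
      (fun i => hwP i) (fun j => hwP j)
    refine ⟨⟨⟨I, q, a⟩, z⟩, ?_, ?_⟩
    · funext j
      by_cases hj : j ∈ I
      · simp only [r, hj, dif_pos]
        exact (congrFun hwz ⟨j, hj⟩).symm
      · simp only [r, hj, dif_neg, not_false_eq_true]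
        funext l
        have hwz' : ∀ i : {i // i ∈ I}, ∑ k, B ⟨I, q, a⟩ i k • z k = w i :=
          fun i => (congrFun hwz i).symm
        simp only [hwz']
        rw [← hrel ⟨j, hj⟩]
        have hq : (q : ℤ) ≠ 0 := by
          have := hadm.1
          omega
        exact Int.mul_ediv_cancel_left _ hq
    · rw [Set.indicator_of_mem hzT]
      exact Set.indicator_le_self' (fun _ _ => zero_le) _
  refine (lintegral_mono hpt).trans ?_
  rw [lintegral_tsum fun b => (measurable_siegelSum (measurable_one.indicator
    ((hT b).inter measurableSet_linearIndependent))).aemeasurable]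
  have hintegral : ∀ b : β, ∫⁻ x, siegelSum ((T b ∩ {v | LinearIndependent ℝ v}).indicator 1) x ∂μ =
      volume (T b) := by
    intro b
    refine lintegral_siegelSum_linearIndependent μ hinv ?_ (hT b)
    rw [Fintype.card_coe]
    exact (Finset.card_le_univ _).trans_lt hcard
  simp only [hintegral]
  refine (ENNReal.tsum_le_tsum hvol).trans ?_
  rw [ENNReal.tsum_sigma', tsum_fintype]
  refine Finset.sum_le_sum fun I _ => ?_
  rw [ENNReal.tsum_sigma']
  refine ENNReal.tsum_le_tsum fun q => ?_
  split_ifs with hIq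
  · calc _ ≤ ∑' _ : {j // j ∉ I} → {i // i ∈ I} → Fin (2 * q + 1),
          denominatorFactor n q * volume P ^ I.card := by
          refine ENNReal.tsum_le_tsum fun a => ?_
          split_ifs
          · exact le_rfl
          · exact zero_le
      _ = _ := by
          rw [tsum_fintype, Finset.sum_const, nsmul_eq_mul, Finset.card_univ]
          simp only [Fintype.card_fun, Fintype.card_fin, Fintype.card_coe, Fintype.card_subtype_compl]
          rw [← pow_mul]
          push_cast
          rfl
  · refine (ENNReal.tsum_eq_zero.2 fun a => if_neg ?_).le
    rintro ⟨h1, h2, h3⟩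
    exact hIq ⟨h1, h2, h3.1⟩

theorem three_pow_mul_le {n e : ℕ} (he : 8 * e ≤ n) :
    (3 : ℝ) ^ e * (Real.sqrt 3 / 2) ^ n ≤ 0.999 ^ n := by
  rw [← pow_le_pow_iff_left₀ (by positivity) (by positivity) (n := 8) (by norm_num)]
  have h8 : (Real.sqrt 3 / 2) ^ 8 = 81 / 256 := by
    rw [div_pow, show (8 : ℕ) = 2 * 4 from rfl, pow_mul, Real.sq_sqrt (by norm_num)]
    norm_num
  calc ((3 : ℝ) ^ e * (Real.sqrt 3 / 2) ^ n) ^ 8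
      = 3 ^ (8 * e) * ((Real.sqrt 3 / 2) ^ 8) ^ n := by
        rw [mul_pow, pow_right_comm _ n 8, mul_comm 8 e, pow_mul]
    _ ≤ 3 ^ n * (81 / 256) ^ n := by
        rw [h8]
        gcongr
        norm_num
    _ = (243 / 256) ^ n := by
        rw [← mul_pow]
        norm_num
    _ ≤ ((0.999 : ℝ) ^ 8) ^ n := by
        gcongr
        norm_num
    _ = _ := pow_right_comm _ _ _

theorem odd_pow_mul_sq_le {n e q : ℕ} (hq : 2 ≤ q) (he1 : 1 ≤ e) (he : 8 * e ≤ n) :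
    (2 * q + 1 : ℝ) ^ e * q ^ 2 ≤ 2 * 0.999 ^ n * q ^ n := by
  obtain ⟨m, rfl⟩ : ∃ m, n = 3 * e + 2 + m := ⟨n - (3 * e + 2), by omega⟩
  have hq' : (2 : ℝ) ≤ q := by exact_mod_cast hq
  have h1 : (2 * q + 1 : ℝ) ≤ q ^ 3 := by nlinarith [mul_nonneg (sub_nonneg.2 hq') (sub_nonneg.2 hq')]
  have h2 : (1 : ℝ) ≤ 2 ^ (m + 1) * 0.999 ^ (3 * e + 2 + m) := by
    rw [← one_le_sq_iff₀ (by positivity)]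
    calc (1 : ℝ) ≤ (2 * 0.999 ^ 2) ^ (3 * e + 2 + m) := one_le_pow₀ (by norm_num)
      _ = 2 ^ (3 * e + 2 + m) * (0.999 ^ (3 * e + 2 + m)) ^ 2 := by rw [mul_pow, pow_right_comm]
      _ ≤ 2 ^ (2 * (m + 1)) * (0.999 ^ (3 * e + 2 + m)) ^ 2 := by
          gcongr
          · norm_num
          · omega
      _ = _ := by ring
  calc (2 * q + 1 : ℝ) ^ e * (q : ℝ) ^ 2 ≤ ((q : ℝ) ^ 3) ^ e * (q : ℝ) ^ 2 * 1 := by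
        rw [mul_one]
        gcongr
    _ ≤ ((q : ℝ) ^ 3) ^ e * (q : ℝ) ^ 2 * (2 ^ (m + 1) * 0.999 ^ (3 * e + 2 + m)) := by gcongr
    _ = ((q : ℝ) ^ 3) ^ e * (q : ℝ) ^ 2 * (2 * 2 ^ m * 0.999 ^ (3 * e + 2 + m)) := by ring
    _ ≤ ((q : ℝ) ^ 3) ^ e * (q : ℝ) ^ 2 * (2 * (q : ℝ) ^ m * 0.999 ^ (3 * e + 2 + m)) := by gcongr
    _ = _ := by ring

theorem pow_mul_denominatorFactor_le {n e q : ℕ} (hq : 0 < q) (he1 : 1 ≤ e) (he : 8 * e ≤ n) :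
    (2 * q + 1 : ENNReal) ^ e * denominatorFactor n q ≤
      ENNReal.ofReal (0.999 ^ n * 2 * (1 / (q : ℝ) ^ 2)) := by
  have hcast : (2 * q + 1 : ENNReal) = ENNReal.ofReal (2 * q + 1) := by
    rw [ENNReal.ofReal_add (by positivity) (by positivity), ENNReal.ofReal_mul (by norm_num)]
    simp
  rw [hcast, ← ENNReal.ofReal_pow (by positivity), denominatorFactor]
  split_ifs with h1
  · subst h1
    rw [← ENNReal.ofReal_pow (by positivity), ← ENNReal.ofReal_mul (by positivity)]
    refine ENNReal.ofReal_le_ofReal ?_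
    have h := three_pow_mul_le he
    calc _ ≤ (0.999 : ℝ) ^ n := by
          refine le_trans (le_of_eq ?_) h
          norm_num
      _ ≤ _ := by
          norm_num
  · rw [← ENNReal.ofReal_pow (by positivity), ← ENNReal.ofReal_mul (by positivity)]
    refine ENNReal.ofReal_le_ofReal ?_
    have hq' : (0 : ℝ) < q := Nat.cast_pos.2 hq
    rw [inv_pow, ← div_eq_mul_inv, mul_one_div, div_le_div_iff₀ (by positivity) (by positivity)]
    have := odd_pow_mul_sq_le (q := q) (by omega) he1 he
    linarith

theorem eight_mul_card_mul_card_compl_le {n h c : ℕ} (hc : c ≤ h) (hn : 2 * h ^ 2 ≤ n) :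
    8 * (c * (h - c)) ≤ n := by
  obtain ⟨d, rfl⟩ := Nat.exists_eq_add_of_le hc
  rw [Nat.add_sub_cancel_left]
  zify at *
  nlinarith [sq_nonneg ((c : ℤ) - d)]

theorem lintegral_siegelSum_dependent_le_geometric {n : ℕ} {ι : Type} [Fintype ι]
    (μ : Measure (LatSpace n)) [IsProbabilityMeasure μ]
    (hinv : ∀ a : SLR n, μ.map (rTranslate n a) = μ)
    (hcard : Fintype.card ι < n) (hcard' : 2 * Fintype.card ι ^ 2 ≤ n)
    {P : Set (Fin n → ℝ)} (hP : MeasurableSet P)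
    (hP0 : (0 : Fin n → ℝ) ∉ P) (hPneg : ∀ x ∈ P, -x ∉ P) :
    ∫⁻ x, siegelSum (Set.indicator {v : ι → Fin n → ℝ | Function.Injective v ∧ (∀ i, v i ∈ P) ∧
        ¬ LinearIndependent ℝ v} 1) x ∂μ ≤
      ENNReal.ofReal (4 * 0.999 ^ n) * (volume P + 1) ^ Fintype.card ι := by
  refine (lintegral_siegelSum_dependent_le μ hinv hcard hP hP0 hPneg).trans ?_
  have hzeta := (hasSum_zeta_two).mul_left ((0.999 : ℝ) ^ n * 2)
  have hsum : ∑' q : ℕ, ENNReal.ofReal (0.999 ^ n * 2 * (1 / (q : ℝ) ^ 2)) ≤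
      ENNReal.ofReal (4 * 0.999 ^ n) := by
    rw [← ENNReal.ofReal_tsum_of_nonneg (fun q => by positivity) hzeta.summable, hzeta.tsum_eq]
    refine ENNReal.ofReal_le_ofReal ?_
    have h1 : Real.pi ^ 2 ≤ 12 := by nlinarith [Real.pi_lt_d2, Real.pi_pos]
    have h2 : (0 : ℝ) < 0.999 ^ n := by positivity
    nlinarith
  have hbinom : ∑ I : Finset ι, volume P ^ I.card = (volume P + 1) ^ Fintype.card ι := by
    rw [← Fintype.sum_pow_mul_eq_add_pow]
    simp
  rw [← hbinom, Finset.mul_sum]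
  refine Finset.sum_le_sum fun I _ => ?_
  refine le_trans ?_ (mul_le_mul_left hsum _)
  rw [← ENNReal.tsum_mul_right]
  refine ENNReal.tsum_le_tsum fun q => ?_
  split_ifs with hI
  · rw [← mul_assoc]
    refine mul_le_mul_left (pow_mul_denominatorFactor_le hI.2.2 ?_ ?_) _
    · refine Nat.mul_pos (Finset.card_pos.2 (Finset.nonempty_iff_ne_empty.2 hI.1)) (Nat.sub_pos_of_lt ?_)
      exact Finset.card_lt_univ_of_notMem (x := (not_forall.1 (fun h => hI.2.1 (Finset.eq_univ_iff_forall.2 h))).choose)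
        (not_forall.1 (fun h => hI.2.1 (Finset.eq_univ_iff_forall.2 h))).choose_spec
    · exact eight_mul_card_mul_card_compl_le (Finset.card_le_univ _) hcard'
  · exact zero_le

theorem measurableSet_posHalf {n : ℕ} {S : Set (Fin n → ℝ)} (hS : MeasurableSet S) :
    MeasurableSet (posHalf n S) := by
  have h : posHalf n S = S ∩ ⋃ i : Fin n, {x : Fin n → ℝ | 0 < x i} ∩
      ⋂ j : Fin n, ⋂ _ : j < i, {x : Fin n → ℝ | x j = 0} := by
    ext x
    simp [posHalf]
  rw [h]
  refine hS.inter (MeasurableSet.iUnion fun i => MeasurableSet.inter ?_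
    (MeasurableSet.iInter fun j => MeasurableSet.iInter fun _ => ?_))
  · exact measurableSet_lt measurable_const (measurable_pi_apply i)
  · exact measurableSet_eq_fun (measurable_pi_apply j) measurable_const

theorem zero_notMem_posHalf {n : ℕ} (S : Set (Fin n → ℝ)) : (0 : Fin n → ℝ) ∉ posHalf n S := by
  rintro ⟨-, i, hi, -⟩
  exact lt_irrefl _ hi

theorem neg_notMem_posHalf {n : ℕ} {S : Set (Fin n → ℝ)} :
    ∀ x ∈ posHalf n S, -x ∉ posHalf n S := by
  rintro x ⟨-, i, hi, hi'⟩ ⟨-, j, hj, hj'⟩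
  simp only [Pi.neg_apply, neg_eq_zero] at hj hj'
  rcases lt_trichotomy i j with h | h | h
  · exact hi.ne' (hj' i h)
  · subst h
    linarith
  · have := hi' j h
    linarith

theorem posHalf_union_neg {n : ℕ} {S : Set (Fin n → ℝ)} (hS : ∀ x, x ∈ S ↔ -x ∈ S) :
    posHalf n S ∪ Neg.neg ⁻¹' posHalf n S = S \ {0} := by
  ext x
  constructor
  · rintro (hx | hx)
    · refine ⟨hx.1, ?_⟩
      rintro rfl
      exact zero_notMem_posHalf S hx
    · refine ⟨(hS x).2 hx.1, ?_⟩
      rintro rfl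
      refine zero_notMem_posHalf S ?_
      simpa using hx
  · rintro ⟨hxS, hx0⟩
    obtain ⟨i₀, hi₀⟩ := Function.ne_iff.1 hx0
    obtain ⟨i, hi, hmin⟩ := wellFounded_lt.has_min {i : Fin n | x i ≠ 0} ⟨i₀, hi₀⟩
    have hmin' : ∀ j < i, x j = 0 := fun j hj => by
      by_contra h
      exact hmin j h hj
    rcases lt_or_gt_of_ne (show x i ≠ 0 from hi) with h | h
    · exact Or.inr ⟨(hS x).1 hxS, i, by simpa using h, fun j hj => by simp [hmin' j hj]⟩
    · exact Or.inl ⟨hxS, i, h, hmin'⟩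

theorem volume_posHalf {n : ℕ} (hn : 2 ≤ n) {S : Set (Fin n → ℝ)} (hSm : MeasurableSet S)
    (hS : ∀ x, x ∈ S ↔ -x ∈ S) {V : ℝ} (hvol : volume S = ENNReal.ofReal V) :
    volume (posHalf n S) = ENNReal.ofReal (V / 2) := by
  have : Nonempty (Fin n) := ⟨⟨0, by omega⟩⟩
  have h1 : volume (S \ {0}) = volume S := measure_sdiff_null (measure_singleton _)
  rw [← posHalf_union_neg hS, measure_union ?_ (measurable_neg (measurableSet_posHalf hSm)),
    (Measure.measurePreserving_neg volume).measure_preimage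
      (measurableSet_posHalf hSm).nullMeasurableSet, hvol, ← two_mul] at h1
  · rw [ENNReal.ofReal_div_of_pos (by norm_num), ← h1, ENNReal.ofReal_ofNat,
      mul_comm, ENNReal.mul_div_cancel_right (by norm_num) (by norm_num)]
  · rw [Set.disjoint_left]
    exact neg_notMem_posHalf

/-- The tuples of distinct elements of `P`. -/
def distinctTuples (ι : Type) {n : ℕ} (P : Set (Fin n → ℝ)) : Set (ι → Fin n → ℝ) :=
  {v | Function.Injective v ∧ ∀ i, v i ∈ P}

theorem measurableSet_distinctTuples {ι : Type} [Fintype ι] {n : ℕ} {P : Set (Fin n → ℝ)}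
    (hP : MeasurableSet P) : MeasurableSet (distinctTuples ι P) := by
  have h : distinctTuples ι P = (⋂ i : ι, ⋂ j : ι, ⋂ _ : i ≠ j, {v : ι → Fin n → ℝ | v i = v j}ᶜ) ∩
      ⋂ i : ι, (fun v : ι → Fin n → ℝ => v i) ⁻¹' P := by
    ext v
    simp only [distinctTuples, Function.Injective, Set.mem_inter_iff, Set.mem_iInter,
      Set.mem_compl_iff, Set.mem_preimage, Set.mem_ofPred_eq]
    refine and_congr ⟨fun h i j hij hv => hij (h hv), fun h i j hv => ?_⟩ Iff.rfl
    by_contra hij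
    exact h i j hij hv
  rw [h]
  refine MeasurableSet.inter (MeasurableSet.iInter fun i => MeasurableSet.iInter fun j =>
    MeasurableSet.iInter fun _ => ?_) (MeasurableSet.iInter fun i => measurable_pi_apply i hP)
  exact (measurableSet_eq_fun (measurable_pi_apply i) (measurable_pi_apply j)).compl

theorem lintegral_siegelSum_distinctTuples {n : ℕ} {ι : Type} [Fintype ι]
    (μ : Measure (LatSpace n)) [IsProbabilityMeasure μ]
    (hinv : ∀ a : SLR n, μ.map (rTranslate n a) = μ)
    (hcard : Fintype.card ι < n) (hcard' : 2 * Fintype.card ι ^ 2 ≤ n)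
    {P : Set (Fin n → ℝ)} (hP : MeasurableSet P)
    (hP0 : (0 : Fin n → ℝ) ∉ P) (hPneg : ∀ x ∈ P, -x ∉ P) :
    ∃ E ≤ ENNReal.ofReal (4 * 0.999 ^ n) * (volume P + 1) ^ Fintype.card ι,
      ∫⁻ x, siegelSum ((distinctTuples ι P).indicator 1) x ∂μ =
        volume P ^ Fintype.card ι + E := by
  refine ⟨_, lintegral_siegelSum_dependent_le_geometric μ hinv hcard hcard' hP hP0 hPneg, ?_⟩
  have hA : MeasurableSet {v : ι → Fin n → ℝ | ∀ i, v i ∈ P} := by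
    have h : {v : ι → Fin n → ℝ | ∀ i, v i ∈ P} = ⋂ i : ι, (fun v : ι → Fin n → ℝ => v i) ⁻¹' P := by
      ext v
      simp
    rw [h]
    exact MeasurableSet.iInter fun i => measurable_pi_apply i hP
  have hvol : volume {v : ι → Fin n → ℝ | ∀ i, v i ∈ P} = volume P ^ Fintype.card ι := by
    have h : {v : ι → Fin n → ℝ | ∀ i, v i ∈ P} = Set.univ.pi fun _ => P := by
      ext v
      simp
    rw [h, volume_pi_pi]
    simp
  rw [← hvol, ← lintegral_siegelSum_linearIndependent μ hinv hcard hA,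
    ← lintegral_add_left (measurable_siegelSum (measurable_one.indicator
      (hA.inter measurableSet_linearIndependent)))]
  refine lintegral_congr fun x => ?_
  obtain ⟨g, rfl⟩ := exists_latMk_eq x
  simp only [siegelSum_mk]
  rw [← ENNReal.tsum_add]
  refine tsum_congr fun w => ?_
  generalize rowMul (realTuple w) g = v
  by_cases hv : LinearIndependent ℝ v
  · by_cases hvP : ∀ i, v i ∈ P
    · have h1 : v ∈ distinctTuples ι P := ⟨hv.injective, hvP⟩
      have h2 : v ∈ {v : ι → Fin n → ℝ | ∀ i, v i ∈ P} ∩ {v | LinearIndependent ℝ v} := ⟨hvP, hv⟩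
      have h3 : v ∉ {v : ι → Fin n → ℝ | Function.Injective v ∧ (∀ i, v i ∈ P) ∧
        ¬ LinearIndependent ℝ v} := fun h => h.2.2 hv
      rw [Set.indicator_of_mem h1, Set.indicator_of_mem h2, Set.indicator_of_notMem h3, add_zero]
    · have h1 : v ∉ distinctTuples ι P := fun h => hvP h.2
      have h2 : v ∉ {v : ι → Fin n → ℝ | ∀ i, v i ∈ P} ∩ {v | LinearIndependent ℝ v} := fun h => hvP h.1
      have h3 : v ∉ {v : ι → Fin n → ℝ | Function.Injective v ∧ (∀ i, v i ∈ P) ∧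
        ¬ LinearIndependent ℝ v} := fun h => h.2.2 hv
      rw [Set.indicator_of_notMem h1, Set.indicator_of_notMem h2, Set.indicator_of_notMem h3, add_zero]
  · have h2 : v ∉ {v : ι → Fin n → ℝ | ∀ i, v i ∈ P} ∩ {v | LinearIndependent ℝ v} := fun h => hv h.2
    rw [Set.indicator_of_notMem h2, zero_add]
    have h4 : v ∈ distinctTuples ι P ↔ v ∈ {v : ι → Fin n → ℝ | Function.Injective v ∧
        (∀ i, v i ∈ P) ∧ ¬ LinearIndependent ℝ v} :=
      ⟨fun h => ⟨h.1, h.2, hv⟩, fun h => ⟨h.1, h.2.1⟩⟩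
    simp only [Set.indicator_apply, h4]

theorem finite_injective_tuples {α : Type} {W : Set α} (hW : W.Finite) (h : ℕ) :
    {w : Fin h → α | Function.Injective w ∧ ∀ i, w i ∈ W}.Finite :=
  (Set.Finite.pi' fun _ => hW).subset fun _ hw => hw.2

theorem natCard_injective_tuples {α : Type} {W : Set α} (hW : W.Finite) (h : ℕ) :
    Nat.card {w : Fin h → α | Function.Injective w ∧ ∀ i, w i ∈ W} = W.ncard.descFactorial h := by
  have := hW.fintype
  let e : {w : Fin h → α | Function.Injective w ∧ ∀ i, w i ∈ W} ≃ (Fin h ↪ W) :=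
    { toFun := fun w => ⟨fun i => ⟨w.1 i, w.2.2 i⟩, fun i j hij => w.2.1 (congrArg Subtype.val hij)⟩
      invFun := fun f => ⟨fun i => f i, fun i j hij => f.injective (Subtype.ext hij), fun i => (f i).2⟩
      left_inv := fun _ => rfl
      right_inv := fun _ => rfl }
  rw [Nat.card_congr e, Nat.card_eq_fintype_card, Fintype.card_embedding_eq, Fintype.card_fin,
    ← Nat.card_eq_fintype_card, Nat.card_coe_set_eq]

theorem natCard_finset_subset {α : Type} {W : Set α} (hW : W.Finite) (h : ℕ) :
    Nat.card {t : Finset α // ↑t ⊆ W ∧ t.card = h} = W.ncard.choose h := by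
  rw [Set.ncard_eq_toFinset_card W hW, ← Finset.card_powersetCard, Nat.subtype_card]
  intro t
  rw [Finset.mem_powersetCard, ← Finset.coe_subset, hW.coe_toFinset]

theorem vecMul_intCast_injective {n : ℕ} (g : SLR n) : Function.Injective fun m : Fin n → ℤ =>
    Matrix.vecMul (fun i => (m i : ℝ)) (g : Matrix (Fin n) (Fin n) ℝ) := by
  have hg : IsUnit (g : Matrix (Fin n) (Fin n) ℝ) := by
    rw [Matrix.isUnit_iff_isUnit_det, g.det_coe]
    exact isUnit_one
  intro m m' hm
  have := Matrix.vecMul_injective_iff_isUnit.2 hg hm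
  funext i
  exact_mod_cast congrFun this i

theorem siegelSum_distinctTuples_mk {n : ℕ} {ι : Type} (P : Set (Fin n → ℝ)) (g : SLR n) :
    siegelSum ((distinctTuples ι P).indicator 1) (latMk n g) =
      ∑' w : ι → Fin n → ℤ, {w : ι → Fin n → ℤ | Function.Injective w ∧
        ∀ i, w i ∈ {m | Matrix.vecMul (fun i => (m i : ℝ)) (g : Matrix (Fin n) (Fin n) ℝ) ∈ P}}.indicator
          (1 : (ι → Fin n → ℤ) → ENNReal) w := by
  rw [siegelSum_mk]
  refine tsum_congr fun w => ?_
  have h : rowMul (realTuple w) g ∈ distinctTuples ι P ↔ w ∈ {w : ι → Fin n → ℤ |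
      Function.Injective w ∧
        ∀ i, w i ∈ {m | Matrix.vecMul (fun i => (m i : ℝ)) (g : Matrix (Fin n) (Fin n) ℝ) ∈ P}} :=
    and_congr ((vecMul_intCast_injective g).of_comp_iff w) Iff.rfl
  simp only [Set.indicator_apply, h, Pi.one_apply]

theorem finite_of_siegelSum_ne_top {n : ℕ} {P : Set (Fin n → ℝ)} {g : SLR n}
    (h : siegelSum ((distinctTuples (Fin 1) P).indicator 1) (latMk n g) ≠ ⊤) :
    {m : Fin n → ℤ | Matrix.vecMul (fun i => (m i : ℝ)) (g : Matrix (Fin n) (Fin n) ℝ) ∈ P}.Finite := by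
  rw [siegelSum_distinctTuples_mk] at h
  have hfin := ENNReal.finite_const_le_of_tsum_ne_top h one_ne_zero
  refine (hfin.preimage (f := fun m (_ : Fin 1) => m) fun a _ b _ hab => congrFun hab 0).subset ?_
  intro m hm
  have hm' : (fun _ : Fin 1 => m) ∈ {w : Fin 1 → Fin n → ℤ | Function.Injective w ∧
      ∀ i, w i ∈ {m | Matrix.vecMul (fun i => (m i : ℝ)) (g : Matrix (Fin n) (Fin n) ℝ) ∈ P}} :=
    ⟨Function.injective_of_subsingleton _, fun _ => hm⟩
  rw [Set.mem_preimage, Set.mem_ofPred_eq, Set.indicator_of_mem hm', Pi.one_apply]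

/-- The number of `h`-element subsets of the lattice in `posHalf n S` counts ordered tuples of
distinct vectors up to `h !`, provided the lattice meets `posHalf n S` in a finite set. -/
theorem siegelSum_distinctTuples_eq_factorial_mul_rhoSub {n : ℕ} {S : Set (Fin n → ℝ)} {g : SLR n}
    (hfin : siegelSum ((distinctTuples (Fin 1) (posHalf n S)).indicator 1) (latMk n g) ≠ ⊤) (h : ℕ) :
    siegelSum ((distinctTuples (Fin h) (posHalf n S)).indicator 1) (latMk n g) =
      ((h ! * rhoSub n S h g : ℕ) : ENNReal) := by
  have hW := finite_of_siegelSum_ne_top hfin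
  rw [siegelSum_distinctTuples_mk, tsum_indicator_eq_natCard _ (finite_injective_tuples hW h),
    natCard_injective_tuples hW, Nat.descFactorial_eq_factorial_mul_choose]
  have himage : latticeOf n g ∩ posHalf n S = (fun m : Fin n → ℤ =>
      Matrix.vecMul (fun i => (m i : ℝ)) (g : Matrix (Fin n) (Fin n) ℝ)) ''
      {m : Fin n → ℤ | Matrix.vecMul (fun i => (m i : ℝ)) (g : Matrix (Fin n) (Fin n) ℝ) ∈ posHalf n S} := by
    ext v
    constructor
    · rintro ⟨⟨m, rfl⟩, hm⟩
      exact ⟨m, hm, rfl⟩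
    · rintro ⟨m, hm, rfl⟩
      exact ⟨⟨m, rfl⟩, hm⟩
  rw [rhoSub, himage, natCard_finset_subset (hW.image _),
    Set.ncard_image_of_injective _ (vecMul_intCast_injective g)]

theorem choose_div_factorial_eq {h k : ℕ} (hk : 1 ≤ k) (hkh : k ≤ h) :
    ((h - 1).choose (k - 1) : ℝ) / (h)! = 1 / (h * (h - k)! * (k - 1)!) := by
  have h1 := Nat.choose_mul_factorial_mul_factorial (show k - 1 ≤ h - 1 by omega)
  rw [show h - 1 - (k - 1) = h - k by omega] at h1
  have h2 : h * (h - 1)! = (h)! := Nat.mul_factorial_pred (by omega)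
  have h0 : (h : ℝ) ≠ 0 := Nat.cast_ne_zero.2 (by omega)
  rw [div_eq_div_iff (by positivity) (by positivity), ← h2, ← h1]
  push_cast
  ring

theorem choose_div_factorial_le {h k : ℕ} (hk : 1 ≤ k) (hkh : k ≤ h) :
    ((h - 1).choose (k - 1) : ℝ) / (h)! ≤ 1 / (k)! := by
  rw [choose_div_factorial_eq hk hkh]
  have h2 : k * (k - 1)! = (k)! := Nat.mul_factorial_pred (by omega)
  have h3 : k * (k - 1)! ≤ h * (h - k)! * (k - 1)! := by
    gcongr
    exact hkh.trans (Nat.le_mul_of_pos_right _ (Nat.factorial_pos _))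
  rw [h2] at h3
  refine one_div_le_one_div_of_le (by positivity) ?_
  exact_mod_cast h3

/-- Moments of the counting functions of tuples of distinct lattice vectors. -/
theorem abs_integral_siegelSum_distinctTuples_sub_le {n h : ℕ} (μ : Measure (LatSpace n))
    [IsProbabilityMeasure μ] (hinv : ∀ a : SLR n, μ.map (rTranslate n a) = μ)
    (hcard : h < n) (hcard' : 2 * h ^ 2 ≤ n)
    {P : Set (Fin n → ℝ)} (hP : MeasurableSet P)
    (hP0 : (0 : Fin n → ℝ) ∉ P) (hPneg : ∀ x ∈ P, -x ∉ P) {V : ℝ} (hV : 0 ≤ V)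
    (hvol : volume P = ENNReal.ofReal V) :
    ∫⁻ x, siegelSum ((distinctTuples (Fin h) P).indicator 1) x ∂μ ≠ ⊤ ∧
    |(∫ x, (siegelSum ((distinctTuples (Fin h) P).indicator 1) x).toReal ∂μ) - V ^ h| ≤
      4 * 0.999 ^ n * (V + 1) ^ h := by
  obtain ⟨E, hE, heq⟩ := lintegral_siegelSum_distinctTuples (ι := Fin h) μ hinv (by simpa) (by simpa)
    hP hP0 hPneg
  have hvol1 : volume P + 1 = ENNReal.ofReal (V + 1) := by
    rw [ENNReal.ofReal_add hV zero_le_one, hvol, ENNReal.ofReal_one]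
  rw [Fintype.card_fin, hvol1, ← ENNReal.ofReal_pow (by positivity),
    ← ENNReal.ofReal_mul (by positivity)] at hE
  rw [Fintype.card_fin, hvol, ← ENNReal.ofReal_pow hV] at heq
  have hEtop : E ≠ ⊤ := ne_top_of_le_ne_top ENNReal.ofReal_ne_top hE
  have htop : ∫⁻ x, siegelSum ((distinctTuples (Fin h) P).indicator 1) x ∂μ ≠ ⊤ := by
    rw [heq]
    exact ENNReal.add_ne_top.2 ⟨ENNReal.ofReal_ne_top, hEtop⟩
  have hmeas := measurable_siegelSum (n := n) (measurable_one.indicator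
    (measurableSet_distinctTuples (ι := Fin h) hP) : Measurable ((distinctTuples (Fin h) P).indicator
      (1 : (Fin h → Fin n → ℝ) → ENNReal)))
  refine ⟨htop, ?_⟩
  rw [integral_toReal hmeas.aemeasurable (ae_lt_top hmeas htop), heq,
    ENNReal.toReal_add ENNReal.ofReal_ne_top hEtop, ENNReal.toReal_ofReal (by positivity),
    add_sub_cancel_left, abs_of_nonneg ENNReal.toReal_nonneg]
  exact ENNReal.toReal_le_of_le_ofReal (by positivity) hE

/-- **Proposition (head estimate).** Let `n ≥ 2`, `S ⊆ ℝ^n` a Borel measurable set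
symmetric about the origin with Lebesgue measure `V`, and `k, α` integers with
`1 ≤ k ≤ α ≤ √(n/2)`. Then
`|∫_{X_n} Σ_{h=k}^{α} (−1)^{h−k} C(h−1,k−1) ρ_{S',h}(L) dμ_n(L)
  − Σ_{h=k}^{α} (−1)^{h−k} (V/2)^h / (h·(h−k)!·(k−1)!)|
  ≤ (12/k!)·√(n/2)·(0.999)^n·(V/2+1)^{√(n/2)}`. -/
theorem stmt7 (n k α : ℕ) (hn : 2 ≤ n) (hk : 1 ≤ k) (hkα : k ≤ α)
    (hα : (α : ℝ) ≤ Real.sqrt ((n : ℝ) / 2))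
    (S : Set (Fin n → ℝ)) (hSmeas : MeasurableSet S)
    (hSsymm : ∀ x, x ∈ S ↔ -x ∈ S)
    (V : ℝ) (hV0 : 0 ≤ V) (hvol : MeasureTheory.volume S = ENNReal.ofReal V)
    (μ : MeasureTheory.Measure (LatSpace n)) [MeasureTheory.IsProbabilityMeasure μ]
    (hinv : ∀ a : SLR n, μ.map (rTranslate n a) = μ)
    (f : LatSpace n → ℝ)
    (hf : ∀ g : SLR n, f (latMk n g) =
      ∑ h ∈ Finset.Icc k α,
        ((-1 : ℝ)) ^ (h - k) * ((h - 1).choose (k - 1)) * (rhoSub n S h g : ℝ)) :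
    |(∫ x, f x ∂μ) - ∑ h ∈ Finset.Icc k α,
        ((-1 : ℝ)) ^ (h - k) * (V / 2) ^ h / (h * (h - k)! * (k - 1)!)|
      ≤ (12 / (k)!) * Real.sqrt ((n : ℝ) / 2) * (0.999 : ℝ) ^ n *
          (V / 2 + 1) ^ (Real.sqrt ((n : ℝ) / 2)) := by
  have hP := measurableSet_posHalf hSmeas
  have hPvol := volume_posHalf hn hSmeas hSsymm hvol
  have hV2 : 0 ≤ V / 2 := by positivity
  have hα2 : 2 * α ^ 2 ≤ n := by
    have h1 := (Real.le_sqrt' (by exact_mod_cast hk.trans hkα)).1 hα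
    have h2 : (2 * α ^ 2 : ℝ) ≤ n := by linarith
    exact_mod_cast h2
  have hsmall : ∀ h, 1 ≤ h → h ≤ α → h < n ∧ 2 * h ^ 2 ≤ n := by
    intro h h1 h2
    have h3 : 2 * h ^ 2 ≤ n := le_trans (by gcongr) hα2
    exact ⟨by nlinarith, h3⟩
  let F : ℕ → LatSpace n → ENNReal := fun h =>
    siegelSum ((distinctTuples (Fin h) (posHalf n S)).indicator 1)
  have hmoment : ∀ h, 1 ≤ h → h ≤ α → ∫⁻ x, F h x ∂μ ≠ ⊤ ∧
      |(∫ x, (F h x).toReal ∂μ) - (V / 2) ^ h| ≤ 4 * 0.999 ^ n * (V / 2 + 1) ^ h := fun h h1 h2 =>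
    abs_integral_siegelSum_distinctTuples_sub_le μ hinv (hsmall h h1 h2).1 (hsmall h h1 h2).2 hP
      (zero_notMem_posHalf S) neg_notMem_posHalf hV2 hPvol
  have hmeas : ∀ h, Measurable (F h) := fun h => measurable_siegelSum (measurable_one.indicator
    (measurableSet_distinctTuples hP))
  let c : ℕ → ℝ := fun h => (-1 : ℝ) ^ (h - k) * (((h - 1).choose (k - 1) : ℝ) / (h)!)
  have hfae : f =ᵐ[μ] fun x => ∑ h ∈ Finset.Icc k α, c h * (F h x).toReal := by
    filter_upwards [ae_lt_top (hmeas 1) (hmoment 1 le_rfl (hk.trans hkα)).1] with x hx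
    obtain ⟨g, rfl⟩ := exists_latMk_eq x
    rw [hf]
    refine Finset.sum_congr rfl fun h _ => ?_
    have h1 : F h (latMk n g) = _ :=
      siegelSum_distinctTuples_eq_factorial_mul_rhoSub (S := S) hx.ne h
    rw [h1, ENNReal.toReal_natCast, Nat.cast_mul]
    have h2 : ((h)! : ℝ) ≠ 0 := by positivity
    simp only [c]
    field_simp
  have hintegral : ∫ x, f x ∂μ = ∑ h ∈ Finset.Icc k α, c h * ∫ x, (F h x).toReal ∂μ := by
    rw [integral_congr_ae hfae, integral_finsetSum]
    · simp only [integral_const_mul]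
    · intro h hh
      rw [Finset.mem_Icc] at hh
      exact (integrable_toReal_of_lintegral_ne_top (hmeas h).aemeasurable
        (hmoment h (hk.trans hh.1) hh.2).1).const_mul _
  have hterm : ∀ h ∈ Finset.Icc k α, |c h * (∫ x, (F h x).toReal ∂μ) - (-1 : ℝ) ^ (h - k) *
      (V / 2) ^ h / ((h : ℝ) * ((h - k)! : ℝ) * ((k - 1)! : ℝ))| ≤
      1 / (k)! * (4 * 0.999 ^ n * (V / 2 + 1) ^ Real.sqrt ((n : ℝ) / 2)) := by
    intro h hh
    rw [Finset.mem_Icc] at hh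
    have h1 : (-1 : ℝ) ^ (h - k) * (V / 2) ^ h / ((h : ℝ) * ((h - k)! : ℝ) * ((k - 1)! : ℝ)) =
        c h * (V / 2) ^ h := by
      simp only [c]
      rw [choose_div_factorial_eq hk hh.1]
      ring
    rw [h1, ← mul_sub, abs_mul]
    have h2 : |c h| ≤ 1 / (k)! := by
      simp only [c]
      rw [abs_mul, abs_pow, abs_neg, abs_one, one_pow, one_mul, abs_of_nonneg (by positivity)]
      exact choose_div_factorial_le hk hh.1
    refine mul_le_mul h2 ((hmoment h (hk.trans hh.1) hh.2).2.trans ?_) (abs_nonneg _) (by positivity)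
    rw [← Real.rpow_natCast (V / 2 + 1) h]
    gcongr
    · linarith
    · exact le_trans (by exact_mod_cast hh.2) hα
  rw [hintegral, ← Finset.sum_sub_distrib]
  refine (Finset.abs_sum_le_sum_abs _ _).trans ((Finset.sum_le_sum hterm).trans ?_)
  rw [Finset.sum_const, nsmul_eq_mul, Nat.card_Icc]
  have hcount : ((α + 1 - k : ℕ) : ℝ) ≤ Real.sqrt ((n : ℝ) / 2) :=
    le_trans (by exact_mod_cast (by omega : α + 1 - k ≤ α)) hα
  set R := Real.sqrt ((n : ℝ) / 2)
  have hX : 0 ≤ 1 / ((k)! : ℝ) * (4 * 0.999 ^ n * (V / 2 + 1) ^ R) := by positivity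
  have hR : 0 ≤ R := Real.sqrt_nonneg _
  calc _ ≤ R * (1 / ((k)! : ℝ) * (4 * 0.999 ^ n * (V / 2 + 1) ^ R)) := by gcongr
    _ ≤ 3 * (R * (1 / ((k)! : ℝ) * (4 * 0.999 ^ n * (V / 2 + 1) ^ R))) := by
        linarith [mul_nonneg hR hX]
    _ = _ := by ring
end

section
/- Let n ≥ 2, let S ⊆ ℝ^n be a Borel measurable set symmetric about the origin, and let k, α be integers with 1 ≤ k ≤ α ≤ √(n/2) and α − k even. Then ∫_{X_n} Σ_{h=α+1}^{∞} (−1)^{h−k} C(h−1,k−1) ρ_{S',h}(L) dμ_n(L) ≤ 0 (the integrand being a finite sum for μ_n-almost every L). -/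
open MeasureTheory Matrix
open scoped Nat Classical

theorem sum_range_neg_one_pow_mul_choose_succ (N c M : ℕ) :
    ∑ i ∈ Finset.range M, (-1 : ℝ) ^ i * ((N + 1).choose (c + 1 + i) : ℝ) =
      (N.choose c : ℝ) - (-1) ^ M * (N.choose (c + M) : ℝ) := by
  induction M with
  | zero => simp
  | succ M ih =>
    rw [Finset.sum_range_succ, ih, show c + 1 + M = c + M + 1 by ring, Nat.choose_succ_succ,
      ← add_assoc c M 1]
    push_cast
    ring

theorem sum_range_neg_one_pow_mul_choose_nonneg {N M : ℕ} (c : ℕ) (hNM : N ≤ M) :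
    0 ≤ ∑ i ∈ Finset.range M, (-1 : ℝ) ^ i * (N.choose (c + 1 + i) : ℝ) := by
  cases N with
  | zero => simp [Nat.choose_eq_zero_of_lt, show ∀ i, 0 < c + 1 + i by omega]
  | succ N =>
    rw [sum_range_neg_one_pow_mul_choose_succ, Nat.choose_eq_zero_of_lt (by omega : N < c + M)]
    simp

/-- Jordan's form of the Bonferroni inequalities: the tail, starting at index `a + 1`, of the
inclusion-exclusion sum counting the event "at least `j + 1` elements" has the sign of its
first term. -/
theorem sum_range_neg_one_pow_mul_choose_mul_choose_nonneg {m M j a : ℕ} (hja : j < a)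
    (hmM : m ≤ M) :
    0 ≤ ∑ i ∈ Finset.range M,
      (-1 : ℝ) ^ i * ((a + i).choose j : ℝ) * (m.choose (a + 1 + i) : ℝ) := by
  induction m with
  | zero => simp [Nat.choose_eq_zero_of_lt, show ∀ i, 0 < a + 1 + i by omega]
  | succ m ih =>
    obtain ⟨c, rfl⟩ : ∃ c, a = j + (c + 1) := ⟨a - j - 1, by omega⟩
    have key : ∑ i ∈ Finset.range M, (-1 : ℝ) ^ i * ((j + (c + 1) + i).choose j : ℝ) *
          ((m + 1).choose (j + (c + 1) + 1 + i) : ℝ) =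
        (m.choose j : ℝ) *
            ∑ i ∈ Finset.range M, (-1 : ℝ) ^ i * ((m - j).choose (c + 1 + i) : ℝ) +
          ∑ i ∈ Finset.range M, (-1 : ℝ) ^ i * ((j + (c + 1) + i).choose j : ℝ) *
            (m.choose (j + (c + 1) + 1 + i) : ℝ) := by
      rw [Finset.mul_sum, ← Finset.sum_add_distrib]
      refine Finset.sum_congr rfl fun i _ => ?_
      have hmul : (m.choose (j + (c + 1) + i) : ℝ) * ((j + (c + 1) + i).choose j : ℝ) =
          (m.choose j : ℝ) * ((m - j).choose (c + 1 + i) : ℝ) := by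
        have h := Nat.choose_mul (n := m) (k := j + (c + 1) + i) (s := j) (by omega)
        rw [show j + (c + 1) + i - j = c + 1 + i by omega] at h
        exact_mod_cast h
      rw [show j + (c + 1) + 1 + i = j + (c + 1) + i + 1 by ring, Nat.choose_succ_succ]
      push_cast
      linear_combination (-1 : ℝ) ^ i * hmul
    rw [key]
    exact add_nonneg (mul_nonneg (Nat.cast_nonneg _)
      (sum_range_neg_one_pow_mul_choose_nonneg c (by omega))) (ih (by omega))

theorem natCard_finset_subset_card_eq {β : Type*} {A : Set β} (hA : A.Finite) (h : ℕ) :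
    Nat.card {t : Finset β // ↑t ⊆ A ∧ t.card = h} = A.ncard.choose h := by
  rw [Set.ncard_eq_toFinset_card A hA, ← Finset.card_powersetCard]
  refine Nat.subtype_card _ fun t => ?_
  rw [Finset.mem_powersetCard, ← Finset.coe_subset, hA.coe_toFinset]

theorem natCard_finset_subset_card_eq_zero {β : Type*} {A : Set β} (hA : A.Infinite) {h : ℕ}
    (hh : 0 < h) : Nat.card {t : Finset β // ↑t ⊆ A ∧ t.card = h} = 0 := by
  refine Nat.card_eq_zero.mpr (Or.inr (not_finite_iff_infinite.mp fun hfin => hA ?_))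
  refine (Set.finite_iUnion fun t : {t : Finset β // ↑t ⊆ A ∧ t.card = h} =>
    t.1.finite_toSet).subset fun a ha => ?_
  obtain ⟨t, htA, htc⟩ := (hA.sdiff (Set.finite_singleton a)).exists_subset_card_eq (h - 1)
  have hat : a ∉ t := fun hmem => (htA hmem).2 rfl
  refine Set.mem_iUnion.mpr ⟨⟨insert a t, ?_, ?_⟩, by simp⟩
  · rw [Finset.coe_insert]
    exact Set.insert_subset ha fun x hx => (htA hx).1
  · rw [Finset.card_insert_of_notMem hat]
    omega

theorem tsum_bonferroni_tail_nonpos {β : Type*} (A : Set β) {k α : ℕ} (hk : 1 ≤ k)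
    (hkα : k ≤ α) (heven : Even (α - k)) :
    ∑' h : ℕ, (if α + 1 ≤ h then ((-1 : ℝ)) ^ (h - k) * ((h - 1).choose (k - 1)) *
      (Nat.card {t : Finset β // ↑t ⊆ A ∧ t.card = h} : ℝ) else 0) ≤ 0 := by
  rcases A.finite_or_infinite with hA | hA
  · simp only [natCard_finset_subset_card_eq hA]
    rw [tsum_eq_sum (s := Finset.Ico (α + 1) (α + 1 + A.ncard)), Finset.sum_Ico_eq_sum_range,
      Nat.add_sub_cancel_left, ← neg_nonneg, ← Finset.sum_neg_distrib]
    · convert sum_range_neg_one_pow_mul_choose_mul_choose_nonneg (m := A.ncard) (j := k - 1)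
        (a := α) (by omega) le_rfl using 2 with i
      rw [if_pos (by omega), show α + 1 + i - k = (α - k) + 1 + i by omega,
        show α + 1 + i - 1 = α + i by omega, pow_add, pow_succ, heven.neg_one_pow]
      ring
    · intro h hh
      split_ifs with hα
      · rw [Finset.mem_Ico] at hh
        rw [Nat.choose_eq_zero_of_lt (by omega : A.ncard < h)]
        simp
      · rfl
  · refine (tsum_congr fun h => ?_).trans_le (tsum_zero (α := ℝ) (β := ℕ)).le
    split_ifs with hα
    · rw [natCard_finset_subset_card_eq_zero hA (by omega)]
      simp
    · rfl

/-- **Proposition (tail estimate, even case).** Let `n ≥ 2`, `S ⊆ ℝ^n` a Borel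
measurable set symmetric about the origin, and `k, α` integers with
`1 ≤ k ≤ α ≤ √(n/2)` and `α − k` even. Then
`∫_{X_n} Σ_{h=α+1}^{∞} (−1)^{h−k} C(h−1,k−1) ρ_{S',h}(L) dμ_n(L) ≤ 0`
(the integrand being a finite sum for `μ_n`-almost every `L`, since `ρ_{S',h}(L) = 0`
for `h > |L ∩ S'|` when `L ∩ S'` is finite). -/
theorem stmt8 (n k α : ℕ) (hn : 2 ≤ n) (hk : 1 ≤ k) (hkα : k ≤ α)
    (hα : (α : ℝ) ≤ Real.sqrt ((n : ℝ) / 2)) (heven : Even (α - k))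
    (S : Set (Fin n → ℝ)) (hSmeas : MeasurableSet S)
    (hSsymm : ∀ x, x ∈ S ↔ -x ∈ S)
    (μ : MeasureTheory.Measure (LatSpace n)) [MeasureTheory.IsProbabilityMeasure μ]
    (hinv : ∀ a : SLR n, μ.map (rTranslate n a) = μ)
    (f : LatSpace n → ℝ)
    (hf : ∀ g : SLR n, f (latMk n g) =
      ∑' h : ℕ, (if α + 1 ≤ h then
        ((-1 : ℝ)) ^ (h - k) * ((h - 1).choose (k - 1)) * (rhoSub n S h g : ℝ)
      else 0)) :
    (∫ x, f x ∂μ) ≤ 0 := by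
  refine integral_nonpos fun x => ?_
  induction x using Quotient.inductionOn with
  | h g => exact (hf g).trans_le (tsum_bonferroni_tail_nonpos _ hk hkα heven)
end

section
/- Let n ≥ 2, let S ⊆ ℝ^n be a Borel measurable set symmetric about the origin, and let k, β be integers with 1 ≤ k ≤ β ≤ √(n/2) and β − k odd. Then ∫_{X_n} Σ_{h=β+1}^{∞} (−1)^{h−k} C(h−1,k−1) ρ_{S',h}(L) dμ_n(L) ≥ 0 (the integrand being a finite sum for μ_n-almost every L). -/
open MeasureTheory Matrix
open scoped Nat Classical

theorem sum_range_neg_one_pow_mul_choose_add (n c M : ℕ) :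
    ∑ t ∈ Finset.range M, (-1 : ℝ) ^ t * ((n + 1).choose (c + 1 + t) : ℝ) =
      (n.choose c : ℝ) - (-1) ^ M * (n.choose (c + M) : ℝ) := by
  induction M with
  | zero => simp
  | succ M ih =>
    rw [Finset.sum_range_succ, ih, show c + 1 + M = (c + M) + 1 by ring,
      Nat.choose_succ_succ, show c + (M + 1) = c + M + 1 by ring]
    push_cast
    ring

theorem sum_range_neg_one_pow_mul_choose_add_nonneg {n c M : ℕ} (hc : 1 ≤ c) (hM : n ≤ M) :
    0 ≤ ∑ t ∈ Finset.range M, (-1 : ℝ) ^ t * (n.choose (c + t) : ℝ) := by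
  obtain ⟨c, rfl⟩ : ∃ c', c = c' + 1 := ⟨c - 1, by omega⟩
  cases n with
  | zero => simp [Nat.choose_eq_zero_of_lt (show 0 < c + 1 + _ by omega)]
  | succ n =>
    rw [sum_range_neg_one_pow_mul_choose_add,
      Nat.choose_eq_zero_of_lt (show n < c + M by omega)]
    simp

/-- A generalized Bonferroni inequality for the tail of the inclusion-exclusion sum. -/
theorem bonferroni_tail_nonneg {d b : ℕ} (hdb : d < b) (N M : ℕ) (hM : N ≤ M) :
    0 ≤ ∑ t ∈ Finset.range M,
      (-1 : ℝ) ^ t * ((b + t).choose d : ℝ) * (N.choose (b + t + 1) : ℝ) := by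
  induction N with
  | zero => simp
  | succ N ih =>
    have hsplit : ∑ t ∈ Finset.range M,
        (-1 : ℝ) ^ t * ((b + t).choose d : ℝ) * ((N + 1).choose (b + t + 1) : ℝ) =
        (N.choose d : ℝ) *
          ∑ t ∈ Finset.range M, (-1 : ℝ) ^ t * ((N - d).choose (b - d + t) : ℝ) +
        ∑ t ∈ Finset.range M,
          (-1 : ℝ) ^ t * ((b + t).choose d : ℝ) * (N.choose (b + t + 1) : ℝ) := by
      rw [Finset.mul_sum, ← Finset.sum_add_distrib]
      refine Finset.sum_congr rfl fun t _ => ?_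
      have hmul : (N.choose (b + t) : ℝ) * ((b + t).choose d : ℝ) =
          (N.choose d : ℝ) * ((N - d).choose (b - d + t) : ℝ) := by
        have h := Nat.choose_mul (n := N) (k := b + t) (s := d) (by omega)
        rw [show b + t - d = b - d + t by omega] at h
        exact_mod_cast h
      rw [Nat.choose_succ_succ]
      push_cast
      linear_combination (-1 : ℝ) ^ t * hmul
    rw [hsplit]
    exact add_nonneg (mul_nonneg (Nat.cast_nonneg _)
      (sum_range_neg_one_pow_mul_choose_add_nonneg (by omega) (by omega))) (ih (by omega))

theorem Set.Finite.card_finset_subsets {α : Type*} {A : Set α} (hA : A.Finite) (h : ℕ) :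
    Nat.card {t : Finset α // ↑t ⊆ A ∧ t.card = h} = A.ncard.choose h := by
  rw [Set.ncard_eq_toFinset_card A hA, ← Finset.card_powersetCard]
  refine Nat.subtype_card _ fun t => ?_
  rw [Finset.mem_powersetCard, ← Finset.coe_subset, hA.coe_toFinset]

theorem Set.Infinite.card_finset_subsets {α : Type*} {A : Set α} (hA : A.Infinite) {h : ℕ}
    (hh : h ≠ 0) : Nat.card {t : Finset α // ↑t ⊆ A ∧ t.card = h} = 0 := by
  have := hA.to_subtype
  have : NeZero h := ⟨hh⟩
  let emb (t : Set.powersetCard A h) : {t : Finset α // ↑t ⊆ A ∧ t.card = h} :=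
    ⟨t.1.map (Function.Embedding.subtype _), by simp, (Finset.card_map _).trans t.2⟩
  have hemb : Function.Injective emb := fun s t hst =>
    Subtype.ext (Finset.map_injective _ (congrArg Subtype.val hst))
  have := Infinite.of_injective emb hemb
  exact Nat.card_eq_zero_of_infinite

/-- **Proposition (tail estimate, odd case).** Let `n ≥ 2`, `S ⊆ ℝ^n` a Borel
measurable set symmetric about the origin, and `k, β` integers with
`1 ≤ k ≤ β ≤ √(n/2)` and `β − k` odd. Then
`∫_{X_n} Σ_{h=β+1}^{∞} (−1)^{h−k} C(h−1,k−1) ρ_{S',h}(L) dμ_n(L) ≥ 0`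
(the integrand being a finite sum for `μ_n`-almost every `L`, since `ρ_{S',h}(L) = 0`
for `h > |L ∩ S'|` when `L ∩ S'` is finite). -/
theorem stmt9 (n k β : ℕ) (hn : 2 ≤ n) (hk : 1 ≤ k) (hkβ : k ≤ β)
    (hβ : (β : ℝ) ≤ Real.sqrt ((n : ℝ) / 2)) (hodd : Odd (β - k))
    (S : Set (Fin n → ℝ)) (hSmeas : MeasurableSet S)
    (hSsymm : ∀ x, x ∈ S ↔ -x ∈ S)
    (μ : MeasureTheory.Measure (LatSpace n)) [MeasureTheory.IsProbabilityMeasure μ]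
    (hinv : ∀ a : SLR n, μ.map (rTranslate n a) = μ)
    (f : LatSpace n → ℝ)
    (hf : ∀ g : SLR n, f (latMk n g) =
      ∑' h : ℕ, (if β + 1 ≤ h then
        ((-1 : ℝ)) ^ (h - k) * ((h - 1).choose (k - 1)) * (rhoSub n S h g : ℝ)
      else 0)) :
    0 ≤ ∫ x, f x ∂μ := by
  refine integral_nonneg fun x => ?_
  obtain ⟨g, rfl⟩ : ∃ g, latMk n g = x := Quotient.exists_rep x
  rw [Pi.zero_apply, hf]
  rcases (latticeOf n g ∩ posHalf n S).finite_or_infinite with hA | hA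
  · set N := (latticeOf n g ∩ posHalf n S).ncard
    have hrho (h : ℕ) : rhoSub n S h g = N.choose h := hA.card_finset_subsets h
    rw [tsum_eq_sum (s := Finset.Ico (β + 1) (β + 1 + N)), Finset.sum_Ico_eq_sum_range,
      Nat.add_sub_cancel_left]
    · refine (bonferroni_tail_nonneg (d := k - 1) (b := β) (by omega) N N le_rfl).trans_eq
        (Finset.sum_congr rfl fun t _ => ?_)
      have heven : Even (β + 1 - k) := by
        rw [Nat.sub_add_comm hkβ]
        exact hodd.add_one
      rw [if_pos (by omega), hrho, show β + 1 + t - k = (β + 1 - k) + t by omega, pow_add,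
        heven.neg_one_pow, show β + 1 + t - 1 = β + t by omega, one_mul,
        show β + 1 + t = β + t + 1 by ring]
    · intro h hh
      rw [Finset.mem_Ico] at hh
      split_ifs
      · rw [hrho, Nat.choose_eq_zero_of_lt (show N < h by omega), Nat.cast_zero, mul_zero]
      · rfl
  · refine tsum_nonneg fun h => ?_
    split_ifs
    · rw [rhoSub, hA.card_finset_subsets (by omega), Nat.cast_zero, mul_zero]
    · rfl
end

section
/- Let k, α, M be integers with 1 ≤ k ≤ α, α − k even, and M ≥ α + 1. Then Σ_{h=α+1}^{M} (−1)^{h−k} · C(h−1, k−1) · C(M, h) ≤ 0. -/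
/-- Partial alternating sums of a row of Pascal's triangle telescope. -/
lemma alternating_sum_choose_add (n b L : ℕ) :
    ∑ i ∈ Finset.range L, (-1 : ℤ) ^ i * (n + 1).choose (b + 1 + i) =
      n.choose b - (-1) ^ L * n.choose (b + L) := by
  induction L with
  | zero => simp
  | succ L ih =>
    rw [Finset.sum_range_succ, ih, show b + 1 + L = (b + L) + 1 by ring,
      Nat.choose_succ_succ, ← add_assoc]
    push_cast
    ring

/-- Alternating tail sums of `C(h - 1, r) * C(M, h)` over `h > r + 1 + b` are nonnegative. -/
lemma alternating_sum_choose_mul_choose_nonneg (r b L M : ℕ) (hM : M ≤ r + 1 + b + L) :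
    0 ≤ ∑ i ∈ Finset.range L,
      (-1 : ℤ) ^ i * (r + 1 + b + i).choose r * M.choose (r + 1 + b + i + 1) := by
  induction M with
  | zero => simp
  | succ M ih =>
    have hpascal (i : ℕ) :
        (-1 : ℤ) ^ i * (r + 1 + b + i).choose r * (M + 1).choose (r + 1 + b + i + 1) =
          (-1 : ℤ) ^ i * (r + 1 + b + i).choose r * M.choose (r + 1 + b + i + 1) +
            M.choose r * ((-1 : ℤ) ^ i * (M - r).choose (b + 1 + i)) := by
      have hmul : M.choose (r + 1 + b + i) * (r + 1 + b + i).choose r =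
          M.choose r * (M - r).choose (b + 1 + i) := by
        rcases le_or_gt (r + 1 + b + i) M with h | h
        · rw [Nat.choose_mul (by omega)]
          congr 2
          omega
        · rw [Nat.choose_eq_zero_of_lt h, Nat.choose_eq_zero_of_lt (n := M - r) (by omega)]
          simp
      rw [Nat.choose_succ_succ]
      push_cast
      linear_combination (-1 : ℤ) ^ i * (by exact_mod_cast hmul :
        (M.choose (r + 1 + b + i) * (r + 1 + b + i).choose r : ℤ) =
          M.choose r * (M - r).choose (b + 1 + i))
    simp_rw [hpascal, Finset.sum_add_distrib, ← Finset.mul_sum]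
    refine add_nonneg (ih (by omega)) (mul_nonneg (by positivity) ?_)
    rcases le_or_gt M r with h | h
    · simp [Nat.sub_eq_zero_of_le h, Nat.choose_eq_zero_of_lt, add_right_comm b 1]
    · obtain ⟨n, rfl⟩ := Nat.exists_eq_add_of_lt h
      rw [show r + n + 1 - r = n + 1 by omega, alternating_sum_choose_add,
        Nat.choose_eq_zero_of_lt (k := b + L) (by omega)]
      simp

/-- **Lemma (tail sum, even case).** Let `k, α, M` be integers with `1 ≤ k ≤ α`,
`α − k` even, and `M ≥ α + 1`. Then
`Σ_{h=α+1}^{M} (−1)^{h−k} · C(h−1, k−1) · C(M, h) ≤ 0`. -/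
theorem stmt10 (k α M : ℕ) (hk : 1 ≤ k) (hkα : k ≤ α) (heven : Even (α - k))
    (hM : α + 1 ≤ M) :
    ∑ h ∈ Finset.Icc (α + 1) M,
        ((-1 : ℤ)) ^ (h - k) * ((h - 1).choose (k - 1)) * (M.choose h) ≤ 0 := by
  obtain ⟨r, rfl⟩ := Nat.exists_eq_add_of_le' hk
  obtain ⟨b, rfl⟩ := Nat.exists_eq_add_of_le hkα
  rw [Nat.add_sub_cancel_left] at heven
  have hnonneg := alternating_sum_choose_mul_choose_nonneg r b (M - (r + 1 + b)) M (by omega)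
  rw [← Finset.Ico_add_one_right_eq_Icc, Finset.sum_Ico_eq_sum_range,
    show M + 1 - (r + 1 + b + 1) = M - (r + 1 + b) by omega, ← neg_nonneg,
    ← Finset.sum_neg_distrib]
  convert hnonneg using 2 with i
  rw [show r + 1 + b + 1 + i - (r + 1) = b + (i + 1) by omega,
    show r + 1 + b + 1 + i = r + 1 + b + i + 1 by ring, pow_add, heven.neg_one_pow]
  simp [pow_succ]
end

section
/- For every real number λ, every integer k ≥ 0 and every integer α ≥ k, one has Σ_{j=0}^{k} e_{α−j}(−λ) · λ^j / j! = 1 + Σ_{h=k+1}^{α} (−1)^{h−k} · C(h−1, k) · λ^h / h!, where e_m(x) = Σ_{i=0}^{m} x^i / i! denotes the m-th Taylor partial sum of the exponential function. (Equivalently, the difference from the Poisson tail: P_λ(k) = e^{−λ} Σ_{j=0}^k λ^j/j! is obtained in the limit α → ∞.) -/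
open scoped Nat

/-- The homogeneous part of degree `k + m + 1` of `exp (-x) * exp x`, truncated at `j ≤ k`. -/
theorem sum_range_neg_pow_div_factorial_mul (x : ℝ) (k m : ℕ) :
    ∑ j ∈ Finset.range (k + 1), (-x) ^ (k + m + 1 - j) / (k + m + 1 - j)! * x ^ j / (j)!
      = (-1) ^ (m + 1) * ((k + m).choose k) * x ^ (k + m + 1) / (k + m + 1)! := by
  induction k generalizing m with
  | zero => simp [neg_pow x]
  | succ k ih =>
    have hih := ih (m + 1)
    rw [show k + (m + 1) + 1 = k + 1 + m + 1 by ring, show k + (m + 1) = k + 1 + m by ring] at hih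
    rw [Finset.sum_range_succ, hih, show k + 1 + m + 1 - (k + 1) = m + 1 by omega]
    have hfact : ((k + 1 + m + 1)! : ℝ)
        = ((k + 1 + m).choose k + (k + 1 + m).choose (k + 1)) * (k + 1)! * (m + 1)! := by
      have h := Nat.add_choose_mul_factorial_mul_factorial (m + 1) (k + 1)
      rw [show m + 1 + (k + 1) = k + 1 + m + 1 by ring, Nat.choose_succ_succ',
        mul_right_comm] at h
      exact_mod_cast h.symm
    have hlast : (-x) ^ (m + 1) / (m + 1)! * x ^ (k + 1) / (k + 1)!
        = (-1) ^ (m + 1) * ((k + 1 + m).choose k + (k + 1 + m).choose (k + 1))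
          * x ^ (k + 1 + m + 1) / (k + 1 + m + 1)! := by
      have hpos : ((k + 1 + m + 1)! : ℝ) ≠ 0 := by positivity
      rw [eq_div_iff hpos, hfact, neg_pow x]
      field_simp
      ring
    rw [hlast]
    ring

/-- Raising the truncation order of the inner exponential sums by one. -/
theorem sum_range_partial_exp_succ (x : ℝ) (k m : ℕ) :
    ∑ j ∈ Finset.range (k + 1),
        (∑ i ∈ Finset.range (k + (m + 1) - j + 1), (-x) ^ i / (i)!) * x ^ j / (j)!
      = ∑ j ∈ Finset.range (k + 1),
          (∑ i ∈ Finset.range (k + m - j + 1), (-x) ^ i / (i)!) * x ^ j / (j)!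
        + (-1) ^ (m + 1) * ((k + m).choose k) * x ^ (k + m + 1) / (k + m + 1)! := by
  rw [← sum_range_neg_pow_div_factorial_mul, ← Finset.sum_add_distrib]
  refine Finset.sum_congr rfl fun j hj => ?_
  have hjk := Finset.mem_range.mp hj
  rw [show k + (m + 1) - j + 1 = (k + m - j + 1) + 1 by omega, Finset.sum_range_succ,
    show k + m + 1 - j = k + m - j + 1 by omega]
  ring

theorem sum_range_partial_exp_self (x : ℝ) (k : ℕ) :
    ∑ j ∈ Finset.range (k + 1),
        (∑ i ∈ Finset.range (k - j + 1), (-x) ^ i / (i)!) * x ^ j / (j)! = 1 := by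
  induction k with
  | zero => simp
  | succ k ih =>
    have h := sum_range_partial_exp_succ x k 0
    simp only [zero_add, add_zero, ih] at h
    rw [Finset.sum_range_succ, h]
    simp
    ring

/-- **Lemma (partial exponential sums identity).** For every real `λ`, every integer
`k ≥ 0` and every integer `α ≥ k`, writing `e_m(x) = Σ_{i=0}^{m} x^i/i!`, one has
`Σ_{j=0}^{k} e_{α−j}(−λ) · λ^j / j! = 1 + Σ_{h=k+1}^{α} (−1)^{h−k} · C(h−1, k) · λ^h / h!`. -/
theorem stmt12 (lam : ℝ) (k α : ℕ) (hkα : k ≤ α) :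
    ∑ j ∈ Finset.range (k + 1),
        (∑ i ∈ Finset.range (α - j + 1), (-lam) ^ i / (i)!) * lam ^ j / (j)!
      = 1 + ∑ h ∈ Finset.Icc (k + 1) α,
          ((-1 : ℝ)) ^ (h - k) * ((h - 1).choose k) * lam ^ h / (h)! := by
  obtain ⟨m, rfl⟩ := Nat.exists_eq_add_of_le hkα
  clear hkα
  induction m with
  | zero => simp [sum_range_partial_exp_self]
  | succ m ih =>
    rw [sum_range_partial_exp_succ, ih, ← add_assoc k m 1,
      Finset.sum_Icc_succ_top (by omega : k + 1 ≤ k + m + 1),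
      show k + m + 1 - k = m + 1 by omega, Nat.add_sub_cancel, add_assoc]
end

section
/- For every real λ ≥ 0 and every positive integer m, one has λ^m / m! ≤ (1/√m) · (λe/m)^m; consequently, for every real λ > 0 and every positive integer m with m ≥ 16λ, the Taylor remainder satisfies |e^{−λ} − e_{m−1}(−λ)| ≤ λ^m/m! < (1/√m) · e^{−λ}. -/
open scoped Nat

theorem hasDerivAt_pow_succ_div_factorial (n : ℕ) (x : ℝ) :
    HasDerivAt (fun y : ℝ => y ^ (n + 1) / (n + 1)!) (x ^ n / n !) x := by
  refine ((hasDerivAt_pow (n + 1) x).div_const ((n + 1)! : ℝ)).congr_deriv ?_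
  rw [Nat.factorial_succ, Nat.add_sub_cancel]
  push_cast
  field_simp

theorem hasDerivAt_sum_neg_pow_div_factorial (n : ℕ) (x : ℝ) :
    HasDerivAt (fun y : ℝ => ∑ i ∈ Finset.range (n + 1), (-y) ^ i / i !)
      (-∑ i ∈ Finset.range n, (-x) ^ i / i !) x := by
  simp_rw [Finset.sum_range_succ' _ n, ← Finset.sum_neg_distrib]
  simp only [pow_zero]
  refine (HasDerivAt.fun_sum fun i _ => ?_).add_const _
  exact ((hasDerivAt_pow_succ_div_factorial i (-x)).comp x (hasDerivAt_neg x)).congr_deriv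
    (mul_neg_one _)

theorem abs_exp_neg_sub_sum_le (n : ℕ) {x : ℝ} (hx : 0 ≤ x) :
    |Real.exp (-x) - ∑ i ∈ Finset.range n, (-x) ^ i / i !| ≤ x ^ n / n ! := by
  induction n generalizing x with
  | zero => simpa using hx
  | succ n ih =>
    have hderiv (y : ℝ) : HasDerivAt
        (fun y : ℝ => Real.exp (-y) - ∑ i ∈ Finset.range (n + 1), (-y) ^ i / i !)
        (-(Real.exp (-y) - ∑ i ∈ Finset.range n, (-y) ^ i / i !)) y := by
      refine ((hasDerivAt_neg y).exp.sub
        (hasDerivAt_sum_neg_pow_div_factorial n y)).congr_deriv ?_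
      ring
    refine image_norm_le_of_norm_deriv_right_le_deriv_boundary (a := 0) (b := x)
      (fun y _ => (hderiv y).continuousAt.continuousWithinAt)
      (fun y _ => (hderiv y).hasDerivWithinAt) ?_ (hasDerivAt_pow_succ_div_factorial n)
      (fun y hy => ?_) ⟨hx, le_rfl⟩
    · simp [Finset.sum_range_succ']
    · rw [norm_neg]
      exact ih hy.1

theorem pow_div_factorial_le {x : ℝ} (hx : 0 ≤ x) {n : ℕ} (hn : 0 < n) :
    x ^ n / n ! ≤ (1 / √n) * (x * Real.exp 1 / n) ^ n := by
  have hn' : (0 : ℝ) < n := Nat.cast_pos.mpr hn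
  have hstirling : √n * (n / Real.exp 1) ^ n ≤ n ! := by
    refine le_trans ?_ (Stirling.le_factorial_stirling n)
    gcongr
    nlinarith [Real.pi_gt_three]
  calc x ^ n / n ! ≤ x ^ n / (√n * (n / Real.exp 1) ^ n) := by gcongr
    _ = (1 / √n) * (x * Real.exp 1 / n) ^ n := by
      rw [div_pow, div_pow, mul_pow]
      field_simp

theorem mul_exp_one_div_pow_lt_exp_neg {x : ℝ} {n : ℕ} (hx : 0 ≤ x) (hn : 0 < n)
    (hxn : 16 * x ≤ n) : (x * Real.exp 1 / n) ^ n < Real.exp (-x) := by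
  have hn' : (0 : ℝ) < n := Nat.cast_pos.mpr hn
  have hexp : Real.exp 1 < 16 * Real.exp (-(1 / 16)) := by
    have h : Real.exp 1 * Real.exp (1 / 16) < 16 := by
      have h1 := Real.exp_one_lt_three
      have h2 : Real.exp (1 / 16) ≤ Real.exp 1 := Real.exp_le_exp.mpr (by norm_num)
      nlinarith [Real.exp_pos 1, Real.exp_pos (1 / 16)]
    rw [Real.exp_neg, ← div_eq_mul_inv, lt_div_iff₀ (Real.exp_pos _)]
    exact h
  have hbase : x * Real.exp 1 / n < Real.exp (-(1 / 16)) := by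
    rw [div_lt_iff₀ hn']
    nlinarith [Real.exp_pos 1, Real.exp_pos (-(1 / 16))]
  calc (x * Real.exp 1 / n) ^ n < Real.exp (-(1 / 16)) ^ n :=
        pow_lt_pow_left₀ hbase (by positivity) hn.ne'
    _ = Real.exp (n * -(1 / 16)) := (Real.exp_nat_mul _ _).symm
    _ ≤ Real.exp (-x) := Real.exp_le_exp.mpr (by linarith)

/-- **Lemma (Stirling bound and Taylor remainder).** For every real `λ ≥ 0` and every
positive integer `m`, one has `λ^m/m! ≤ (1/√m)·(λe/m)^m`; consequently, for every real
`λ > 0` and positive integer `m` with `m ≥ 16λ`, the Taylor remainder of the exponential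
satisfies `|e^{−λ} − e_{m−1}(−λ)| ≤ λ^m/m! < (1/√m)·e^{−λ}`, where
`e_{m−1}(x) = Σ_{i=0}^{m−1} x^i/i!`. -/
theorem stmt14 :
    (∀ (lam : ℝ), 0 ≤ lam → ∀ m : ℕ, 0 < m →
      lam ^ m / (m)! ≤ (1 / Real.sqrt m) * (lam * Real.exp 1 / (m : ℝ)) ^ m) ∧
    (∀ (lam : ℝ), 0 < lam → ∀ m : ℕ, 0 < m → 16 * lam ≤ (m : ℝ) →
      |Real.exp (-lam) - ∑ i ∈ Finset.range m, (-lam) ^ i / (i)!| ≤ lam ^ m / (m)! ∧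
      lam ^ m / (m)! < (1 / Real.sqrt m) * Real.exp (-lam)) := by
  refine ⟨fun lam hlam m hm => pow_div_factorial_le hlam hm, fun lam hlam m hm hlm =>
    ⟨abs_exp_neg_sub_sum_le m hlam.le, (pow_div_factorial_le hlam.le hm).trans_lt ?_⟩⟩
  have := mul_exp_one_div_pow_lt_exp_neg hlam.le hm hlm
  gcongr
end
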